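/- arXiv:1905.08568 — 7 statements merged into one kernel-verified Lean document; each statement's English description precedes it below -/
import Mathlib

section
/- Let λ be a positive integer and let M be the adjacency matrix of a doubly-regular tournament with parameters (4λ+3, 2λ+1, λ), with Laplacian Q = (2λ+1)·I − M. Then there exist a finite abelian group K₂ with exactly (4λ+3)^(2λ) elements and an isomorphism of abelian groups between the cokernel of Q and ℤ ⊕ (ℤ/(λ+1)ℤ)^(2λ+1) ⊕ K₂. -/
open Matrix

theorem AddMonoidHom.nonempty_addEquiv_prod_ker {H A : Type*} [AddCommGroup H] [AddCommGroup A]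
    [Finite H] (f : H →+ A) (hf : Function.Surjective f) {b : ℕ}
    (hH : Nat.card H = Nat.card A * b) (hab : (Nat.card A).Coprime b) :
    Nat.card f.ker = b ∧ Nonempty (H ≃+ A × f.ker) := by
  have : Finite A := Finite.of_surjective f hf
  have hker : Nat.card f.ker = b := by
    have h1 := AddSubgroup.card_eq_card_quotient_mul_card_addSubgroup f.ker
    rw [Nat.card_congr (QuotientAddGroup.quotientKerEquivOfSurjective f hf).toEquiv, hH] at h1
    exact (Nat.eq_of_mul_eq_mul_left Nat.card_pos h1).symm
  refine ⟨hker, ?_⟩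
  let g : H →+ f.ker := (nsmulAddMonoidHom (Nat.card A)).codRestrict f.ker fun x => by
    rw [AddMonoidHom.mem_ker, nsmulAddMonoidHom_apply, map_nsmul, card_nsmul_eq_zero']
  have hinj : Function.Injective (f.prod g) := by
    rw [injective_iff_map_eq_zero]
    intro x hx
    have hx1 : f x = 0 := congrArg Prod.fst hx
    have hx2 : Nat.card A • x = 0 := congrArg (fun y => (y.2 : H)) hx
    have hx3 : b • x = 0 := by
      have := card_nsmul_eq_zero' (G := f.ker) (x := ⟨x, hx1⟩)
      rw [hker] at this
      exact congrArg Subtype.val this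
    rw [← AddMonoid.addOrderOf_eq_one_iff]
    exact Nat.eq_one_of_dvd_coprimes hab (addOrderOf_dvd_of_nsmul_eq_zero hx2)
      (addOrderOf_dvd_of_nsmul_eq_zero hx3)
  exact ⟨AddEquiv.ofBijective (f.prod g) ((Nat.bijective_iff_injective_and_card _).2
    ⟨hinj, by rw [Nat.card_prod, hker, hH]⟩)⟩

theorem Matrix.natCard_quotient_span_rows {ι : Type*} [Fintype ι] [DecidableEq ι]
    (N : Matrix ι ι ℤ) (hN : N.det ≠ 0) :
    Nat.card ((ι → ℤ) ⧸ Submodule.span ℤ (Set.range N.row)) = N.det.natAbs := by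
  have hinj : Function.Injective N.vecMulLinear := by
    rw [← LinearMap.ker_eq_bot, LinearMap.ker_eq_bot']
    intro v hv
    by_contra hv0
    exact hN (exists_vecMul_eq_zero_iff.1 ⟨v, hv0, hv⟩)
  rw [← range_vecMulLinear, ← Submodule.natAbs_det_equiv _ (LinearEquiv.ofInjective _ hinj)]
  have : (LinearMap.range N.vecMulLinear).subtype ∘ₗ AddMonoidHom.toIntLinearMap
      ((LinearEquiv.ofInjective _ hinj : (ι → ℤ) ≃ₗ[ℤ] _) : (ι → ℤ) →+ _) = Nᵀ.toLin' := by
    ext v i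
    simp
  rw [this, LinearMap.det_toLin', det_transpose]

theorem IsIdempotentElem.nonempty_basis_range {R ι : Type*} [CommRing R] [Finite (MaximalSpectrum R)]
    [Fintype ι] [DecidableEq ι] {A : Matrix ι ι R} (hA : IsIdempotentElem A) (r : ℕ)
    (hr : ∀ P : MaximalSpectrum R, letI := Ideal.Quotient.field P.1
      (A.map (Ideal.Quotient.mk P.1)).rank = r) :
    Nonempty (Module.Basis (Fin r) R (LinearMap.range A.toLin')) := by
  let i := (LinearMap.range A.toLin').subtype
  let q := A.toLin'.rangeRestrict
  have hqi : q ∘ₗ i = LinearMap.id := by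
    ext1 ⟨x, y, hy⟩
    apply Subtype.ext
    simp only [toLin'_apply] at hy
    simp [i, q, ← hy, hA.eq]
  have hiq : i ∘ₗ q = A.toLin' := rfl
  have hproj : Module.Projective R (LinearMap.range A.toLin') := .of_split i q hqi
  have hfin : Module.Finite R (LinearMap.range A.toLin') := inferInstance
  refine Module.nonempty_basis_of_flat_of_finrank_eq R _ r fun P => ?_
  let := Ideal.Quotient.field P.1
  have hqi' : q.baseChange (R ⧸ P.1) ∘ₗ i.baseChange (R ⧸ P.1) = LinearMap.id := by
    rw [← LinearMap.baseChange_comp, hqi, LinearMap.baseChange_id]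
  have hiq' : i.baseChange (R ⧸ P.1) ∘ₗ q.baseChange (R ⧸ P.1) =
      A.toLin'.baseChange (R ⧸ P.1) := by
    rw [← LinearMap.baseChange_comp, hiq]
  have hq : Function.Surjective (q.baseChange (R ⧸ P.1)) :=
    fun x => ⟨i.baseChange (R ⧸ P.1) x, LinearMap.congr_fun hqi' x⟩
  have hi : Function.Injective (i.baseChange (R ⧸ P.1)) :=
    Function.LeftInverse.injective (LinearMap.congr_fun hqi')
  rw [← hr P, rank_eq_finrank_range_toLin _
    (Algebra.TensorProduct.basis (R ⧸ P.1) (Pi.basisFun R ι))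
    (Algebra.TensorProduct.basis (R ⧸ P.1) (Pi.basisFun R ι))]
  have hlin : toLin (Algebra.TensorProduct.basis (R ⧸ P.1) (Pi.basisFun R ι))
      (Algebra.TensorProduct.basis (R ⧸ P.1) (Pi.basisFun R ι))
      (A.map (Ideal.Quotient.mk P.1)) = A.toLin'.baseChange (R ⧸ P.1) := by
    apply (LinearMap.toMatrix (Algebra.TensorProduct.basis (R ⧸ P.1) (Pi.basisFun R ι))
      (Algebra.TensorProduct.basis (R ⧸ P.1) (Pi.basisFun R ι))).injective
    rw [LinearMap.toMatrix_toLin, LinearMap.toMatrix_baseChange]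
    simp [LinearMap.toMatrix_eq_toMatrix']
  rw [hlin, ← hiq', LinearMap.range_comp, LinearMap.range_eq_top.2 hq, Submodule.map_top]
  exact (LinearMap.finrank_range_of_inj hi).symm

/-- The matrix identities satisfied by the adjacency matrix of a doubly-regular tournament with
parameters `(4 * lam + 3, 2 * lam + 1, lam)`, over an arbitrary commutative ring. -/
structure IsDoublyRegular {ι R : Type*} [Fintype ι] [DecidableEq ι] [CommRing R]
    (lam : ℕ) (M : Matrix ι ι R) : Prop where
  card_eq : Fintype.card ι = 4 * lam + 3
  add_transpose : M + Mᵀ = Matrix.of (fun _ _ => 1) - 1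
  mul_transpose : M * Mᵀ = ((lam : R) + 1) • (1 : Matrix ι ι R)
    + (lam : R) • Matrix.of (fun _ _ => 1)
  mul_ones : M * Matrix.of (fun _ _ => 1) = (2 * (lam : R) + 1) • Matrix.of (fun _ _ => 1)

namespace IsDoublyRegular

variable {ι R : Type*} [Fintype ι] [DecidableEq ι] [CommRing R] {lam : ℕ} {M : Matrix ι ι R}

theorem map {S : Type*} [CommRing S] (h : IsDoublyRegular lam M) (f : R →+* S) :
    IsDoublyRegular lam (M.map f) where
  card_eq := h.card_eq
  add_transpose := by
    ext i j
    have := congrArg f (congrFun (congrFun h.add_transpose i) j)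
    simpa [Matrix.one_apply, apply_ite f] using this
  mul_transpose := by
    ext i j
    have := congrArg f (congrFun (congrFun h.mul_transpose i) j)
    simpa [Matrix.mul_apply, Matrix.one_apply, apply_ite f] using this
  mul_ones := by
    ext i j
    have := congrArg f (congrFun (congrFun h.mul_ones i) j)
    simpa [Matrix.mul_apply, map_ofNat f] using this

theorem ones_mul_ones (h : IsDoublyRegular lam M) :
    (Matrix.of (fun _ _ => 1) : Matrix ι ι R) * Matrix.of (fun _ _ => 1) =
      (4 * (lam : R) + 3) • Matrix.of (fun _ _ => 1) := by
  ext i j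
  simp [Matrix.mul_apply, h.card_eq]

theorem transpose_eq (h : IsDoublyRegular lam M) :
    Mᵀ = Matrix.of (fun _ _ => 1) - 1 - M := by
  rw [← h.add_transpose]; abel

theorem transpose_mul_ones (h : IsDoublyRegular lam M) :
    Mᵀ * Matrix.of (fun _ _ => 1) = (2 * (lam : R) + 1) • Matrix.of (fun _ _ => 1) := by
  rw [h.transpose_eq, sub_mul, sub_mul, one_mul, h.ones_mul_ones, h.mul_ones]
  module

theorem ones_mul (h : IsDoublyRegular lam M) :
    Matrix.of (fun _ _ => 1) * M = (2 * (lam : R) + 1) • Matrix.of (fun _ _ => 1) := by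
  have := congrArg transpose h.transpose_mul_ones
  rw [transpose_mul, transpose_transpose] at this
  exact this

theorem mul_self (h : IsDoublyRegular lam M) :
    M * M = ((lam : R) + 1) • (Matrix.of (fun _ _ => 1) - 1) - M := by
  have hM : M = Matrix.of (fun _ _ => 1) - 1 - Mᵀ := by rw [← h.add_transpose]; abel
  conv_lhs =>
    congr
    · skip
    · rw [hM]
  rw [mul_sub, mul_sub, mul_one, h.mul_transpose, h.mul_ones]
  module

/-- Modulo `lam + 1`, the matrix `1 + M` is idempotent. -/
theorem isIdempotentElem_one_add (h : IsDoublyRegular lam M) (hR : (lam : R) + 1 = 0) :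
    IsIdempotentElem (1 + M) := by
  rw [IsIdempotentElem, mul_add, add_mul, add_mul, h.mul_self, hR]
  simp

theorem one_add_mul_one_add_transpose (h : IsDoublyRegular lam M)
    (hR : (lam : R) + 1 = 0) : (1 + M) * (1 + Mᵀ) = 0 := by
  have : (1 + M) * (1 + Mᵀ) = 1 + (M + Mᵀ) + M * Mᵀ := by noncomm_ring
  rw [this, h.add_transpose, h.mul_transpose, eq_neg_of_add_eq_zero_left hR]
  module

theorem one_add_mul_laplacian_transpose (h : IsDoublyRegular lam M) (hR : (lam : R) + 1 = 0) :
    (1 + M) * ((2 * (lam : R) + 1) • (1 : Matrix ι ι R) - M)ᵀ = 0 := by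
  have : ((2 * (lam : R) + 1) • (1 : Matrix ι ι R) - M)ᵀ = -(1 + Mᵀ) := by
    rw [transpose_sub, transpose_smul, transpose_one, eq_neg_of_add_eq_zero_left hR]
    module
  rw [this, mul_neg, h.one_add_mul_one_add_transpose hR, neg_zero]

theorem one_add_mul_ones (h : IsDoublyRegular lam M) (hR : (lam : R) + 1 = 0) :
    (1 + M) * Matrix.of (fun _ _ => 1) = 0 := by
  rw [add_mul, one_mul, h.mul_ones, eq_neg_of_add_eq_zero_left hR]
  module

theorem rank_one_add {K : Type*} [Field K] {M : Matrix ι ι K}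
    (h : IsDoublyRegular lam M) (hK : (lam : K) + 1 = 0) :
    (1 + M).rank = 2 * lam + 1 := by
  have htr : (1 + M).rank = (1 + Mᵀ).rank := by
    rw [← rank_transpose, transpose_add, transpose_one]
  have hle := rank_add_rank_le_card_of_mul_eq_zero (h.one_add_mul_one_add_transpose hK)
  have htop : LinearMap.range (1 + M).mulVecLin ⊔ LinearMap.range (1 + Mᵀ).mulVecLin ⊔
      Submodule.span K {(1 : ι → K)} = ⊤ := by
    refine eq_top_iff.2 fun x _ => ?_
    have hx : x = (1 + M) *ᵥ x + (1 + Mᵀ) *ᵥ x - (∑ i, x i) • (1 : ι → K) := by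
      have h1 : (1 + M) + (1 + Mᵀ) - Matrix.of (fun _ _ => 1) = 1 := by
        have : (1 + M) + (1 + Mᵀ) = 1 + 1 + (M + Mᵀ) := by abel
        rw [this, h.add_transpose]; abel
      conv_lhs => rw [← one_mulVec x, ← h1, sub_mulVec, add_mulVec]
      congr 1
      ext i
      simp [mulVec, dotProduct]
    rw [hx]
    refine sub_mem (Submodule.mem_sup_left (add_mem ?_ ?_)) ?_
    · exact Submodule.mem_sup_left ⟨x, rfl⟩
    · exact Submodule.mem_sup_right ⟨x, rfl⟩
    · exact Submodule.mem_sup_right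
        (Submodule.smul_mem _ _ (Submodule.mem_span_singleton_self _))
  have h1 := Submodule.finrank_add_le_finrank_add_finrank
    (LinearMap.range (1 + M).mulVecLin ⊔ LinearMap.range (1 + Mᵀ).mulVecLin)
    (Submodule.span K {(1 : ι → K)})
  have h2 := Submodule.finrank_add_le_finrank_add_finrank
    (LinearMap.range (1 + M).mulVecLin) (LinearMap.range (1 + Mᵀ).mulVecLin)
  have h3 := finrank_span_le_card (R := K) {(1 : ι → K)}
  rw [htop, finrank_top, Module.finrank_fintype_fun_eq_card] at h1
  simp only [Set.toFinset_singleton, Finset.card_singleton] at h3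
  have hc := h.card_eq
  simp only [Matrix.rank] at *
  omega

theorem laplacian_mul_transpose (h : IsDoublyRegular lam M) :
    ((2 * (lam : R) + 1) • (1 : Matrix ι ι R) - M) *
      ((2 * (lam : R) + 1) • (1 : Matrix ι ι R) - M)ᵀ =
      ((lam : R) + 1) • ((4 * (lam : R) + 3) • (1 : Matrix ι ι R) - Matrix.of (fun _ _ => 1)) := by
  rw [transpose_sub, transpose_smul, transpose_one, sub_mul, mul_sub, mul_sub, h.mul_transpose,
    h.transpose_eq]
  simp only [smul_mul_assoc, mul_smul_comm, one_mul, mul_one]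
  module

theorem laplacian_mul_ones (h : IsDoublyRegular lam M) :
    ((2 * (lam : R) + 1) • (1 : Matrix ι ι R) - M) * Matrix.of (fun _ _ => 1) = 0 := by
  rw [sub_mul, h.mul_ones, smul_mul_assoc, one_mul, sub_self]

theorem ones_mul_laplacian (h : IsDoublyRegular lam M) :
    Matrix.of (fun _ _ => 1) * ((2 * (lam : R) + 1) • (1 : Matrix ι ι R) - M) = 0 := by
  rw [mul_sub, h.ones_mul, mul_smul_comm, mul_one, sub_self]

/-- The determinant of the Laplacian with one row replaced by the all-ones row. -/
theorem det_laplacian_updateRow_one_sq {K : Type*} [Field K] [CharZero K] {M : Matrix ι ι K}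
    (h : IsDoublyRegular lam M) (a : ι) :
    (((2 * (lam : K) + 1) • (1 : Matrix ι ι K) - M).updateRow a 1).det ^ 2 =
      ((((lam : K) + 1) * (4 * lam + 3)) ^ (2 * lam + 1)) ^ 2 := by
  set Q := (2 * (lam : K) + 1) • (1 : Matrix ι ι K) - M with hQ
  set m : K := (lam : K) + 1 with hm
  set n : K := 4 * (lam : K) + 3 with hn
  have hm0 : m ≠ 0 := by rw [hm]; exact_mod_cast Nat.succ_ne_zero lam
  have hn0 : n ≠ 0 := by rw [hn]; exact_mod_cast (by omega : 4 * lam + 3 ≠ 0)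
  have hcard : (Fintype.card ι : K) = n := by rw [h.card_eq, hn]; push_cast; rfl
  let u : ι → K := 1 - Pi.single a 1
  let d : ι → K := fun i => if i = a then n else m * n
  have hd0 : ∀ i, d i ≠ 0 := fun i => by
    simp only [d]; split_ifs <;> simp [hm0, hn0]
  have hrow (i : ι) : ∑ j, Q i j = 0 := by
    have := congrFun (congrFun h.laplacian_mul_ones i) i
    rw [← hQ, Matrix.mul_apply] at this
    simpa using this
  have hprod : Q.updateRow a 1 * (Q.updateRow a 1)ᵀ =
      diagonal d + replicateCol Unit (-m • u) * replicateRow Unit u := by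
    ext i j
    have hQQ := congrFun (congrFun h.laplacian_mul_transpose i) j
    rw [← hQ, Matrix.mul_apply] at hQQ
    rw [Matrix.mul_apply]
    by_cases hi : i = a <;> by_cases hj : j = a
    · subst hi hj
      simp [hcard, u, d, Matrix.mul_apply]
    · subst hi
      simp [hrow, hj, u, d, Matrix.mul_apply, Ne.symm hj]
    · subst hj
      simp [hrow, hi, u, d, Matrix.mul_apply]
    · simp only [transpose_apply, updateRow_ne hi, updateRow_ne hj] at hQQ ⊢
      rw [hQQ]
      by_cases hij : i = j
      · subst hij
        simp [hi, u, d, Matrix.mul_apply, hm, hn]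
        ring
      · simp [hi, hj, hij, u, d, Matrix.mul_apply, hm, hn]
  have hdet : (diagonal d).det = n * (m * n) ^ (4 * lam + 2) := by
    rw [det_diagonal, Finset.prod_ite, Finset.prod_const, Finset.prod_const,
      Finset.filter_eq' , Finset.filter_ne', if_pos (Finset.mem_univ a), Finset.card_singleton,
      Finset.card_erase_of_mem (Finset.mem_univ a), Finset.card_univ, h.card_eq, pow_one]
    rfl
  have hsum : ∑ i, u i * (d i)⁻¹ * (m * u i) = 1 - n⁻¹ := by
    have hterm : ∀ i, u i * (d i)⁻¹ * (m * u i) = n⁻¹ - if i = a then n⁻¹ else 0 := fun i => by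
      by_cases hi : i = a
      · subst hi; simp [u]
      · simp [u, d, hi]; field_simp
    simp_rw [hterm]
    rw [Finset.sum_sub_distrib, Finset.sum_const, Finset.card_univ, nsmul_eq_mul, hcard,
      mul_inv_cancel₀ hn0]
    simp
  have hinv : (diagonal d)⁻¹ = diagonal fun i => (d i)⁻¹ := by
    refine inv_eq_right_inv ?_
    rw [diagonal_mul_diagonal, ← diagonal_one]
    congr 1
    ext i
    exact mul_inv_cancel₀ (hd0 i)
  have hU : IsUnit (diagonal d).det := by
    rw [hdet, isUnit_iff_ne_zero]
    exact mul_ne_zero hn0 (pow_ne_zero _ (mul_ne_zero hm0 hn0))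
  have hsmall : (1 + replicateRow Unit u * (diagonal d)⁻¹ * replicateCol Unit (-m • u)).det =
      n⁻¹ := by
    rw [det_unique, hinv, Matrix.add_apply, Matrix.one_apply_eq, Matrix.mul_apply]
    simp only [mul_diagonal, replicateRow_apply, replicateCol_apply, Pi.smul_apply, smul_eq_mul,
      neg_mul, mul_neg, Finset.sum_neg_distrib]
    rw [hsum]
    ring
  calc _ = (Q.updateRow a 1 * (Q.updateRow a 1)ᵀ).det := by rw [det_mul, det_transpose, sq]
    _ = _ := by
      rw [hprod, det_add_replicateCol_mul_replicateRow hU, hsmall, hdet, ← pow_mul]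
      field_simp
      ring_nf

theorem natAbs_det_laplacian_updateRow_single {M : Matrix ι ι ℤ} (h : IsDoublyRegular lam M)
    (a : ι) :
    (((2 * (lam : ℤ) + 1) • (1 : Matrix ι ι ℤ) - M).updateRow a (Pi.single a 1)).det.natAbs =
      (lam + 1) ^ (2 * lam + 1) * (4 * lam + 3) ^ (2 * lam) := by
  set Q := (2 * (lam : ℤ) + 1) • (1 : Matrix ι ι ℤ) - M with hQ
  have hrow (i : ι) : ∑ j, Q i j = 0 := by
    have := congrFun (congrFun h.laplacian_mul_ones i) i
    rw [← hQ, Matrix.mul_apply] at this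
    simpa using this
  have hone : (Q.updateRow a 1).det = (4 * lam + 3) * (Q.updateRow a (Pi.single a 1)).det := by
    have hz : (Q.updateRow a (1 - (4 * (lam : ℤ) + 3) • Pi.single a 1)).det = 0 := by
      refine exists_mulVec_eq_zero_iff.1 ⟨1, fun h1 => one_ne_zero (congrFun h1 a), ?_⟩
      ext i
      by_cases hi : i = a
      · subst hi
        simp [mulVec, dotProduct, h.card_eq, Pi.single_apply]
      · simp [mulVec, dotProduct, hi, hrow]
    have : (1 : ι → ℤ) = (1 - (4 * (lam : ℤ) + 3) • Pi.single a 1) +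
        (4 * (lam : ℤ) + 3) • Pi.single a 1 := by abel
    rw [this, det_updateRow_add, hz, det_updateRow_smul, zero_add]
  have hsq : (Q.updateRow a 1).det ^ 2 =
      ((((lam : ℤ) + 1) * (4 * lam + 3)) ^ (2 * lam + 1)) ^ 2 := by
    have := (h.map (Int.castRingHom ℚ)).det_laplacian_updateRow_one_sq a
    have hmap : ((2 * (lam : ℚ) + 1) • (1 : Matrix ι ι ℚ) - M.map (Int.castRingHom ℚ)).updateRow a 1
        = (Q.updateRow a 1).map (Int.castRingHom ℚ) := by
      ext i j
      by_cases hi : i = a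
      · subst hi; simp
      · simp only [updateRow_ne hi, Matrix.map_apply, hQ, Matrix.sub_apply, Matrix.smul_apply,
          Matrix.one_apply, smul_eq_mul]
        split_ifs <;> simp
    rw [hmap, ← RingHom.mapMatrix_apply, ← RingHom.map_det] at this
    rw [eq_intCast] at this
    exact_mod_cast this
  have habs := Int.natAbs_eq_iff_sq_eq.2 hsq
  rw [hone, Int.natAbs_mul, Int.natAbs_pow, Int.natAbs_mul] at habs
  have e1 : (4 * (lam : ℤ) + 3).natAbs = 4 * lam + 3 := by omega
  have e2 : ((lam : ℤ) + 1).natAbs = lam + 1 := by omega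
  rw [e1, e2] at habs
  refine Nat.eq_of_mul_eq_mul_left (by omega : 0 < 4 * lam + 3) (habs.trans ?_)
  rw [mul_pow]
  ring

end IsDoublyRegular

/-- If every row of `Q` sums to zero, then the cokernel of `Q` splits off a copy of `ℤ`. -/
theorem Matrix.nonempty_quotient_span_rows_addEquiv_int_prod {ι : Type*} [Fintype ι]
    [DecidableEq ι] (Q : Matrix ι ι ℤ) (hrow : ∀ i, ∑ j, Q i j = 0) (hcol : ∑ i, Q.row i = 0)
    (a : ι) :
    Nonempty (((ι → ℤ) ⧸ Submodule.span ℤ (Set.range Q.row)) ≃+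
      ℤ × ((ι → ℤ) ⧸ Submodule.span ℤ (Set.range (Q.updateRow a (Pi.single a 1)).row))) := by
  set N := Q.updateRow a (Pi.single a 1) with hN
  have hNQ : Submodule.span ℤ (Set.range N.row) =
      Submodule.span ℤ (Set.range Q.row) ⊔ Submodule.span ℤ {Pi.single a 1} := by
    have hne {i : ι} (hi : i ≠ a) : N.row i = Q.row i := updateRow_ne hi
    have hself : N.row a = Pi.single a 1 := updateRow_self
    have hmem (i : ι) : N.row i ∈ Submodule.span ℤ (Set.range N.row) :=
      Submodule.subset_span ⟨i, rfl⟩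
    refine le_antisymm (Submodule.span_le.2 ?_) (sup_le (Submodule.span_le.2 ?_) ?_)
    · rintro _ ⟨i, rfl⟩
      by_cases hi : i = a
      · rw [hi, hself]
        exact Submodule.mem_sup_right (Submodule.mem_span_singleton_self _)
      · rw [hne hi]
        exact Submodule.mem_sup_left (Submodule.subset_span ⟨i, rfl⟩)
    · rintro _ ⟨i, rfl⟩
      by_cases hi : i = a
      · rw [← Finset.add_sum_erase _ _ (Finset.mem_univ a), ← hi] at hcol
        rw [eq_neg_of_add_eq_zero_left hcol]
        refine neg_mem (sum_mem fun j hj => ?_)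
        rw [← hne (hi ▸ (Finset.mem_erase.1 hj).1)]
        exact hmem j
      · rw [← hne hi]
        exact hmem i
    · rw [Submodule.span_singleton_le_iff_mem, ← hself]
      exact hmem a
  let s : (ι → ℤ) →ₗ[ℤ] ℤ := Fintype.linearCombination ℤ fun _ => 1
  have hs (x : ι → ℤ) : s x = ∑ i, x i := by simp [s, Fintype.linearCombination_apply]
  have hs0 : Submodule.span ℤ (Set.range Q.row) ≤ LinearMap.ker s := by
    rw [Submodule.span_le]
    rintro _ ⟨i, rfl⟩
    exact (hs _).trans (hrow i)
  let φ := s.prod (Submodule.span ℤ (Set.range N.row)).mkQ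
  have hker : LinearMap.ker φ = Submodule.span ℤ (Set.range Q.row) := by
    ext x
    rw [LinearMap.ker_prod, Submodule.ker_mkQ, Submodule.mem_inf, hNQ]
    refine ⟨fun ⟨h1, h2⟩ => ?_, fun hx => ⟨hs0 hx, Submodule.mem_sup_left hx⟩⟩
    obtain ⟨y, hy, z, hz, rfl⟩ := Submodule.mem_sup.1 h2
    obtain ⟨c, rfl⟩ := Submodule.mem_span_singleton.1 hz
    have hc : c = 0 := by
      have hy0 : s y = 0 := hs0 hy
      rw [LinearMap.mem_ker, map_add, hy0, map_smul, hs] at h1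
      simpa using h1
    simpa [hc] using hy
  have hsurj : Function.Surjective φ := by
    rintro ⟨c, y⟩
    obtain ⟨y, rfl⟩ := Submodule.mkQ_surjective _ y
    refine ⟨y + (c - s y) • Pi.single a 1, Prod.ext ?_ ?_⟩
    · change s _ = c
      rw [map_add, map_smul, hs (Pi.single a 1)]
      simp
    · change Submodule.mkQ _ _ = _
      rw [← sub_eq_zero, ← map_sub, add_sub_cancel_left, ← LinearMap.mem_ker, Submodule.ker_mkQ,
        hNQ]
      exact Submodule.mem_sup_right (Submodule.smul_mem _ _ (Submodule.mem_span_singleton_self _))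
  exact ⟨((Submodule.quotEquivOfEq _ _ hker.symm).trans
    (φ.quotKerEquivOfSurjective hsurj)).toAddEquiv⟩

/-- The cokernel of the Laplacian, reduced by one basis vector, surjects onto a free
`ZMod (lam + 1)`-module of rank `2 * lam + 1`. -/
theorem IsDoublyRegular.exists_surjective_quotient {ι : Type*} [Fintype ι] [DecidableEq ι]
    {lam : ℕ} {M : Matrix ι ι ℤ} (h : IsDoublyRegular lam M) (a : ι) :
    ∃ f : ((ι → ℤ) ⧸ Submodule.span ℤ (Set.range
      (((2 * (lam : ℤ) + 1) • (1 : Matrix ι ι ℤ) - M).updateRow a (Pi.single a 1)).row)) →+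
        (Fin (2 * lam + 1) → ZMod (lam + 1)), Function.Surjective f := by
  set Q := (2 * (lam : ℤ) + 1) • (1 : Matrix ι ι ℤ) - M with hQ
  have hR : (lam : ZMod (lam + 1)) + 1 = 0 := by exact_mod_cast ZMod.natCast_self (lam + 1)
  have hMR := h.map (Int.castRingHom (ZMod (lam + 1)))
  have : Finite (MaximalSpectrum (ZMod (lam + 1))) :=
    Finite.of_injective MaximalSpectrum.asIdeal fun _ _ => MaximalSpectrum.ext
  obtain ⟨b⟩ := (hMR.isIdempotentElem_one_add hR).nonempty_basis_range (2 * lam + 1) fun P => by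
    have hP : (lam : ZMod (lam + 1) ⧸ P.1) + 1 = 0 := by
      have := congrArg (Ideal.Quotient.mk P.1) hR
      rwa [map_add, map_natCast, map_one, map_zero] at this
    let := Ideal.Quotient.field P.1
    rw [← (hMR.map (Ideal.Quotient.mk P.1)).rank_one_add hP]
    congr 1
    ext i j
    simp [Matrix.one_apply, apply_ite (Ideal.Quotient.mk P.1)]
  set W := 1 + M.map (Int.castRingHom (ZMod (lam + 1))) with hW
  have hW1 : W *ᵥ (1 : ι → ZMod (lam + 1)) = 0 := by
    ext i
    have := congrFun (congrFun (hMR.one_add_mul_ones hR) i) i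
    rw [← hW, Matrix.mul_apply] at this
    simpa [mulVec, dotProduct] using this
  have hWQ (i : ι) : W *ᵥ (fun j => (Q i j : ZMod (lam + 1))) = 0 := by
    ext k
    have := congrFun (congrFun (hMR.one_add_mul_laplacian_transpose hR) k) i
    rw [← hW, Matrix.mul_apply] at this
    rw [mulVec, dotProduct, Pi.zero_apply]
    refine Eq.trans (Finset.sum_congr rfl fun j _ => ?_) this
    congr 1
    simp only [hQ, transpose_apply, Matrix.map_apply, Matrix.sub_apply, Matrix.smul_apply,
      Matrix.one_apply, smul_eq_mul]
    split_ifs <;> push_cast <;> simp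
  let red : (ι → ℤ) →+ (ι → ZMod (lam + 1)) :=
    { toFun := fun x j => ((x j : ℤ) : ZMod (lam + 1)) - if j = a then ((∑ i, x i : ℤ) : ZMod (lam + 1)) else 0
      map_zero' := by ext; simp
      map_add' := fun x y => by
        ext j
        simp only [Pi.add_apply, Int.cast_add, Finset.sum_add_distrib]
        split_ifs <;> ring }
  have hred (x : ι → ℤ) (j : ι) :
      red x j = ((x j : ℤ) : ZMod (lam + 1)) - if j = a then ((∑ i, x i : ℤ) : ZMod (lam + 1)) else 0 := rfl
  let g : (ι → ℤ) →+ (Fin (2 * lam + 1) → ZMod (lam + 1)) :=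
    (b.equivFun.toLinearMap ∘ₗ W.toLin'.rangeRestrict).toAddMonoidHom.comp red
  have hg0 {x : ι → ℤ} (hx : W *ᵥ red x = 0) : g x = 0 := by
    have : W.toLin'.rangeRestrict (red x) = 0 := Subtype.ext hx
    change b.equivFun (W.toLin'.rangeRestrict (red x)) = 0
    rw [this, map_zero]
  have hle : Submodule.span ℤ (Set.range (Q.updateRow a (Pi.single a 1)).row) ≤
      LinearMap.ker g.toIntLinearMap := by
    rw [Submodule.span_le]
    rintro _ ⟨i, rfl⟩
    refine hg0 ?_
    by_cases hi : i = a
    · have : red ((Q.updateRow a (Pi.single a 1)).row i) = 0 := by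
        ext j
        rw [hred, hi]
        by_cases hj : j = a <;> simp [hj]
      rw [this, mulVec_zero]
    · have hsum : ∑ j, Q i j = 0 := by
        have := congrFun (congrFun h.laplacian_mul_ones i) i
        rw [← hQ, Matrix.mul_apply] at this
        simpa using this
      rw [← hWQ i]
      congr 1
      ext j
      rw [hred]
      simp only [Matrix.row, updateRow_ne hi, hsum]
      simp
  refine ⟨(Submodule.liftQ _ g.toIntLinearMap hle).toAddMonoidHom, fun y => ?_⟩
  obtain ⟨z, hz⟩ := LinearMap.surjective_rangeRestrict W.toLin' (b.equivFun.symm y)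
  choose x hx using fun i => ZMod.intCast_surjective (z i)
  refine ⟨Submodule.Quotient.mk (x + (∑ i, x i) • 1), ?_⟩
  have hxr : red (x + (∑ i, x i) • 1) = z + ((∑ i, x i : ℤ) : ZMod (lam + 1)) • 1 := by
    ext j
    have hsum : ((∑ i, (x + (∑ i, x i) • (1 : ι → ℤ)) i : ℤ) : ZMod (lam + 1)) = 0 := by
      have : ∑ i, (x + (∑ i, x i) • (1 : ι → ℤ)) i = (∑ i, x i) * (4 * (lam + 1)) := by
        simp only [Pi.add_apply, Pi.smul_apply, Pi.one_apply, smul_eq_mul, mul_one,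
          Finset.sum_add_distrib, Finset.sum_const, Finset.card_univ, h.card_eq, nsmul_eq_mul]
        push_cast
        ring
      rw [this]
      push_cast
      rw [hR]
      ring
    rw [hred, hsum]
    simp [hx]
  change b.equivFun (W.toLin'.rangeRestrict (red _)) = y
  have : W.toLin'.rangeRestrict (red (x + (∑ i, x i) • 1)) = W.toLin'.rangeRestrict z := by
    refine Subtype.ext ?_
    change W *ᵥ _ = W *ᵥ _
    rw [hxr, mulVec_add, mulVec_smul, hW1, smul_zero, add_zero]
  rw [this, hz, LinearEquiv.apply_symm_apply]

theorem drt_critical_group (lam : ℕ) (hlam : 0 < lam)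
    (M : Matrix (Fin (4*lam+3)) (Fin (4*lam+3)) ℤ)
    (hM01 : ∀ i j, M i j = 0 ∨ M i j = 1)
    (hMdiag : ∀ i, M i i = 0)
    (hMskew : M + Mᵀ = Matrix.of (fun _ _ => 1) - 1)
    (hMMt : M * Mᵀ = ((lam : ℤ) + 1) • (1 : Matrix (Fin (4*lam+3)) (Fin (4*lam+3)) ℤ)
      + (lam : ℤ) • Matrix.of (fun _ _ => 1))
    (Q : Matrix (Fin (4*lam+3)) (Fin (4*lam+3)) ℤ)
    (hQ : Q = (2*(lam:ℤ)+1) • (1 : Matrix (Fin (4*lam+3)) (Fin (4*lam+3)) ℤ) - M) :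
    ∃ (K₂ : Type) (_ : AddCommGroup K₂),
      Nat.card K₂ = (4*lam+3)^(2*lam) ∧
      Nonempty (((Fin (4*lam+3) → ℤ) ⧸ Submodule.span ℤ (Set.range fun i => Q i)) ≃+
        ℤ × (Fin (2*lam+1) → ZMod (lam+1)) × K₂) := by
  have h : IsDoublyRegular lam M :=
    { card_eq := Fintype.card_fin _
      add_transpose := hMskew
      mul_transpose := hMMt
      mul_ones := by
        ext i j
        have hii := congrFun (congrFun hMMt i) i
        have hsq (k) : M i k * M i k = M i k := by rcases hM01 i k with hk | hk <;> simp [hk]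
        simp only [Matrix.mul_apply, transpose_apply, hsq, Matrix.add_apply, Matrix.smul_apply,
          Matrix.one_apply_eq, of_apply, smul_eq_mul, mul_one] at hii ⊢
        rw [hii]
        ring }
  have hrow (i) : ∑ j, Q i j = 0 := by
    have := congrFun (congrFun h.laplacian_mul_ones i) i
    rw [← hQ, Matrix.mul_apply] at this
    simpa using this
  have hcol : ∑ i, Q.row i = 0 := by
    ext j
    have := congrFun (congrFun h.ones_mul_laplacian j) j
    rw [← hQ, Matrix.mul_apply] at this
    simpa using this
  obtain ⟨e⟩ := nonempty_quotient_span_rows_addEquiv_int_prod Q hrow hcol 0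
  have hdet := h.natAbs_det_laplacian_updateRow_single 0
  have hsurj := h.exists_surjective_quotient 0
  rw [← hQ] at hdet hsurj
  obtain ⟨f, hf⟩ := hsurj
  have hcard := natCard_quotient_span_rows (Q.updateRow 0 (Pi.single 0 1))
    (Int.natAbs_ne_zero.1 (by rw [hdet]; positivity))
  rw [hdet] at hcard
  have := Nat.finite_of_card_ne_zero (hcard.trans_ne (by positivity))
  have hA : Nat.card (Fin (2 * lam + 1) → ZMod (lam + 1)) = (lam + 1) ^ (2 * lam + 1) := by
    simp
  have hcop : (lam + 1).Coprime (4 * lam + 3) := by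
    have : IsCoprime ((lam + 1 : ℕ) : ℤ) ((4 * lam + 3 : ℕ) : ℤ) := ⟨4, -1, by push_cast; ring⟩
    exact Nat.isCoprime_iff_coprime.1 this
  obtain ⟨hK, ⟨e'⟩⟩ := f.nonempty_addEquiv_prod_ker hf (hcard.trans (by rw [hA]))
    (hA ▸ hcop.pow _ _)
  exact ⟨f.ker, inferInstance, hK, ⟨e.trans (AddEquiv.prodCongr (AddEquiv.refl ℤ) e')⟩⟩
end

section
/- Let p be a prime and t a positive integer with q := p^t ≡ 3 (mod 4), and let Q be the Laplacian matrix of the Paley tournament P(q). Then the cokernel of Q (the quotient of ℤ^F by the subgroup generated by the rows of Q) is isomorphic as an abelian group to ℤ ⊕ (ℤ/((q+1)/4)ℤ)^((q−1)/2) ⊕ ⊕_{i=1}^{t} (ℤ/p^iℤ)^(e_i), where e_t = ((p+1)/2)^t − 2 and, for 1 ≤ i < t, e_i = Σ_{j=0}^{min(i, t−i)} (t/(t−j))·C(t−j, j)·C(t−2j, i−j)·(−p)^j·((p+1)/2)^(t−2j) (here C(n,k) denotes the binomial coefficient). -/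
open Matrix

theorem ZMod.card_addMonoidHom (a n : ℕ) [NeZero n] :
    Nat.card (ZMod a →+ ZMod n) = Nat.gcd n a := by
  have e : (ZMod a →+ ZMod n) ≃ (nsmulAddMonoidHom (α := ZMod n) a).ker :=
    (ZMod.lift a).symm.trans <|
      (zmultiplesHom (ZMod n)).symm.subtypeEquiv fun f => by
        simp [AddMonoidHom.mem_ker, zmultiplesHom]
        rw [← nsmul_one, map_nsmul]
        simp
  rw [Nat.card_congr e, IsAddCyclic.card_nsmulAddMonoidHom_ker, Nat.card_zmod]

/-- Homomorphisms from a finite product are families of homomorphisms from the factors. -/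
def AddMonoidHom.piEquiv {ι : Type*} [Fintype ι] [DecidableEq ι] (A : ι → Type*)
    [∀ i, AddCommGroup (A i)] (C : Type*) [AddCommGroup C] :
    ((∀ i, A i) →+ C) ≃ (∀ i, A i →+ C) where
  toFun f i := f.comp (AddMonoidHom.single A i)
  invFun g := ∑ i, (g i).comp (Pi.evalAddMonoidHom A i)
  left_inv f := by
    refine DFunLike.ext _ _ fun v => ?_
    simp only [AddMonoidHom.finsetSum_apply, AddMonoidHom.comp_apply,
      Pi.evalAddMonoidHom_apply, AddMonoidHom.single_apply]
    rw [← map_sum, Finset.univ_sum_single]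
  right_inv g := by
    ext i x
    simp only [AddMonoidHom.comp_apply, AddMonoidHom.finsetSum_apply, Pi.evalAddMonoidHom_apply,
      AddMonoidHom.single_apply]
    rw [Finset.sum_eq_single i] <;> simp +contextual

theorem AddMonoidHom.card_pi {ι : Type*} [Fintype ι] (A : ι → Type*)
    [∀ i, AddCommGroup (A i)] (C : Type*) [AddCommGroup C] :
    Nat.card ((∀ i, A i) →+ C) = ∏ i, Nat.card (A i →+ C) := by
  classical
  rw [Nat.card_congr (AddMonoidHom.piEquiv A C), Nat.card_pi]

theorem AddMonoidHom.card_prod (A B C : Type*) [AddCommGroup A] [AddCommGroup B]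
    [AddCommGroup C] : Nat.card (A × B →+ C) = Nat.card (A →+ C) * Nat.card (B →+ C) := by
  rw [← Nat.card_prod]
  exact Nat.card_congr
    { toFun := fun f => (f.comp (AddMonoidHom.inl A B), f.comp (AddMonoidHom.inr A B))
      invFun := fun f => f.1.coprod f.2
      left_inv := fun f => by ext; simp
      right_inv := fun f => by simp }

theorem AddMonoidHom.card_congr_left {A B : Type*} (C : Type*) [AddCommGroup A] [AddCommGroup B]
    [AddCommGroup C] (e : A ≃+ B) : Nat.card (A →+ C) = Nat.card (B →+ C) :=
  Nat.card_congr e.addMonoidHomCongrLeftEquiv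

theorem AddMonoidHom.card_int (C : Type*) [AddCommGroup C] : Nat.card (ℤ →+ C) = Nat.card C :=
  Nat.card_congr (zmultiplesHom C).symm

theorem gcd_prime_pow {p l : ℕ} (hp : p.Prime) (hl : l.Prime) (e m : ℕ) :
    Nat.gcd (l ^ m) (p ^ e) = l ^ (if p = l then min e m else 0) := by
  split_ifs with h
  · subst h
    rcases le_total e m with h | h
    · rw [min_eq_left h, Nat.gcd_eq_right (pow_dvd_pow _ h)]
    · rw [min_eq_right h, Nat.gcd_eq_left (pow_dvd_pow _ h)]
  · rw [pow_zero]
    exact Nat.Coprime.pow _ _ ((Nat.coprime_primes hl hp).2 (Ne.symm h))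

theorem card_hom_primary (r : ℕ) {ι : Type} [Fintype ι] (f : ι → ℕ × ℕ)
    (hf : ∀ i, (f i).1.Prime) {l : ℕ} (hl : l.Prime) (m : ℕ) :
    Nat.card ((Fin r → ℤ) × (∀ i, ZMod ((f i).1 ^ (f i).2)) →+ ZMod (l ^ m)) =
      l ^ (r * m + ∑ i, if (f i).1 = l then min (f i).2 m else 0) := by
  have : NeZero (l ^ m) := ⟨(pow_pos hl.pos m).ne'⟩
  rw [AddMonoidHom.card_prod, AddMonoidHom.card_pi, AddMonoidHom.card_pi]
  simp only [AddMonoidHom.card_int, ZMod.card_addMonoidHom, Nat.card_zmod, gcd_prime_pow (hf _) hl]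
  rw [Finset.prod_const, Finset.prod_pow_eq_pow_sum, pow_add, Finset.card_univ, Fintype.card_fin,
    ← pow_mul, mul_comm m r]

theorem exponent_succ {ι : Type} [Fintype ι] (f : ι → ℕ × ℕ) (l m : ℕ) :
    (∑ i, if (f i).1 = l then min (f i).2 (m + 1) else 0) =
      (∑ i, if (f i).1 = l then min (f i).2 m else 0) +
        (Finset.univ.filter fun i => (f i).1 = l ∧ m < (f i).2).card := by
  rw [Finset.card_filter, ← Finset.sum_add_distrib]
  refine Finset.sum_congr rfl fun i _ => ?_
  by_cases h : (f i).1 = l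
  · simp only [h, if_true, true_and]
    split_ifs <;> omega
  · simp [h]

theorem card_filter_lt_succ {ι : Type} [Fintype ι] (f : ι → ℕ × ℕ) (l m : ℕ) :
    (Finset.univ.filter fun i => (f i).1 = l ∧ m < (f i).2).card =
      (Finset.univ.filter fun i => (f i).1 = l ∧ m + 1 < (f i).2).card +
      (Finset.univ.filter fun i => f i = (l, m + 1)).card := by
  simp only [Finset.card_filter]
  rw [← Finset.sum_add_distrib]
  refine Finset.sum_congr rfl fun i _ => ?_
  by_cases h : (f i).1 = l
  · simp only [Prod.ext_iff, h, true_and]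
    split_ifs <;> omega
  · simp [h, Prod.ext_iff]

theorem equiv_of_exponents {r r' : ℕ} {ι ι' : Type} [Fintype ι] [Fintype ι'] (f : ι → ℕ × ℕ)
    (f' : ι' → ℕ × ℕ) (hf : ∀ i, (f i).1.Prime ∧ (f i).2 ≠ 0)
    (hf' : ∀ i, (f' i).1.Prime ∧ (f' i).2 ≠ 0)
    (h : ∀ l m : ℕ, l.Prime → r * m + (∑ i, if (f i).1 = l then min (f i).2 m else 0) =
      r' * m + (∑ i, if (f' i).1 = l then min (f' i).2 m else 0)) :
    r = r' ∧ ∃ σ : ι ≃ ι', ∀ i, f' (σ i) = f i := by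
  classical
  have h1 : ∀ l m : ℕ, l.Prime →
      r + (Finset.univ.filter fun i => (f i).1 = l ∧ m < (f i).2).card =
      r' + (Finset.univ.filter fun i => (f' i).1 = l ∧ m < (f' i).2).card := by
    intro l m hl
    have a := h l m hl
    have b := h l (m + 1) hl
    rw [exponent_succ, exponent_succ] at b
    linarith [mul_add r m 1, mul_add r' m 1]
  have hr : r = r' := by
    have := h1 2 (∑ i, (f i).2 + ∑ i, (f' i).2) Nat.prime_two
    rw [Finset.filter_false_of_mem, Finset.filter_false_of_mem] at this
    · simpa using this
    · intro i _ hi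
      have := Finset.single_le_sum (f := fun i => (f' i).2) (fun _ _ => Nat.zero_le _)
        (Finset.mem_univ i)
      omega
    · intro i _ hi
      have := Finset.single_le_sum (f := fun i => (f i).2) (fun _ _ => Nat.zero_le _)
        (Finset.mem_univ i)
      omega
  refine ⟨hr, ?_⟩
  have h2 : ∀ c : ℕ × ℕ, Nonempty ({i // f i = c} ≃ {i // f' i = c}) := by
    rintro ⟨l, m⟩
    by_cases hc : l.Prime ∧ m ≠ 0
    · obtain ⟨hl, hm⟩ := hc
      obtain ⟨m, rfl⟩ := Nat.exists_eq_succ_of_ne_zero hm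
      have a := h1 l m hl
      have b := h1 l (m + 1) hl
      rw [card_filter_lt_succ, card_filter_lt_succ f'] at a
      refine ⟨Fintype.equivOfCardEq ?_⟩
      rw [Fintype.card_subtype, Fintype.card_subtype]
      simp only [Nat.succ_eq_add_one]
      omega
    · have : IsEmpty {i // f i = (l, m)} := ⟨fun i => hc (by have := hf i.1; rwa [i.2] at this)⟩
      have : IsEmpty {i // f' i = (l, m)} := ⟨fun i => hc (by have := hf' i.1; rwa [i.2] at this)⟩
      exact ⟨Equiv.equivOfIsEmpty _ _⟩
  exact ⟨Equiv.ofFiberEquiv fun c => (h2 c).some, fun i => Equiv.ofFiberEquiv_map _ i⟩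

theorem exists_primary_decomposition (G : Type*) [AddCommGroup G] [AddGroup.FG G] :
    ∃ (r : ℕ) (ι : Type) (_ : Fintype ι) (f : ι → ℕ × ℕ),
      (∀ i, (f i).1.Prime ∧ (f i).2 ≠ 0) ∧
      Nonempty (G ≃+ (Fin r → ℤ) × (∀ i, ZMod ((f i).1 ^ (f i).2))) := by
  classical
  obtain ⟨r, ι, hι, p, hp, e, ⟨φ⟩⟩ := AddCommGroup.equiv_free_prod_directSum_zmod G
  refine ⟨r, {i // e i ≠ 0}, inferInstance, fun i => (p i, e i), fun i => ⟨hp _, i.2⟩, ⟨?_⟩⟩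
  refine φ.trans (AddEquiv.prodCongr Finsupp.addEquivFunOnFinite
    ((DirectSum.addEquivProd _).trans ?_))
  refine AddEquiv.ofBijective
    ({ toFun := fun x i => x i.1, map_zero' := rfl, map_add' := fun _ _ => rfl } :
      (∀ i, ZMod (p i ^ e i)) →+ ∀ i : {i // e i ≠ 0}, ZMod (p i.1 ^ e i.1)) ⟨?_, ?_⟩
  · intro x y hxy
    ext i
    by_cases h : e i = 0
    · have : Subsingleton (ZMod (p i ^ e i)) := ZMod.subsingleton_iff.2 (by rw [h, pow_zero])
      exact Subsingleton.elim _ _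
    · exact congrFun hxy ⟨i, h⟩
  · intro y
    refine ⟨fun i => if h : e i ≠ 0 then y ⟨i, h⟩ else 0, ?_⟩
    ext i
    simp [i.2]

/-- Finitely generated abelian groups are determined by the number of their homomorphisms to the
cyclic groups of prime power order. -/
theorem nonempty_addEquiv_of_card_hom (G H : Type*) [AddCommGroup G] [AddCommGroup H]
    [AddGroup.FG G] [AddGroup.FG H]
    (h : ∀ l m : ℕ, l.Prime → Nat.card (G →+ ZMod (l ^ m)) = Nat.card (H →+ ZMod (l ^ m))) :
    Nonempty (G ≃+ H) := by
  obtain ⟨r, ι, _, f, hf, ⟨φ⟩⟩ := exists_primary_decomposition G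
  obtain ⟨r', ι', _, f', hf', ⟨φ'⟩⟩ := exists_primary_decomposition H
  obtain ⟨rfl, σ, hσ⟩ := equiv_of_exponents (r := r) (r' := r') f f' hf hf' fun l m hl => by
    have := h l m hl
    rw [AddMonoidHom.card_congr_left _ φ, AddMonoidHom.card_congr_left _ φ',
      card_hom_primary r f (fun i => (hf i).1) hl, card_hom_primary r' f' (fun i => (hf' i).1) hl]
      at this
    exact Nat.pow_right_injective hl.two_le this
  obtain rfl : f = f' ∘ σ := funext fun i => (hσ i).symm
  refine ⟨φ.trans (AddEquiv.trans (AddEquiv.prodCongr (AddEquiv.refl _) ?_) φ'.symm)⟩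
  refine AddEquiv.symm (AddEquiv.ofBijective
    ({ toFun := fun x i => x (σ i), map_zero' := rfl, map_add' := fun _ _ => rfl } :
      (∀ i, ZMod ((f' i).1 ^ (f' i).2)) →+ ∀ i, ZMod ((f' (σ i)).1 ^ (f' (σ i)).2)) ⟨?_, ?_⟩)
  · intro x y hxy
    ext i
    obtain ⟨j, rfl⟩ := σ.surjective i
    exact congrFun hxy j
  · intro y
    exact ⟨(Equiv.piCongrLeft (fun i => ZMod ((f' i).1 ^ (f' i).2)) σ) y, by ext i; simp⟩

/-- The number of carries in the addition of `a`, `(p ^ n - 1) / 2` and an initial carry `c` in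
base `p`, among the lowest `n` digits. -/
def carries (p n a c : ℕ) : ℕ :=
  ∑ i ∈ Finset.range n, if (p ^ (i + 1) - 1) / 2 < a % p ^ (i + 1) + c then 1 else 0

theorem carries_zero (p a c : ℕ) : carries p 0 a c = 0 := rfl

theorem half_pow_succ (B n : ℕ) :
    ((2 * B + 1) ^ (n + 1) - 1) / 2 = ((2 * B + 1) ^ n - 1) / 2 + (2 * B + 1) ^ n * B := by
  have h : Odd ((2 * B + 1) ^ n) := Odd.pow ⟨B, rfl⟩
  obtain ⟨m, hm⟩ := h
  rw [pow_succ, hm]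
  have : (2 * m + 1) * (2 * B + 1) - 1 = 2 * (m + (2 * m + 1) * B) := by
    rw [Nat.sub_eq_iff_eq_add (by nlinarith [Nat.zero_le m, Nat.zero_le B])]; ring
  rw [this]
  omega

theorem half_lt (B n : ℕ) : ((2 * B + 1) ^ n - 1) / 2 < (2 * B + 1) ^ n := by
  have : 0 < (2 * B + 1) ^ n := by positivity
  omega

theorem carries_succ (p n a c d : ℕ) (ha : a < p ^ n) (hd : d < p) :
    carries p (n + 1) (a + p ^ n * d) c = carries p n a c +
      if (p ^ (n + 1) - 1) / 2 < a + p ^ n * d + c then 1 else 0 := by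
  unfold carries
  rw [Finset.sum_range_succ]
  congr 1
  · refine Finset.sum_congr rfl fun i hi => ?_
    have : (a + p ^ n * d) % p ^ (i + 1) = a % p ^ (i + 1) := by
      obtain ⟨k, hk⟩ : p ^ (i + 1) ∣ p ^ n := pow_dvd_pow _ (Finset.mem_range.1 hi)
      rw [hk, mul_assoc, Nat.add_mul_mod_self_left]
    rw [this]
  · rw [Nat.mod_eq_of_lt]
    rw [pow_succ]
    calc a + p ^ n * d < p ^ n + p ^ n * d := by omega
      _ = p ^ n * (d + 1) := by ring
      _ ≤ p ^ n * p := Nat.mul_le_mul_left _ hd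

theorem half_lt_iff (B n a c d : ℕ) (ha : a < (2 * B + 1) ^ n) (hc : c ≤ 1) :
    ((2 * B + 1) ^ (n + 1) - 1) / 2 < a + (2 * B + 1) ^ n * d + c ↔
      B < d ∨ (d = B ∧ ((2 * B + 1) ^ n - 1) / 2 < a + c) := by
  rw [half_pow_succ]
  have h1 := half_lt B n
  set N := (2 * B + 1) ^ n
  rcases lt_trichotomy d B with h | h | h
  · have : N * d + N ≤ N * B := by rw [← Nat.mul_succ]; exact Nat.mul_le_mul_left _ h
    omega
  · subst h; omega
  · have : N * B + N ≤ N * d := by rw [← Nat.mul_succ]; exact Nat.mul_le_mul_left _ h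
    omega

theorem Finset.sum_range_mul_eq {M : Type*} [AddCommMonoid M] (f : ℕ → M) (N D : ℕ) :
    ∑ a ∈ Finset.range (N * D), f a =
      ∑ a ∈ Finset.range N, ∑ d ∈ Finset.range D, f (a + N * d) := by
  rw [Finset.sum_comm]
  induction D with
  | zero => simp
  | succ D ih =>
    rw [Nat.mul_succ, Finset.sum_range_add, ih, Finset.sum_range_succ]
    simp only [add_comm (N * D)]

open Polynomial in
/-- The generating function of the number of carries over all `a < p ^ n` for which the last
carry is `0` (or `1`). -/
noncomputable def carryGen (p n c : ℕ) (o : Prop) [Decidable o] : ℚ[X] :=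
  ∑ a ∈ Finset.range (p ^ n),
    if (((p ^ n - 1) / 2 < a + c) ↔ o) then X ^ carries p n a c else 0

theorem sum_range_ite_lt (B : ℕ) (e : Prop) [Decidable e] :
    (∑ d ∈ Finset.range (2 * B + 1), if (B < d ∨ (d = B ∧ e)) then (1 : ℕ) else 0) =
      B + if e then 1 else 0 := by
  rw [show 2 * B + 1 = B + (1 + B) by ring, Finset.sum_range_add, Finset.sum_range_add]
  rw [Finset.sum_eq_zero, Finset.sum_range_one, Finset.sum_congr rfl (g := fun _ => 1)]
  · simp [add_comm]
  · intro x _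
    rw [if_pos (by omega)]
  · intro x hx
    rw [Finset.mem_range] at hx
    rw [if_neg (by omega)]

theorem sum_range_ite_not_lt (B : ℕ) (e : Prop) [Decidable e] :
    (∑ d ∈ Finset.range (2 * B + 1), if ¬ (B < d ∨ (d = B ∧ e)) then (1 : ℕ) else 0) =
      B + if e then 0 else 1 := by
  have h := sum_range_ite_lt B e
  have h2 : ∑ d ∈ Finset.range (2 * B + 1), ((if ¬ (B < d ∨ (d = B ∧ e)) then (1 : ℕ) else 0) +
      if (B < d ∨ (d = B ∧ e)) then (1 : ℕ) else 0) = 2 * B + 1 := by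
    rw [Finset.sum_congr rfl (g := fun _ => 1)]
    · simp
    · intro x _
      split_ifs <;> rfl
  rw [Finset.sum_add_distrib, h] at h2
  split_ifs at h2 ⊢ <;> omega

open Polynomial in
theorem carryGen_succ_false (B n c : ℕ) (hc : c ≤ 1) :
    carryGen (2 * B + 1) (n + 1) c False =
      ((B : ℚ[X]) + 1) * carryGen (2 * B + 1) n c False +
        (B : ℚ[X]) * carryGen (2 * B + 1) n c True := by
  unfold carryGen
  rw [pow_succ, Finset.sum_range_mul_eq, Finset.mul_sum, Finset.mul_sum,
    ← Finset.sum_add_distrib]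
  refine Finset.sum_congr rfl fun a ha => ?_
  rw [Finset.mem_range] at ha
  have key : ∀ d ∈ Finset.range (2 * B + 1),
      (if ((((2 * B + 1) ^ n * (2 * B + 1) - 1) / 2 < a + (2 * B + 1) ^ n * d + c) ↔ False) then
        (X : ℚ[X]) ^ carries (2 * B + 1) (n + 1) (a + (2 * B + 1) ^ n * d) c else 0) =
      ((if ¬ (B < d ∨ (d = B ∧ ((2 * B + 1) ^ n - 1) / 2 < a + c)) then 1 else 0 : ℕ) : ℚ[X]) *
        X ^ carries (2 * B + 1) n a c := by
    intro d hd
    rw [carries_succ _ _ _ _ _ ha (Finset.mem_range.1 hd), ← pow_succ]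
    simp only [half_lt_iff B n a c d ha hc, iff_false]
    split_ifs <;> simp
  rw [Finset.sum_congr rfl key, ← Finset.sum_mul, ← Nat.cast_sum, sum_range_ite_not_lt]
  split_ifs <;> simp_all

open Polynomial in
theorem carryGen_succ_true (B n c : ℕ) (hc : c ≤ 1) :
    carryGen (2 * B + 1) (n + 1) c True =
      X * ((B : ℚ[X]) * carryGen (2 * B + 1) n c False +
        ((B : ℚ[X]) + 1) * carryGen (2 * B + 1) n c True) := by
  unfold carryGen
  rw [pow_succ, Finset.sum_range_mul_eq, Finset.mul_sum, Finset.mul_sum,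
    ← Finset.sum_add_distrib, Finset.mul_sum]
  refine Finset.sum_congr rfl fun a ha => ?_
  rw [Finset.mem_range] at ha
  have key : ∀ d ∈ Finset.range (2 * B + 1),
      (if ((((2 * B + 1) ^ n * (2 * B + 1) - 1) / 2 < a + (2 * B + 1) ^ n * d + c) ↔ True) then
        (X : ℚ[X]) ^ carries (2 * B + 1) (n + 1) (a + (2 * B + 1) ^ n * d) c else 0) =
      ((if (B < d ∨ (d = B ∧ ((2 * B + 1) ^ n - 1) / 2 < a + c)) then 1 else 0 : ℕ) : ℚ[X]) *
        (X * X ^ carries (2 * B + 1) n a c) := by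
    intro d hd
    rw [carries_succ _ _ _ _ _ ha (Finset.mem_range.1 hd), ← pow_succ]
    simp only [half_lt_iff B n a c d ha hc, iff_true]
    split_ifs <;> simp [pow_succ, mul_comm]
  rw [Finset.sum_congr rfl key, ← Finset.sum_mul, ← Nat.cast_sum, sum_range_ite_lt]
  split_ifs <;> simp_all <;> ring

/-- The coefficients of the Lucas polynomials. -/
def lucasCoeff (n j : ℕ) : ℚ := (n : ℚ) / ((n - j : ℕ) : ℚ) * ((n - j).choose j : ℚ)

theorem lucasCoeff_zero (n : ℕ) (hn : n ≠ 0) : lucasCoeff n 0 = 1 := by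
  have : (n : ℚ) ≠ 0 := by exact_mod_cast hn
  simp [lucasCoeff, this]

theorem lucasCoeff_eq_zero (n j : ℕ) (h : n < 2 * j) : lucasCoeff n j = 0 := by
  rw [lucasCoeff, Nat.choose_eq_zero_of_lt (by omega)]
  simp

theorem lucasCoeff_add (m j : ℕ) :
    lucasCoeff (m + 2 * (j + 1)) (j + 1) =
      ((m + j + 1).choose (j + 1) : ℚ) + ((m + j).choose j : ℚ) := by
  rw [lucasCoeff, show m + 2 * (j + 1) - (j + 1) = m + j + 1 by omega]
  have h := Nat.add_one_mul_choose_eq (m + j) j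
  have h' : ((m : ℚ) + j + 1) * ((m + j).choose j : ℚ) =
    ((m + j + 1).choose (j + 1) : ℚ) * (j + 1) := by exact_mod_cast h
  have h0 : ((m : ℚ) + j + 1) ≠ 0 := by positivity
  push_cast
  field_simp
  linear_combination -h'

theorem lucasCoeff_succ (n j : ℕ) (hn : n ≠ 0) :
    lucasCoeff (n + 2) (j + 1) = lucasCoeff (n + 1) (j + 1) + lucasCoeff n j := by
  rcases lt_trichotomy n (2 * j) with h | h | h
  · rw [lucasCoeff_eq_zero _ _ h, lucasCoeff_eq_zero _ _ (by omega),
      lucasCoeff_eq_zero _ _ (by omega), add_zero]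
  · obtain ⟨j, rfl⟩ : ∃ i, j = i + 1 := ⟨j - 1, by omega⟩
    have h1 := lucasCoeff_add 0 (j + 1)
    have h2 := lucasCoeff_add 0 j
    rw [lucasCoeff_eq_zero (n + 1) _ (by omega), h,
      show 2 * (j + 1) + 2 = 0 + 2 * (j + 1 + 1) by ring, h1,
      show 2 * (j + 1) = 0 + 2 * (j + 1) by ring, h2]
    simp
  · obtain ⟨m, rfl⟩ : ∃ m, n = m + 1 + 2 * j := ⟨n - 2 * j - 1, by omega⟩
    have h1 := lucasCoeff_add (m + 1) j
    have h2 := lucasCoeff_add m j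
    rw [show m + 1 + 2 * j + 2 = m + 1 + 2 * (j + 1) by ring,
      show m + 1 + 2 * j + 1 = m + 2 * (j + 1) by ring, h1, h2]
    rcases j with - | j
    · rw [lucasCoeff_zero _ (by omega)]
      simp
    · have h3 := lucasCoeff_add (m + 1) j
      rw [h3]
      have e1 := Nat.choose_succ_succ (m + 1 + (j + 1)) (j + 1)
      have e2 := Nat.choose_succ_succ (m + 1 + j) j
      simp only [Nat.succ_eq_add_one] at e1 e2
      rw [show m + 1 + (j + 1) + 1 = m + (j + 1) + 1 + 1 by ring] at e1 ⊢
      rw [show m + 1 + (j + 1) = m + (j + 1) + 1 by ring] at e1 ⊢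
      rw [show m + 1 + j + 1 = m + (j + 1) + 1 by ring] at e2 ⊢
      rw [show m + 1 + j = m + (j + 1) by ring] at e2 ⊢
      rw [e1, e2]
      push_cast
      ring

theorem lucas_eq_sum {R : Type*} [CommRing R] [Algebra ℚ R] (τ d : R) (W : ℕ → R) (h0 : W 0 = 2)
    (h1 : W 1 = τ) (h : ∀ n, W (n + 2) = τ * W (n + 1) - d * W n) (n : ℕ) :
    W (n + 1) = ∑ j ∈ Finset.range (n + 2),
      lucasCoeff (n + 1) j • ((-d) ^ j * τ ^ (n + 1 - 2 * j)) := by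
  induction n using Nat.twoStepInduction with
  | zero =>
    rw [Finset.sum_range_succ, Finset.sum_range_one, lucasCoeff_zero _ (by simp),
      lucasCoeff_eq_zero _ _ (by simp)]
    simp [h1]
  | one =>
    have e := lucasCoeff_add 0 0
    norm_num at e
    rw [Finset.sum_range_succ, Finset.sum_range_succ, Finset.sum_range_one,
      lucasCoeff_zero _ (by simp), lucasCoeff_eq_zero _ 2 (by simp), h, h1, h0]
    norm_num
    rw [e, two_smul]
    ring
  | more n ih1 ih2 =>
    have ih1' : d * W (n + 1) = - ∑ j ∈ Finset.range (n + 2),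
        lucasCoeff (n + 1) j • ((-d) ^ (j + 1) * τ ^ (n + 1 - 2 * j)) := by
      rw [ih1, Finset.mul_sum, ← Finset.sum_neg_distrib]
      refine Finset.sum_congr rfl fun j _ => ?_
      rw [mul_smul_comm, ← smul_neg]
      congr 1
      ring
    have ih2' : τ * W (n + 1 + 1) = ∑ j ∈ Finset.range (n + 3),
        lucasCoeff (n + 2) j • ((-d) ^ j * τ ^ (n + 3 - 2 * j)) := by
      rw [ih2, Finset.mul_sum]
      refine Finset.sum_congr rfl fun j _ => ?_
      by_cases hj : n + 2 < 2 * j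
      · rw [lucasCoeff_eq_zero (n + 1 + 1) j (by omega)]
        simp
      · rw [mul_smul_comm, show n + 3 - 2 * j = n + 1 + 1 - 2 * j + 1 by omega]
        congr 1
        ring
    rw [h, ih1', ih2', sub_neg_eq_add, Finset.sum_range_succ', Finset.sum_range_succ' _ (n + 3),
      Finset.sum_range_succ _ (n + 2), lucasCoeff_zero _ (by omega), lucasCoeff_zero _ (by omega),
      add_right_comm, ← Finset.sum_add_distrib, lucasCoeff_eq_zero (n + 2 + 1) (n + 2 + 1)
        (by omega), zero_smul, add_zero]
    congr 1
    refine Finset.sum_congr rfl fun j _ => ?_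
    rw [show n + 2 + 1 = n + 1 + 2 by ring, lucasCoeff_succ (n + 1) j (by omega), add_smul]
    rw [show n + 1 + 2 - 2 * (j + 1) = n + 1 - 2 * j by omega]

open Polynomial in
/-- The trace of the transfer matrix for carries. -/
noncomputable def carryTrace (p n : ℕ) : ℚ[X] := carryGen p n 0 False + carryGen p n 1 True

open Polynomial in
theorem carryTrace_succ_succ (B n : ℕ) :
    carryTrace (2 * B + 1) (n + 2) = (((B : ℚ[X]) + 1) * (1 + X)) * carryTrace (2 * B + 1) (n + 1) -
      ((2 * (B : ℚ[X]) + 1) * X) * carryTrace (2 * B + 1) n := by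
  unfold carryTrace
  rw [carryGen_succ_false _ (n + 1) 0 (by simp), carryGen_succ_true _ (n + 1) 1 (by simp),
    carryGen_succ_false _ n 1 (by simp), carryGen_succ_true _ n 0 (by simp),
    carryGen_succ_false _ n 0 (by simp), carryGen_succ_true _ n 1 (by simp)]
  ring

theorem carryTrace_zero (B : ℕ) : carryTrace (2 * B + 1) 0 = 2 := by
  norm_num [carryTrace, carryGen, carries_zero]

open Polynomial in
theorem carryTrace_one (B : ℕ) : carryTrace (2 * B + 1) 1 = ((B : ℚ[X]) + 1) * (1 + X) := by
  rw [carryTrace, carryGen_succ_false _ 0 _ (by simp), carryGen_succ_true _ 0 _ (by simp)]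
  norm_num [carryGen, carries_zero, Finset.filter_singleton]
  ring

open Polynomial in
theorem coeff_carryTrace (B t i : ℕ) (ht : 0 < t) (hi : i ≤ t) :
    (carryTrace (2 * B + 1) t).coeff i = ∑ j ∈ Finset.range (min i (t - i) + 1),
          (t : ℚ) / ((t - j : ℕ) : ℚ) * ((t - j).choose j : ℚ)
            * ((t - 2*j).choose (i - j) : ℚ)
            * (-((2 * B + 1 : ℕ) : ℚ))^j * ((B + 1 : ℕ) : ℚ)^(t - 2*j) := by
  obtain ⟨n, rfl⟩ : ∃ n, t = n + 1 := ⟨t - 1, by omega⟩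
  rw [lucas_eq_sum (((B : ℚ[X]) + 1) * (1 + X)) ((2 * (B : ℚ[X]) + 1) * X) (carryTrace (2 * B + 1))
    (carryTrace_zero B) (carryTrace_one B) (carryTrace_succ_succ B) n, finsetSum_coeff]
  have key : ∀ j, (lucasCoeff (n + 1) j • ((-((2 * (B : ℚ[X]) + 1) * X)) ^ j *
      (((B : ℚ[X]) + 1) * (1 + X)) ^ (n + 1 - 2 * j)) : ℚ[X]).coeff i =
      if j ≤ i then ((n + 1 : ℕ) : ℚ) / ((n + 1 - j : ℕ) : ℚ) * ((n + 1 - j).choose j : ℚ)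
            * ((n + 1 - 2*j).choose (i - j) : ℚ)
            * (-((2 * B + 1 : ℕ) : ℚ))^j * ((B + 1 : ℕ) : ℚ)^(n + 1 - 2*j) else 0 := by
    intro j
    have : ((-((2 * (B : ℚ[X]) + 1) * X)) ^ j *
        (((B : ℚ[X]) + 1) * (1 + X)) ^ (n + 1 - 2 * j) : ℚ[X]) =
      C ((-((2 * B + 1 : ℕ) : ℚ))^j * ((B + 1 : ℕ) : ℚ)^(n + 1 - 2*j)) *
        ((1 + X) ^ (n + 1 - 2 * j) * X ^ j) := by
      rw [mul_pow, neg_pow, neg_pow (((2 * B + 1 : ℕ) : ℚ)), mul_pow]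
      simp only [map_mul, map_pow, map_neg, map_one]
      push_cast
      simp only [map_add, map_mul, map_one, map_natCast, map_ofNat]
      ring
    rw [this, coeff_smul, coeff_C_mul, coeff_mul_X_pow', coeff_one_add_X_pow, lucasCoeff]
    split_ifs
    · simp only [smul_eq_mul]
      ring
    · simp
  rw [Finset.sum_congr rfl fun j _ => key j]
  symm
  rw [Finset.sum_congr rfl (g := fun j => if j ≤ i then
      ((n + 1 : ℕ) : ℚ) / ((n + 1 - j : ℕ) : ℚ) * ((n + 1 - j).choose j : ℚ)
            * ((n + 1 - 2*j).choose (i - j) : ℚ)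
            * (-((2 * B + 1 : ℕ) : ℚ))^j * ((B + 1 : ℕ) : ℚ)^(n + 1 - 2*j) else 0)]
  · refine Finset.sum_subset (fun j hj => ?_) fun j hj hj' => ?_
    · rw [Finset.mem_range] at *
      omega
    · rw [Finset.mem_range] at *
      split_ifs with h
      · by_cases h2 : n + 1 < 2 * j
        · rw [Nat.choose_eq_zero_of_lt (show n + 1 - j < j by omega)]
          simp
        · rw [Nat.choose_eq_zero_of_lt (show n + 1 - 2 * j < i - j by omega)]
          simp
      · rfl
  · intro j hj
    rw [Finset.mem_range] at hj
    rw [if_pos (by omega)]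

theorem half_mod (B i t : ℕ) (h : i ≤ t) :
    (((2 * B + 1) ^ t - 1) / 2) % (2 * B + 1) ^ i = ((2 * B + 1) ^ i - 1) / 2 := by
  induction t, h using Nat.le_induction with
  | base => exact Nat.mod_eq_of_lt (half_lt B i)
  | succ t ht ih =>
    obtain ⟨k, hk⟩ : (2 * B + 1) ^ i ∣ (2 * B + 1) ^ t := pow_dvd_pow _ ht
    rw [half_pow_succ, ← ih]
    nth_rewrite 2 [hk]
    rw [mul_assoc, Nat.add_mul_mod_self_left]

theorem carries_half_zero (B t : ℕ) : carries (2 * B + 1) t (((2 * B + 1) ^ t - 1) / 2) 0 = 0 := by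
  refine Finset.sum_eq_zero fun i hi => ?_
  rw [half_mod B _ _ (Finset.mem_range.1 hi), if_neg (by simp)]

theorem carries_half_one (B t : ℕ) : carries (2 * B + 1) t (((2 * B + 1) ^ t - 1) / 2) 1 = t := by
  unfold carries
  rw [Finset.sum_congr rfl (g := fun _ => 1)]
  · simp
  · intro i hi
    rw [half_mod B _ _ (Finset.mem_range.1 hi), if_pos (by simp)]

theorem carries_zero_zero (p t : ℕ) : carries p t 0 0 = 0 :=
  Finset.sum_eq_zero fun i hi => by simp

theorem carries_sub_one_one (p t : ℕ) (hp : 0 < p) : carries p t (p ^ t - 1) 1 = t := by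
  unfold carries
  rw [Finset.sum_congr rfl (g := fun _ => 1)]
  · simp
  · intro i hi
    have h0 : 0 < p ^ (i + 1) := pow_pos hp _
    have : (p ^ t - 1) % p ^ (i + 1) = p ^ (i + 1) - 1 := by
      obtain ⟨k, hk⟩ : p ^ (i + 1) ∣ p ^ t := pow_dvd_pow _ (Finset.mem_range.1 hi)
      have hk0 : 0 < k := Nat.pos_of_ne_zero fun h => by
        have := pow_pos hp t
        simp [h] at hk
        omega
      obtain ⟨k, rfl⟩ : ∃ m, k = m + 1 := ⟨k - 1, by omega⟩
      rw [hk, show p ^ (i + 1) * (k + 1) - 1 = p ^ (i + 1) - 1 + p ^ (i + 1) * k by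
        rw [mul_add]; omega, Nat.add_mul_mod_self_left, Nat.mod_eq_of_lt (by omega)]
    rw [this, if_pos (by omega)]

/-- The number of carries in the addition of `a` and `(p ^ t - 1) / 2` modulo `p ^ t - 1`. -/
def cyclicCarries (p t a : ℕ) : ℕ :=
  carries p t a (if (p ^ t - 1) / 2 < a then 1 else 0)

/-- The exponents of the nontrivial, non-quadratic characters of a field with `q` elements. -/
def genericExponents (q : ℕ) : Finset ℕ :=
  (Finset.range q).filter fun a => a ≠ 0 ∧ a ≠ (q - 1) / 2 ∧ a ≠ q - 1

theorem genericExponents_union (q : ℕ) (hq : 3 ≤ q) {M : Type*} [AddCommMonoid M]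
    (f : ℕ → M) : ∑ a ∈ Finset.range q, f a =
      f 0 + f ((q - 1) / 2) + f (q - 1) + ∑ a ∈ genericExponents q, f a := by
  have h : Finset.range q = ({0, (q - 1) / 2, q - 1} : Finset ℕ) ∪ genericExponents q := by
    ext a
    simp only [genericExponents, Finset.mem_union, Finset.mem_insert, Finset.mem_singleton,
      Finset.mem_filter, Finset.mem_range]
    omega
  have hd : Disjoint ({0, (q - 1) / 2, q - 1} : Finset ℕ) (genericExponents q) := by
    rw [Finset.disjoint_left]
    intro a
    simp only [genericExponents, Finset.mem_insert, Finset.mem_singleton, Finset.mem_filter]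
    tauto
  rw [h, Finset.sum_union hd, Finset.sum_insert, Finset.sum_insert, Finset.sum_singleton]
  · simp only [add_assoc]
  · rw [Finset.mem_singleton]
    omega
  · simp only [Finset.mem_insert, Finset.mem_singleton]
    omega

open Polynomial in
theorem coeff_carryTrace_eq_card (B t i : ℕ) (hB : 0 < B) (ht : 0 < t) :
    (carryTrace (2 * B + 1) t).coeff i =
      (((genericExponents ((2 * B + 1) ^ t)).filter
        fun a => cyclicCarries (2 * B + 1) t a = i).card : ℚ) +
      (if i = 0 then 2 else 0) + (if i = t then 2 else 0) := by
  have hodd : Odd ((2 * B + 1) ^ t) := Odd.pow ⟨B, rfl⟩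
  have h3 : 3 ≤ (2 * B + 1) ^ t := by
    calc 3 ≤ 2 * B + 1 := by omega
      _ ≤ (2 * B + 1) ^ t := Nat.le_self_pow ht.ne' _
  rw [carryTrace, carryGen, carryGen, ← Finset.sum_add_distrib, genericExponents_union _ h3]
  rw [carries_half_zero, carries_half_one, carries_zero_zero, carries_sub_one_one _ _ (by omega)]
  set q := (2 * B + 1) ^ t with hq
  simp only [add_zero, iff_false, iff_true]
  rw [if_pos (by omega), if_neg (by omega), if_pos (by omega), if_pos (by omega),
    if_neg (by omega), if_pos (by omega)]
  rw [Finset.card_filter]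
  simp only [coeff_add, finsetSum_coeff, Nat.cast_sum, pow_zero, coeff_X_pow, coeff_zero,
    coeff_one]
  have key : ∀ a ∈ genericExponents q,
      (((if ¬ (q - 1) / 2 < a then X ^ carries (2 * B + 1) t a 0 else 0 : ℚ[X]).coeff i) +
      ((if (q - 1) / 2 < a + 1 then X ^ carries (2 * B + 1) t a 1 else 0 : ℚ[X]).coeff i)) =
      ((if cyclicCarries (2 * B + 1) t a = i then 1 else 0 : ℕ) : ℚ) := by
    intro a ha
    simp only [genericExponents, Finset.mem_filter] at ha
    rw [cyclicCarries, ← hq]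
    by_cases h : (q - 1) / 2 < a
    · rw [if_neg (by omega), if_pos (by omega), if_pos h, coeff_X_pow]
      simp [eq_comm]
    · rw [if_pos h, if_neg (by omega), if_neg h, coeff_X_pow]
      simp [eq_comm]
  rw [Finset.sum_congr rfl key]
  split_ifs <;> ring

section

open Finset

theorem digitSum_add_floorSum (p t n : ℕ) (hp : 1 < p) (hn : n < p ^ t) :
    (p.digits n).sum + (p - 1) * ∑ i ∈ range t, n / p ^ (i + 1) = n := by
  induction t generalizing n with
  | zero => simp_all
  | succ t ih =>
    rcases Nat.eq_zero_or_pos n with rfl | h0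
    · simp
    have := ih (n / p) (by rw [Nat.div_lt_iff_lt_mul (by omega)]; rwa [pow_succ] at hn)
    rw [Nat.digits_def' hp h0, List.sum_cons, sum_range_succ']
    simp only [Nat.div_div_eq_div_mul, ← pow_succ'] at this
    simp only [zero_add, pow_one, mul_add]
    have h1 := Nat.mod_add_div n p
    have h2 : (p - 1) * (n / p) + n / p = p * (n / p) := by
      rw [Nat.sub_one_mul, Nat.sub_add_cancel (Nat.le_mul_of_pos_left _ (by omega))]
    omega

theorem digitSum_sub_two (p t : ℕ) (hp : 2 < p) (ht : 0 < t) :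
    (p.digits (p ^ t - 2)).sum + 1 = t * (p - 1) := by
  have hq : p ≤ p ^ t := Nat.le_self_pow ht.ne' p
  have h := digitSum_add_floorSum p t (p ^ t - 2) (by omega) (by omega)
  have h1 : ∀ i ∈ range t, (p ^ t - 2) / p ^ (i + 1) + 1 = p ^ (t - 1 - i) := by
    intro i hi
    have hi := mem_range.1 hi
    have h2 : p ^ t = p ^ (t - 1 - i) * p ^ (i + 1) := by rw [← pow_add]; congr 1; omega
    have h3 : p ≤ p ^ (i + 1) := Nat.le_self_pow (by omega) p
    have h4 : 0 < p ^ (t - 1 - i) := by positivity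
    obtain ⟨c, hc⟩ := Nat.exists_eq_add_of_lt h4
    rw [h2, hc]
    have : (0 + c + 1) * p ^ (i + 1) - 2 = (p ^ (i + 1) - 2) + c * p ^ (i + 1) := by
      rw [zero_add, add_mul, one_mul]; omega
    rw [this, Nat.add_mul_div_right _ _ (by omega), Nat.div_eq_of_lt (by omega)]
  have h2 : ∑ i ∈ range t, (p ^ t - 2) / p ^ (i + 1) + t = ∑ i ∈ range t, p ^ i := by
    rw [← sum_range_reflect (fun i => p ^ i), ← sum_congr rfl h1, sum_add_distrib]
    simp
  have h3 := Nat.geomSum_eq (m := p) (by omega) t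
  have h4 : (p - 1) * ∑ i ∈ range t, p ^ i = p ^ t - 1 := by
    rw [h3, Nat.mul_div_cancel' (Nat.sub_one_dvd_pow_sub_one p t)]
  rw [← h2, mul_add, mul_comm (p - 1) t] at h4
  omega

theorem Nat.add_half_div (B i b : ℕ) (c : ℕ) (hc : c ≤ 1) (hB : 0 < B) (k : ℕ)
    (hk : k % (2 * B + 1) ^ (i + 1) = ((2 * B + 1) ^ (i + 1) - 1) / 2) :
    (b + k + c) / (2 * B + 1) ^ (i + 1) = b / (2 * B + 1) ^ (i + 1) + k / (2 * B + 1) ^ (i + 1) +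
      if ((2 * B + 1) ^ (i + 1) - 1) / 2 < b % (2 * B + 1) ^ (i + 1) + c then 1 else 0 := by
  have hodd : Odd ((2 * B + 1) ^ (i + 1)) := Odd.pow ⟨B, rfl⟩
  have h3 : 2 * B + 1 ≤ (2 * B + 1) ^ (i + 1) := Nat.le_self_pow (by omega) _
  generalize (2 * B + 1) ^ (i + 1) = P at *
  obtain ⟨h, rfl⟩ := hodd
  have e : (2 * h + 1 - 1) / 2 = h := by omega
  rw [e] at *
  have h5 : b + k + c = (b % (2 * h + 1) + h + c) +
      (2 * h + 1) * (b / (2 * h + 1) + k / (2 * h + 1)) := by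
    have h6 := Nat.mod_add_div b (2 * h + 1)
    have h7 := Nat.mod_add_div k (2 * h + 1)
    rw [mul_add]; omega
  rw [h5, Nat.add_mul_div_left _ _ (by omega), add_comm]
  congr 1
  have h6 := Nat.mod_lt b (show 2 * h + 1 > 0 by omega)
  split_ifs
  · rw [Nat.div_eq_iff (by omega)]; omega
  · rw [Nat.div_eq_of_lt]; omega

theorem cyclicCarries_eq_of_digitSum (B t b v : ℕ) (hB : 0 < B) (ht : 0 < t)
    (hb : b < (2 * B + 1) ^ t - 1) (hbk : b ≠ ((2 * B + 1) ^ t - 1) / 2) :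
    letI p := 2 * B + 1
    letI k := (p ^ t - 1) / 2
    (p - 1) * v + (p.digits ((b + k) % (p ^ t - 1))).sum =
      (p.digits b).sum + (p.digits k).sum → v = cyclicCarries p t b := by
  intro h
  have hq : 2 * B + 1 ≤ (2 * B + 1) ^ t := Nat.le_self_pow ht.ne' _
  have hodd : Odd ((2 * B + 1) ^ t) := Odd.pow ⟨B, rfl⟩
  have hmod : ∀ i ∈ range t, ((2 * B + 1) ^ t - 1) / 2 % (2 * B + 1) ^ (i + 1)
      = ((2 * B + 1) ^ (i + 1) - 1) / 2 := fun i hi =>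
    half_mod B (i + 1) t (by have := mem_range.1 hi; omega)
  have hh := half_lt B t
  set k := ((2 * B + 1) ^ t - 1) / 2 with hkdef
  have hk : (2 * B + 1) ^ t = 2 * k + 1 := by obtain ⟨h, hh⟩ := hodd; omega
  have h1 := digitSum_add_floorSum (2 * B + 1) t b (by omega) (by omega)
  have h2 := digitSum_add_floorSum (2 * B + 1) t k (by omega) (by omega)
  have hcar : ∀ c ≤ 1, ∑ i ∈ range t, (b + k + c) / (2 * B + 1) ^ (i + 1) =
      ∑ i ∈ range t, b / (2 * B + 1) ^ (i + 1) + ∑ i ∈ range t, k / (2 * B + 1) ^ (i + 1)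
        + carries (2 * B + 1) t b c := by
    intro c hc
    rw [carries, ← sum_add_distrib, ← sum_add_distrib]
    exact sum_congr rfl fun i hi => Nat.add_half_div B i b c hc hB k (hmod i hi)
  unfold cyclicCarries
  rw [← hkdef]
  apply Nat.eq_of_mul_eq_mul_left (show 0 < 2 * B + 1 - 1 by omega)
  have key : ∀ c S : ℕ, (2 * B + 1 - 1) * (S + c) = (2 * B + 1 - 1) * S + (2 * B + 1 - 1) * c :=
    fun c S => mul_add _ _ _
  split_ifs with hlt
  · have hr : (b + k) % ((2 * B + 1) ^ t - 1) = b + k + 1 - (2 * B + 1) ^ t := by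
      rw [Nat.mod_eq_sub_mod (by omega), Nat.mod_eq_of_lt (by omega)]; omega
    rw [hr] at h
    have h3 := digitSum_add_floorSum (2 * B + 1) t (b + k + 1 - (2 * B + 1) ^ t)
      (by omega) (by omega)
    have h4 : ∑ i ∈ range t, (b + k + 1 - (2 * B + 1) ^ t) / (2 * B + 1) ^ (i + 1) +
        ∑ i ∈ range t, (2 * B + 1) ^ i = ∑ i ∈ range t, (b + k + 1) / (2 * B + 1) ^ (i + 1) := by
      rw [← sum_range_reflect (fun i => (2 * B + 1) ^ i), ← sum_add_distrib]
      refine sum_congr rfl fun i hi => ?_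
      have e : (2 * B + 1) ^ t = (2 * B + 1) ^ (i + 1) * (2 * B + 1) ^ (t - 1 - i) := by
        rw [← pow_add]; congr 1; have := mem_range.1 hi; omega
      obtain ⟨r, hr⟩ : ∃ r, b + k + 1 = r + (2 * B + 1) ^ t :=
        ⟨b + k + 1 - (2 * B + 1) ^ t, by omega⟩
      rw [hr, Nat.add_sub_cancel, e, Nat.add_mul_div_left _ _ (by positivity)]
    have h5 := Nat.geomSum_eq (m := 2 * B + 1) (by omega) t
    have h6 : (2 * B + 1 - 1) * ∑ i ∈ range t, (2 * B + 1) ^ i = (2 * B + 1) ^ t - 1 := by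
      rw [h5, Nat.mul_div_cancel' (Nat.sub_one_dvd_pow_sub_one _ t)]
    have h7 := hcar 1 le_rfl
    rw [h7] at h4
    have h8 := congrArg ((2 * B + 1 - 1) * ·) h4
    simp only [mul_add] at h8
    omega
  · rw [not_lt] at hlt
    have hlt : b < k := lt_of_le_of_ne hlt hbk
    have hr : (b + k) % ((2 * B + 1) ^ t - 1) = b + k := Nat.mod_eq_of_lt (by omega)
    rw [hr] at h
    have h3 := digitSum_add_floorSum (2 * B + 1) t (b + k) (by omega) (by omega)
    have h7 := hcar 0 zero_le_one
    rw [add_zero] at h7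
    have h8 := congrArg ((2 * B + 1 - 1) * ·) h7
    simp only [mul_add] at h8
    omega

theorem gaussValuation_eq (p t : ℕ) (hp : 2 < p) (ht : 0 < t) (V : ℕ → ℕ) (h0 : V 0 = 0)
    (hmul : ∀ a, V (p * a) = V a)
    (hsucc : ∀ a, a % p ≠ p - 1 → a + 1 < p ^ t - 1 → V (a + 1) = V a + V 1)
    (hrefl : V 1 + V (p ^ t - 2) = t * (p ^ t - 1)) (a : ℕ) (ha : a < p ^ t - 1) :
    (p - 1) * V a = (p ^ t - 1) * (p.digits a).sum := by
  have key : ∀ a < p ^ t - 1, V a = V 1 * (p.digits a).sum := by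
    intro a
    induction a using Nat.strong_induction_on with
    | _ a ih =>
      intro ha
      rcases Nat.eq_zero_or_pos a with rfl | hpos
      · simp [h0]
      by_cases hd : p ∣ a
      · obtain ⟨c, rfl⟩ := hd
        have hc : 0 < c := Nat.pos_of_mul_pos_left hpos
        have hlt : c < p * c := by nlinarith
        rw [hmul, ih c hlt (by omega), Nat.digits_base_mul (by omega) hc]
        simp
      · obtain ⟨c, rfl⟩ : ∃ c, a = c + 1 := ⟨a - 1, by omega⟩
        have hne : c % p ≠ p - 1 := by
          intro h
          apply hd
          rw [Nat.dvd_iff_mod_eq_zero, Nat.add_mod, h, Nat.mod_eq_of_lt (show 1 < p by omega),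
            Nat.sub_add_cancel (by omega), Nat.mod_self]
        rw [hsucc c hne ha, ih c (by omega) (by omega)]
        have hlt := Nat.mod_lt c (show p > 0 by omega)
        have e1 : (p.digits (c + 1)).sum = (p.digits c).sum + 1 := by
          rw [Nat.digits_def' (by omega) (Nat.succ_pos c), List.sum_cons]
          have e : c + 1 = (c % p + 1) + p * (c / p) := by
            have := Nat.mod_add_div c p; omega
          have em : (c + 1) % p = c % p + 1 := by
            rw [e, Nat.add_mul_mod_self_left, Nat.mod_eq_of_lt (by omega)]
          have ed : (c + 1) / p = c / p := by
            conv_lhs => rw [e]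
            rw [Nat.add_mul_div_left _ _ (by omega), Nat.div_eq_of_lt (by omega), zero_add]
          rw [em, ed]
          rcases Nat.eq_zero_or_pos c with rfl | hc
          · simp
          · rw [Nat.digits_def' (b := p) (n := c) (by omega) hc, List.sum_cons]
            ring
        rw [e1]; ring
  have hq : p ≤ p ^ t := Nat.le_self_pow ht.ne' p
  have h2 := key (p ^ t - 2) (by omega)
  have h3 := digitSum_sub_two p t hp ht
  have h4 : V 1 * (p - 1) = p ^ t - 1 := by
    have : t * (V 1 * (p - 1)) = t * (p ^ t - 1) := by
      rw [← hrefl, h2]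
      calc t * (V 1 * (p - 1)) = V 1 * (t * (p - 1)) := by ring
        _ = _ := by rw [← h3]; ring
    exact Nat.eq_of_mul_eq_mul_left ht this
  rw [key a ha, ← h4]; ring

/-- A ring `W` with residue field `F` of `p ^ t` elements, `p` odd, whose maximal ideal is
generated by `p`, together with a multiplicative section of the residue map. -/
structure TeichmullerLift (p t : ℕ) (F W : Type*) [Field F] [Fintype F] [CommRing W] where
  /-- The residue map. -/
  res : W →+* F
  /-- The Teichmüller lift. -/
  lift : F →*₀ W
  res_lift : ∀ x, res (lift x) = x
  res_eq_zero_iff : ∀ w, res w = 0 ↔ (p : W) ∣ w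
  card_eq : Fintype.card F = p ^ t
  two_lt : 2 < p
  pos : 0 < t
  prime : p.Prime
  finiteMultiplicity : ∀ w : W, w ≠ 0 → FiniteMultiplicity (p : W) w

theorem ne_one_of_isPrimitive {F L : Type*} [Field F] [Field L] {ψ : AddChar F L}
    (hψ : ψ.IsPrimitive) : ψ ≠ 1 := by
  simpa using hψ one_ne_zero

namespace TeichmullerLift

variable {p t : ℕ} {F W : Type*} [Field F] [Fintype F] [CommRing W] (D : TeichmullerLift p t F W)

include D

theorem three_le : 3 ≤ p ^ t := D.two_lt.trans_le (Nat.le_self_pow D.pos.ne' p)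

theorem res_p : D.res p = 0 := (D.res_eq_zero_iff _).2 dvd_rfl

theorem cast_p : (p : F) = 0 := by simpa using D.res_p

theorem cast_eq_zero_iff (n : ℕ) : (n : F) = 0 ↔ p ∣ n := by
  have := D.prime.one_lt
  have hchar : CharP F p := by
    obtain ⟨r, hr⟩ := CharP.exists F
    have h := (CharP.cast_eq_zero_iff F r p).1 D.cast_p
    rcases (Nat.dvd_prime D.prime).1 h with rfl | rfl
    · exact absurd (CharP.cast_eq_zero F 1) (by rw [Nat.cast_one]; exact one_ne_zero)
    · exact hr
  exact CharP.cast_eq_zero_iff F p n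

theorem prime_p [IsDomain W] (h0 : (p : W) ≠ 0) : Prime (p : W) := by
  refine ⟨h0, fun hu => ?_, fun a b h => ?_⟩
  · have := hu.map D.res
    rw [D.res_p] at this
    exact not_isUnit_zero this
  · simp only [← D.res_eq_zero_iff, map_mul, mul_eq_zero] at h ⊢
    exact h

theorem lift_pow_card_sub_one {x : F} (hx : x ≠ 0) : D.lift x ^ (p ^ t - 1) = 1 := by
  rw [← map_pow, ← D.card_eq, FiniteField.pow_card_sub_one_eq_one x hx, map_one]

/-- The inverse of the Teichmüller character. -/
noncomputable def char : MulChar F W :=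
  (MulChar.mk (D.lift : F →* W) fun x hx => by
    have : x = 0 := by simpa using hx
    simp [this])⁻¹

theorem char_apply (x : F) : D.char x = D.lift x⁻¹ := MulChar.inv_apply' _ _

theorem char_pow_apply {x : F} (hx : x ≠ 0) (a : ℕ) : (D.char ^ a) x = D.lift x⁻¹ ^ a := by
  have := MulChar.pow_apply_coe D.char a (Units.mk0 x hx)
  rwa [Units.val_mk0, char_apply] at this

theorem char_pow_eq_one_iff (a : ℕ) : D.char ^ a = 1 ↔ p ^ t - 1 ∣ a := by
  rw [← D.card_eq, ← FiniteField.forall_pow_eq_one_iff]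
  constructor
  · intro h x
    have h1 := D.char_pow_apply (inv_ne_zero x.ne_zero) a
    rw [h, inv_inv, ← map_pow, ← Units.val_inv_eq_inv_val, MulChar.one_apply_coe] at h1
    have h2 := congrArg D.res h1
    rw [D.res_lift, map_one] at h2
    exact Units.ext (by simpa using h2.symm)
  · intro h
    ext x
    rw [D.char_pow_apply x.ne_zero, ← map_pow, ← Units.val_inv_eq_inv_val,
      ← Units.val_pow_eq_pow_val,
      h x⁻¹]
    simp

theorem char_pow_mod (a : ℕ) : D.char ^ (a % (p ^ t - 1)) = D.char ^ a := by
  conv_rhs => rw [← Nat.mod_add_div a (p ^ t - 1), pow_add, pow_mul,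
    (D.char_pow_eq_one_iff _).2 dvd_rfl, one_pow, mul_one]

theorem res_jacobiSum (a : ℕ) (ha : a + 1 < p ^ t - 1) :
    D.res (jacobiSum (D.char ^ a) (D.char ^ 1)) = -((a + 1 : ℕ) : F) := by
  classical
  have hq := D.three_le
  have hsum : ∀ i < p ^ t - 1, ∑ y : F, y ^ i = 0 := fun i hi =>
    FiniteField.sum_pow_lt_card_sub_one F i (by rwa [D.card_eq])
  have h1 : D.res (jacobiSum (D.char ^ a) (D.char ^ 1)) =
      ∑ y : F, y ^ (a + 1) * (y - 1)⁻¹ := by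
    rw [jacobiSum, map_sum]
    refine Fintype.sum_equiv (Equiv.inv F) _ _ fun x => ?_
    rcases eq_or_ne x 0 with rfl | hx
    · simp [MulChar.map_zero]
    · rw [map_mul, D.char_pow_apply hx, pow_one, char_apply, map_pow, D.res_lift, D.res_lift,
        Equiv.inv_apply, pow_succ]
      rcases eq_or_ne x 1 with rfl | hx1
      · simp
      have h3 : 1 - x ≠ 0 := sub_ne_zero.2 hx1.symm
      have h4 : x⁻¹ - 1 ≠ 0 := by
        rw [sub_ne_zero]; simpa using hx1
      rw [mul_assoc]
      congr 1
      field_simp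
  have h2 : ∀ y : F, y ^ (a + 1) * (y - 1)⁻¹ =
      ∑ i ∈ range (a + 1), y ^ i + (y - 1)⁻¹ - if y = 1 then ((a + 1 : ℕ) : F) else 0 := by
    intro y
    split_ifs with h
    · subst h; simp
    · have h4 : y - 1 ≠ 0 := sub_ne_zero.2 h
      rw [geom_sum_eq h]
      field_simp
      ring
  rw [h1, sum_congr rfl fun y _ => h2 y, sum_sub_distrib, sum_add_distrib, sum_comm,
    sum_eq_zero fun i hi => hsum i (by have := mem_range.1 hi; omega), zero_add, sum_ite_eq']
  have h5 : ∑ y : F, (y - 1)⁻¹ = ∑ y : F, y ^ 1 := by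
    refine Fintype.sum_equiv ((Equiv.subRight 1).trans (Equiv.inv F)) _ _ fun x => ?_
    simp
  rw [h5, hsum 1 (by omega)]
  simp

variable {L : Type*} [Field L] (f : W →+* L) (ψ : AddChar F L)

/-- The Gauss sum of a power of the inverse Teichmüller character. -/
noncomputable def gauss (a : ℕ) : L := gaussSum ((D.char ^ a).ringHomComp f) ψ

theorem gauss_congr {a b : ℕ} (h : D.char ^ a = D.char ^ b) : D.gauss f ψ a = D.gauss f ψ b := by
  rw [gauss, gauss, h]

theorem gauss_zero (hψ : ψ ≠ 1) : D.gauss f ψ 0 = -1 := by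
  rw [gauss, pow_zero, MulChar.ringHomComp_one, gaussSum_one_left hψ]

theorem gauss_frob (hfrob : ∀ x, ψ (x ^ p) = ψ x) (a : ℕ) :
    D.gauss f ψ (p * a) = D.gauss f ψ a := by
  have := Fact.mk D.prime
  have : CharP F p := (CharP.charP_iff_prime_eq_zero D.prime).2 D.cast_p
  unfold gauss gaussSum
  refine Fintype.sum_equiv (frobeniusEquiv F p).toEquiv _ _ fun x => ?_
  simp only [RingEquiv.toEquiv_eq_coe, EquivLike.coe_coe, frobeniusEquiv_apply, frobenius_def,
    MulChar.ringHomComp_apply]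
  rw [hfrob]
  congr 2
  rcases eq_or_ne x 0 with rfl | hx
  · simp [MulChar.map_zero, D.prime.ne_zero]
  · rw [D.char_pow_apply hx, D.char_pow_apply (pow_ne_zero _ hx), pow_mul, ← map_pow, inv_pow]

theorem jacobiSum_mul_gauss (a b : ℕ) (h : ¬ p ^ t - 1 ∣ a + b) (hf : Function.Injective f) :
    f (jacobiSum (D.char ^ a) (D.char ^ b)) * D.gauss f ψ (a + b) =
      D.gauss f ψ a * D.gauss f ψ b := by
  rw [gauss, gauss, gauss, ← jacobiSum_mul_nontrivial, jacobiSum_ringHomComp, pow_add,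
    MulChar.ringHomComp_mul, mul_comm]
  rw [← MulChar.ringHomComp_mul, ← pow_add, MulChar.ringHomComp_ne_one_iff hf, ne_eq,
    D.char_pow_eq_one_iff]
  exact h

theorem gauss_mul_gauss_of_dvd (hψ : ψ.IsPrimitive) (a b : ℕ) (h : p ^ t - 1 ∣ a + b)
    (ha : ¬ p ^ t - 1 ∣ a) (hf : Function.Injective f) :
    ∃ ε : W, ε ^ (p ^ t - 1) = 1 ∧ f (ε * (p : W) ^ t) = D.gauss f ψ a * D.gauss f ψ b := by
  have h1 : (D.char ^ a) * D.char ^ b = 1 := by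
    rw [← pow_add, D.char_pow_eq_one_iff]; exact h
  have h2 : (D.char ^ a).ringHomComp f ≠ 1 := by
    rw [MulChar.ringHomComp_ne_one_iff hf, ne_eq, D.char_pow_eq_one_iff]; exact ha
  refine ⟨(D.char ^ b) (-1), ?_, ?_⟩
  · rw [D.char_pow_apply (by simp), pow_right_comm, D.lift_pow_card_sub_one (by simp), one_pow]
  · have h3 := gaussSum_mul_gaussSum_eq_card h2 hψ
    have h4 := mul_gaussSum_inv_eq_gaussSum ((D.char ^ b).ringHomComp f) ψ
    rw [MulChar.ringHomComp_inv, inv_eq_of_mul_eq_one_right h1, D.card_eq] at h3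
    rw [gauss, gauss, ← h4, mul_left_comm, h3, MulChar.ringHomComp_apply]
    push_cast
    simp

theorem exists_mul_gauss_add (hψ : ψ.IsPrimitive) (a b : ℕ) (hf : Function.Injective f) :
    ∃ w : W, f w * D.gauss f ψ (a + b) = D.gauss f ψ a * D.gauss f ψ b := by
  have hψ1 : ψ ≠ 1 := ne_one_of_isPrimitive hψ
  by_cases h : p ^ t - 1 ∣ a + b
  · have h0 : D.gauss f ψ (a + b) = -1 := by
      rw [← D.gauss_zero f ψ hψ1]
      exact D.gauss_congr f ψ (by rw [(D.char_pow_eq_one_iff _).2 h, pow_zero])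
    by_cases ha : p ^ t - 1 ∣ a
    · have hb := (Nat.dvd_add_right ha).1 h
      refine ⟨-1, ?_⟩
      rw [h0, D.gauss_congr f ψ (b := 0) (by rw [(D.char_pow_eq_one_iff _).2 ha, pow_zero]),
        D.gauss_congr f ψ (a := b) (b := 0) (by rw [(D.char_pow_eq_one_iff _).2 hb, pow_zero]),
        D.gauss_zero f ψ hψ1]
      simp
    · obtain ⟨ε, -, h2⟩ := D.gauss_mul_gauss_of_dvd f ψ hψ a b h ha hf
      exact ⟨-(ε * p ^ t), by rw [h0, ← h2, map_neg]; ring⟩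
  · exact ⟨_, D.jacobiSum_mul_gauss f ψ a b h hf⟩

theorem exists_eq_gauss_pow (hψ : ψ.IsPrimitive) (a : ℕ) (hf : Function.Injective f) :
    ∃ w : W, f w = D.gauss f ψ a ^ (p ^ t - 1) := by
  have hψ1 : ψ ≠ 1 := ne_one_of_isPrimitive hψ
  have key : ∀ n, ∃ w : W, f w * D.gauss f ψ (n * a) = D.gauss f ψ a ^ n := by
    intro n
    induction n with
    | zero => exact ⟨-1, by simp [D.gauss_zero f ψ hψ1]⟩
    | succ n ih =>
      obtain ⟨w, hw⟩ := ih
      obtain ⟨u, hu⟩ := D.exists_mul_gauss_add f ψ hψ (n * a) a hf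
      refine ⟨w * u, ?_⟩
      rw [pow_succ, ← hw, add_one_mul, map_mul, mul_assoc, hu]; ring
  obtain ⟨w, hw⟩ := key (p ^ t - 1)
  rw [D.gauss_congr f ψ (b := 0)
    (by rw [(D.char_pow_eq_one_iff _).2 (dvd_mul_right _ _), pow_zero]),
    D.gauss_zero f ψ hψ1] at hw
  exact ⟨-w, by rw [← hw, map_neg]; ring⟩

theorem multiplicity_jacobiSum_of_addChar [IsDomain W] (hp0 : (p : W) ≠ 0) (hψ : ψ.IsPrimitive)
    (hfrob : ∀ x, ψ (x ^ p) = ψ x) (hf : Function.Injective f) (b : ℕ)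
    (hb : b ∈ genericExponents (p ^ t)) :
    jacobiSum (D.char ^ b) (D.char ^ ((p ^ t - 1) / 2)) ≠ 0 ∧
    multiplicity (p : W) (jacobiSum (D.char ^ b) (D.char ^ ((p ^ t - 1) / 2))) =
      cyclicCarries p t b := by
  have hψ1 : ψ ≠ 1 := ne_one_of_isPrimitive hψ
  have hq := D.three_le
  have hprime := D.prime_p hp0
  have hcard : (Fintype.card F : L) ≠ 0 := by
    rw [D.card_eq, ← map_natCast f, ne_eq, map_eq_zero_iff f hf, Nat.cast_pow]
    exact pow_ne_zero _ hp0
  choose N hN using fun a => D.exists_eq_gauss_pow f ψ hψ a hf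
  have hg0 : ∀ a, D.gauss f ψ a ≠ 0 := by
    intro a
    by_cases ha : p ^ t - 1 ∣ a
    · rw [D.gauss_congr f ψ (b := 0) (by rw [(D.char_pow_eq_one_iff _).2 ha, pow_zero]),
        D.gauss_zero f ψ hψ1]
      simp
    · refine gaussSum_ne_zero_of_nontrivial hcard ?_ hψ
      rw [MulChar.ringHomComp_ne_one_iff hf, ne_eq, D.char_pow_eq_one_iff]; exact ha
  have hN0 : ∀ a, N a ≠ 0 := fun a h => by
    have := hN a
    rw [h, map_zero] at this
    exact pow_ne_zero _ (hg0 a) this.symm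
  have hcongr : ∀ a c, D.gauss f ψ a = D.gauss f ψ c → N a = N c := fun a c h =>
    hf (by rw [hN, hN, h])
  have hJ : ∀ a c, ¬ p ^ t - 1 ∣ a + c →
      jacobiSum (D.char ^ a) (D.char ^ c) ≠ 0 ∧
      (p ^ t - 1) * multiplicity (p : W) (jacobiSum (D.char ^ a) (D.char ^ c)) +
        multiplicity (p : W) (N (a + c)) =
        multiplicity (p : W) (N a) + multiplicity (p : W) (N c) := by
    intro a c h
    have h1 := D.jacobiSum_mul_gauss f ψ a c h hf
    have hJ0 : jacobiSum (D.char ^ a) (D.char ^ c) ≠ 0 := fun h0 => by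
      rw [h0, map_zero, zero_mul] at h1
      exact mul_ne_zero (hg0 a) (hg0 c) h1.symm
    refine ⟨hJ0, ?_⟩
    have h2 : jacobiSum (D.char ^ a) (D.char ^ c) ^ (p ^ t - 1) * N (a + c) = N a * N c := by
      apply hf
      rw [map_mul, map_mul, map_pow, hN, hN, hN, ← mul_pow, ← mul_pow, h1]
    rw [← multiplicity_mul hprime (D.finiteMultiplicity _ (mul_ne_zero (hN0 a) (hN0 c))), ← h2,
      multiplicity_mul hprime (D.finiteMultiplicity _
        (mul_ne_zero (pow_ne_zero _ hJ0) (hN0 _))),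
      (D.finiteMultiplicity _ hJ0).multiplicity_pow hprime]
  set V : ℕ → ℕ := fun a => multiplicity (p : W) (N a) with hV
  have hV0 : V 0 = 0 := by
    refine multiplicity_of_isUnit_right hprime.not_isUnit ?_
    have : N 0 = (-1) ^ (p ^ t - 1) := hf (by rw [hN, D.gauss_zero f ψ hψ1]; simp)
    rw [this]
    exact isUnit_one.neg.pow _
  have hVmul : ∀ a, V (p * a) = V a := fun a => by
    simp only [hV]
    rw [hcongr _ _ (D.gauss_frob f ψ hfrob a)]
  have hVsucc : ∀ a, a % p ≠ p - 1 → a + 1 < p ^ t - 1 → V (a + 1) = V a + V 1 := by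
    intro a ha hlt
    have h1 := (hJ a 1 fun h => absurd (Nat.le_of_dvd (by omega) h) (by omega)).2
    rw [multiplicity_eq_zero.2, mul_zero, zero_add] at h1
    · exact h1
    · rw [← D.res_eq_zero_iff, D.res_jacobiSum a hlt, neg_eq_zero, D.cast_eq_zero_iff]
      intro h
      apply ha
      obtain ⟨c, hc⟩ := h
      have : a = (p - 1) + p * (c - 1) := by
        have h2 : 0 < c := Nat.pos_of_ne_zero fun h => by simp [h] at hc
        obtain ⟨c, rfl⟩ : ∃ d, c = d + 1 := ⟨c - 1, by omega⟩
        rw [mul_add] at hc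
        have := D.two_lt
        simp only [Nat.add_sub_cancel]
        omega
      rw [this, Nat.add_mul_mod_self_left, Nat.mod_eq_of_lt]
      have := D.two_lt
      omega
  have hVrefl : V 1 + V (p ^ t - 2) = t * (p ^ t - 1) := by
    have hd : ¬ p ^ t - 1 ∣ 1 := fun h => absurd (Nat.le_of_dvd one_pos h) (by omega)
    obtain ⟨ε, hε, h⟩ := D.gauss_mul_gauss_of_dvd f ψ hψ 1 (p ^ t - 2)
      (by rw [show 1 + (p ^ t - 2) = p ^ t - 1 by omega]) hd hf
    have h2 : (p : W) ^ (t * (p ^ t - 1)) = N 1 * N (p ^ t - 2) := by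
      apply hf
      rw [map_mul, hN, hN, ← mul_pow, ← h, ← map_pow, mul_pow, hε, one_mul, pow_mul]
    simp only [hV]
    rw [← multiplicity_mul hprime (D.finiteMultiplicity _ (mul_ne_zero (hN0 _) (hN0 _))), ← h2,
      multiplicity_pow_self_of_prime hprime]
  have key := gaussValuation_eq p t D.two_lt D.pos V hV0 hVmul hVsucc hVrefl
  simp only [genericExponents, mem_filter, mem_range] at hb
  obtain ⟨B, rfl⟩ : ∃ B, p = 2 * B + 1 :=
    D.prime.odd_of_ne_two (by have := D.two_lt; omega)
  have hodd : Odd ((2 * B + 1) ^ t) := Odd.pow ⟨B, rfl⟩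
  have hk : (2 * B + 1) ^ t = 2 * (((2 * B + 1) ^ t - 1) / 2) + 1 := by
    obtain ⟨h, hh⟩ := hodd; omega
  have hnd : ¬ (2 * B + 1) ^ t - 1 ∣ b + ((2 * B + 1) ^ t - 1) / 2 := by
    rintro ⟨c, hc⟩
    rcases Nat.lt_or_ge c 1 with h | h
    · obtain rfl : c = 0 := by omega
      omega
    · rcases h.eq_or_lt with rfl | h
      · omega
      · have : ((2 * B + 1) ^ t - 1) * 2 ≤ ((2 * B + 1) ^ t - 1) * c := Nat.mul_le_mul_left _ h
        omega
  obtain ⟨hne, h⟩ := hJ b (((2 * B + 1) ^ t - 1) / 2) hnd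
  refine ⟨hne, cyclicCarries_eq_of_digitSum B t b _ (by have := D.two_lt; omega) D.pos (by omega)
    hb.2.2.1 ?_⟩
  rw [← hcongr _ _ (D.gauss_congr f ψ (D.char_pow_mod _))] at h
  have e1 := key _ (Nat.mod_lt (b + ((2 * B + 1) ^ t - 1) / 2)
    (show (2 * B + 1) ^ t - 1 > 0 by omega))
  have e2 := key b (by omega)
  have e3 := key (((2 * B + 1) ^ t - 1) / 2) (by omega)
  apply Nat.eq_of_mul_eq_mul_left (show 0 < (2 * B + 1) ^ t - 1 by omega)
  rw [mul_add, mul_add, ← e1, ← e2, ← e3, ← mul_add, ← h]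
  ring

end TeichmullerLift

theorem exists_isPrimitive_frobenius_invariant (p : ℕ) [Fact p.Prime] (F : Type) [Field F]
    [Fintype F] [CharP F p] (K : Type) [Field K] (hK : (p : K) ≠ 0) :
    ∃ (L : Type) (_ : Field L) (_ : K →+* L) (ψ : AddChar F L),
      ψ.IsPrimitive ∧ ∀ x, ψ (x ^ p) = ψ x := by
  let pp : ℕ+ := ⟨p, (Fact.out : p.Prime).pos⟩
  let ψ := AddChar.primitiveZModChar pp K hK
  let _ : Algebra (ZMod p) F := ZMod.algebra _ _
  let ψ' := ψ.char.compAddMonoidHom (Algebra.trace (ZMod p) F).toAddMonoidHom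
  refine ⟨CyclotomicField ψ.n K, inferInstance, algebraMap _ _, ψ', ?_, ?_⟩
  · refine AddChar.IsPrimitive.of_ne_one (AddChar.ne_one_iff.2 ?_)
    obtain rfl := ringChar.eq F p
    obtain ⟨a, ha⟩ := FiniteField.trace_to_zmod_nondegenerate F one_ne_zero
    rw [one_mul] at ha
    exact ⟨a, fun hf => ha <|
      (ψ.prim.zmod_char_eq_one_iff pp <| Algebra.trace (ZMod (ringChar F)) F a).mp hf⟩
  · intro x
    have h := Algebra.trace_eq_of_algEquiv (FiniteField.frobeniusAlgEquiv (ZMod p) F p) x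
    rw [FiniteField.frobeniusAlgEquiv_apply, ZMod.card] at h
    change ψ.char (Algebra.trace (ZMod p) F (x ^ p)) = ψ.char (Algebra.trace (ZMod p) F x)
    rw [h]

namespace TeichmullerLift

variable {p t : ℕ} {F W : Type} [Field F] [Fintype F] [CommRing W]

theorem charP (D : TeichmullerLift p t F W) : CharP F p :=
  (CharP.charP_iff_prime_eq_zero D.prime).2 D.cast_p

theorem multiplicity_jacobiSum [IsDomain W] (D : TeichmullerLift p t F W) (hp0 : (p : W) ≠ 0)
    (b : ℕ) (hb : b ∈ genericExponents (p ^ t)) :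
    jacobiSum (D.char ^ b) (D.char ^ ((p ^ t - 1) / 2)) ≠ 0 ∧
    multiplicity (p : W) (jacobiSum (D.char ^ b) (D.char ^ ((p ^ t - 1) / 2))) =
      cyclicCarries p t b := by
  have := Fact.mk D.prime
  have := D.charP
  have hinj := IsFractionRing.injective W (FractionRing W)
  obtain ⟨L, _, g, ψ, hψ, hfrob⟩ := exists_isPrimitive_frobenius_invariant p F (FractionRing W) (by
    rw [← map_natCast (algebraMap W (FractionRing W)), ne_eq, map_eq_zero_iff _ hinj]; exact hp0)
  exact D.multiplicity_jacobiSum_of_addChar (g.comp (algebraMap W _)) ψ hp0 hψ hfrob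
    (g.injective.comp hinj) b hb

theorem odd (D : TeichmullerLift p t F W) : Odd (p ^ t) :=
  (D.prime.odd_of_ne_two (by have := D.two_lt; omega)).pow

theorem ringChar_ne_two (D : TeichmullerLift p t F W) : ringChar F ≠ 2 := by
  have := D.charP
  rw [ringChar.eq F p]
  have := D.two_lt
  omega

theorem lift_neg_one [IsDomain W] (D : TeichmullerLift p t F W) : D.lift (-1) = -1 := by
  have h : D.lift (-1) ^ 2 = 1 := by rw [← map_pow]; simp
  refine (sq_eq_one_iff.1 h).resolve_left fun h1 => ?_
  have h2 := congrArg D.res h1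
  rw [D.res_lift, map_one] at h2
  exact Ring.neg_one_ne_one_of_char_ne_two D.ringChar_ne_two h2

theorem char_pow_half [IsDomain W] [DecidableEq F] (D : TeichmullerLift p t F W) (x : F) :
    (D.char ^ ((p ^ t - 1) / 2)) x = (quadraticChar F x : W) := by
  rcases eq_or_ne x 0 with rfl | hx
  · simp [MulChar.map_zero]
  have h2 := D.ringChar_ne_two
  have h1 : (quadraticChar F x⁻¹ : F) = x⁻¹ ^ ((p ^ t - 1) / 2) := by
    rw [quadraticChar_eq_pow_of_char_ne_two' h2, D.card_eq]
    congr 1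
    have := D.odd
    obtain ⟨m, hm⟩ := this
    omega
  have h3 : quadraticChar F x⁻¹ = quadraticChar F x := by
    have h4 : quadraticChar F x * quadraticChar F x⁻¹ = 1 := by
      rw [← map_mul, mul_inv_cancel₀ hx, map_one]
    rcases quadraticChar_dichotomy hx with h | h <;> rw [h] at h4 ⊢ <;> linarith
  rw [D.char_pow_apply hx, ← map_pow, ← h1, h3]
  rcases quadraticChar_dichotomy hx with h | h
  · simp [h]
  · simp [h, D.lift_neg_one]

/-- The ring of Witt vectors of a finite field of odd characteristic. -/
noncomputable def wittVector (p t : ℕ) [Fact p.Prime] (F : Type) [Field F] [Fintype F] [CharP F p]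
    (hF : Fintype.card F = p ^ t) (hp : 2 < p) (ht : 0 < t) :
    TeichmullerLift p t F (WittVector p F) where
  res := WittVector.constantCoeff
  lift := { WittVector.teichmuller p with map_zero' := WittVector.teichmuller_zero p }
  res_lift x := WittVector.teichmuller_coeff_zero p x
  res_eq_zero_iff w := by
    constructor
    · intro h
      rcases eq_or_ne w 0 with rfl | hw
      · exact dvd_zero _
      obtain ⟨m, u, rfl⟩ := WittVector.exists_eq_pow_p_mul' w hw
      rcases m with _ | m
      · rw [pow_zero, one_mul] at h
        exact absurd h (u.isUnit.map _).ne_zero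
      · rw [pow_succ', mul_assoc]
        exact dvd_mul_right _ _
    · rintro ⟨u, rfl⟩
      rw [map_mul, map_natCast, CharP.cast_eq_zero, zero_mul]
  card_eq := hF
  two_lt := hp
  pos := ht
  prime := Fact.out
  finiteMultiplicity w hw := FiniteMultiplicity.of_not_isUnit
    (WittVector.irreducible p).not_isUnit hw

end TeichmullerLift

namespace TeichmullerLift

variable {p t : ℕ} {F W : Type} [Field F] [Fintype F] [CommRing W]

/-- The powers of the Teichmüller lift, a basis of the functions on `F`, indexed so that the
functions with index less than `p ^ t - 1` are the powers of the inverse Teichmüller character. -/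
def powFun (D : TeichmullerLift p t F W) (b : ℕ) (x : F) : W := D.lift x ^ (p ^ t - 1 - b)

theorem powFun_eq_char (D : TeichmullerLift p t F W) {b : ℕ} (hb : b < p ^ t - 1) (x : F) :
    D.powFun b x = (D.char ^ b) x := by
  unfold powFun
  rcases eq_or_ne x 0 with rfl | hx
  · rw [map_zero, zero_pow (by omega), MulChar.map_zero]
  · rw [D.char_pow_apply hx]
    have h1 : D.lift x * D.lift x⁻¹ = 1 := by rw [← map_mul, mul_inv_cancel₀ hx, map_one]
    have h2 := D.lift_pow_card_sub_one hx
    calc D.lift x ^ (p ^ t - 1 - b)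
        = D.lift x ^ (p ^ t - 1 - b) * (D.lift x * D.lift x⁻¹) ^ b := by rw [h1, one_pow, mul_one]
      _ = D.lift x ^ (p ^ t - 1 - b + b) * D.lift x⁻¹ ^ b := by rw [mul_pow, pow_add]; ring
      _ = _ := by rw [Nat.sub_add_cancel hb.le, h2, one_mul]

theorem two_mul_half (D : TeichmullerLift p t F W) :
    (p ^ t - 1) / 2 + (p ^ t - 1) / 2 = p ^ t - 1 := by
  obtain ⟨m, hm⟩ := D.odd
  omega

/-- The diagonal coefficients of the quadratic character convolution with respect to `powFun`. -/
noncomputable def coeff (D : TeichmullerLift p t F W) (b : ℕ) : W :=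
  if b = (p ^ t - 1) / 2 then ((p ^ t : ℕ) : W)
  else jacobiSum (D.char ^ b) (D.char ^ ((p ^ t - 1) / 2))

variable [DecidableEq F] [IsDomain W]

theorem sum_char_pow_mul (D : TeichmullerLift p t F W) (hneg : quadraticChar F (-1) = -1) (b : ℕ)
    {x : F} (hx : x ≠ 0) :
    ∑ y, (quadraticChar F (y - x) : W) * (D.char ^ b) y =
      -jacobiSum (D.char ^ b) (D.char ^ ((p ^ t - 1) / 2)) *
        (D.char ^ (b + (p ^ t - 1) / 2)) x := by
  rw [← Equiv.sum_comp (Equiv.mulLeft₀ x hx), jacobiSum, neg_mul, sum_mul, ← sum_neg_distrib]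
  refine sum_congr rfl fun z _ => ?_
  have h : quadraticChar F (x * z - x) = -(quadraticChar F x * quadraticChar F (1 - z)) := by
    rw [show x * z - x = (-1) * (x * (1 - z)) by ring, map_mul, map_mul, hneg]; ring
  rw [Equiv.mulLeft₀_apply, h, pow_add, MulChar.mul_apply, D.char_pow_half, D.char_pow_half,
    map_mul]
  push_cast
  ring

theorem sum_powFun (D : TeichmullerLift p t F W) (hneg : quadraticChar F (-1) = -1) {b : ℕ}
    (hb : b < p ^ t - 1) (x : F) :
    ∑ y, (quadraticChar F (y - x) : W) * D.powFun b y =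
      -D.coeff b * D.powFun ((b + (p ^ t - 1) / 2) % (p ^ t - 1)) x +
        if b = (p ^ t - 1) / 2 then ((p ^ t : ℕ) : W) - 1 else 0 := by
  have hq := D.three_le
  have hk := D.two_mul_half
  rw [D.powFun_eq_char (Nat.mod_lt _ (by omega)), D.char_pow_mod,
    sum_congr rfl fun y _ => by rw [D.powFun_eq_char hb y], coeff]
  rcases eq_or_ne x 0 with rfl | hx
  · rw [MulChar.map_zero, mul_zero, zero_add]
    have h1 : ∀ y : F, (quadraticChar F (y - 0) : W) * (D.char ^ b) y =
        (D.char ^ (b + (p ^ t - 1) / 2)) y := fun y => by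
      rw [sub_zero, ← D.char_pow_half, pow_add, MulChar.mul_apply, mul_comm]
    rw [sum_congr rfl fun y _ => h1 y]
    split_ifs with h
    · rw [h, hk, (D.char_pow_eq_one_iff _).2 dvd_rfl, MulChar.sum_one_eq_card_units,
        Fintype.card_units, D.card_eq, Nat.cast_sub (by omega), Nat.cast_one]
    · refine MulChar.sum_eq_zero_of_ne_one ?_
      rw [ne_eq, D.char_pow_eq_one_iff]
      rintro ⟨c, hc⟩
      rcases Nat.lt_or_ge c 1 with h' | h'
      · obtain rfl : c = 0 := by omega
        omega
      · rcases h'.eq_or_lt with rfl | h'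
        · omega
        · have : (p ^ t - 1) * 2 ≤ (p ^ t - 1) * c := Nat.mul_le_mul_left _ h'
          omega
  · rw [D.sum_char_pow_mul hneg b hx]
    split_ifs with h
    · have h1 : D.char ^ ((p ^ t - 1) / 2) * D.char ^ ((p ^ t - 1) / 2) = 1 := by
        rw [← pow_add, hk, D.char_pow_eq_one_iff]
      have h2 : D.char ^ ((p ^ t - 1) / 2) ≠ 1 := by
        rw [ne_eq, D.char_pow_eq_one_iff]
        intro h
        have := Nat.le_of_dvd (by omega) h
        omega
      have h3 := jacobiSum_nontrivial_inv h2
      rw [inv_eq_of_mul_eq_one_right h1, D.char_pow_half, hneg] at h3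
      rw [h, pow_add, h1, h3, MulChar.one_apply (Ne.isUnit hx)]
      push_cast
      ring
    · rw [add_zero]

omit [IsDomain W] in
theorem sum_powFun_last (D : TeichmullerLift p t F W) (x : F) :
    ∑ y, (quadraticChar F (y - x) : W) * D.powFun (p ^ t - 1) y = 0 := by
  simp only [powFun, Nat.sub_self, pow_zero, mul_one]
  rw [Fintype.sum_equiv (Equiv.subRight x) (fun y => (quadraticChar F (y - x) : W))
    (fun y => (quadraticChar F y : W)) fun y => rfl, ← Int.cast_sum,
      quadraticChar_sum_zero D.ringChar_ne_two, Int.cast_zero]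

variable {R : Type} [CommRing R] (g : W →+* R)

theorem sum_quadraticChar_expansion (D : TeichmullerLift p t F W)
    (hneg : quadraticChar F (-1) = -1) (c : ℕ → R) (x : F) :
    ∑ y, (quadraticChar F (y - x) : R) * ∑ b ∈ range (p ^ t), g (D.powFun b y) * c b =
      ∑ b ∈ range (p ^ t), g (D.powFun b x) *
        if b = p ^ t - 1 then (((p ^ t : ℕ) : R) - 1) * c ((p ^ t - 1) / 2)
        else -(g (D.coeff ((b + (p ^ t - 1) / 2) % (p ^ t - 1))) *
          c ((b + (p ^ t - 1) / 2) % (p ^ t - 1))) := by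
  have hq := D.three_le
  have hk := D.two_mul_half
  have h1 : ∀ b, ∑ y, (quadraticChar F (y - x) : R) * (g (D.powFun b y) * c b) =
      g (∑ y, (quadraticChar F (y - x) : W) * D.powFun b y) * c b := by
    intro b
    rw [map_sum, sum_mul]
    refine sum_congr rfl fun y _ => ?_
    rw [map_mul, map_intCast, mul_assoc]
  simp only [mul_sum]
  rw [sum_comm, sum_congr rfl fun b _ => h1 b]
  conv_lhs => rw [show p ^ t = p ^ t - 1 + 1 by omega, sum_range_succ, D.sum_powFun_last]
  conv_rhs => rw [show p ^ t = p ^ t - 1 + 1 by omega, sum_range_succ]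
  simp only [Nat.add_sub_cancel, if_true]
  rw [show p ^ t - 1 + 1 = p ^ t by omega, map_zero, zero_mul, add_zero]
  set k := (p ^ t - 1) / 2 with hkdef
  set n := p ^ t - 1 with hn
  have hσ : ∀ b < n, ((b + k) % n + k) % n = b := fun b hb => by
    rw [Nat.mod_add_mod, add_assoc, hk, Nat.add_mod_right, Nat.mod_eq_of_lt hb]
  have h2 : ∑ b ∈ range n, g (D.powFun b x) *
      (if b = n then (((p ^ t : ℕ) : R) - 1) * c k
        else -(g (D.coeff ((b + k) % n)) * c ((b + k) % n))) =
      ∑ b ∈ range n, g (D.powFun ((b + k) % n) x) * (-(g (D.coeff b) * c b)) := by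
    refine sum_nbij' (fun b => (b + k) % n) (fun b => (b + k) % n)
      (fun b _ => mem_range.2 (Nat.mod_lt _ (by omega)))
      (fun b _ => mem_range.2 (Nat.mod_lt _ (by omega)))
      (fun b hb => hσ b (mem_range.1 hb)) (fun b hb => hσ b (mem_range.1 hb)) fun b hb => ?_
    have hb := mem_range.1 hb
    rw [if_neg hb.ne, hσ b hb]
  have h3 : g (D.powFun n x) = 1 := by simp [powFun, ← hn]
  have h4 : (((p ^ t : ℕ) : R) - 1) * c k =
      ∑ b ∈ range n, if b = k then (((p ^ t : ℕ) : R) - 1) * c b else 0 := by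
    rw [sum_ite_eq' (range n) k, if_pos (mem_range.2 (by omega))]
  rw [h2, h3, one_mul, h4, ← sum_add_distrib]
  refine sum_congr rfl fun b hb => ?_
  rw [D.sum_powFun hneg (mem_range.1 hb), ← hkdef, ← hn]
  split_ifs
  · simp only [map_add, map_mul, map_neg, map_sub, map_natCast, map_one]; ring
  · simp only [map_add, map_mul, map_neg, map_zero]; ring

omit [DecidableEq F] [IsDomain W] in
theorem bijective_expansion (D : TeichmullerLift p t F W)
    (hunit : ∀ w, D.res w ≠ 0 → IsUnit w) :
    Function.Bijective fun (c : Fin (p ^ t) → R) (x : F) =>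
      ∑ b : Fin (p ^ t), g (D.powFun b x) * c b := by
  let ε : F ≃ Fin (p ^ t) := Fintype.equivFinOfCardEq D.card_eq
  let V : Matrix (Fin (p ^ t)) (Fin (p ^ t)) R := vandermonde fun i => g (D.lift (ε.symm i))
  have hV : IsUnit V.det := by
    rw [det_vandermonde]
    refine IsUnit.prod_univ_iff.2 fun i => ?_
    refine IsUnit.prod_iff.2 fun j hj => ?_
    rw [← map_sub]
    refine (hunit _ ?_).map g
    rw [map_sub, D.res_lift, D.res_lift, sub_ne_zero]
    exact fun h => (mem_Ioi.1 hj).ne (ε.symm.injective h).symm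
  have h1 : Function.Bijective V.mulVec :=
    ⟨mulVec_injective_of_isUnit ((isUnit_iff_isUnit_det V).2 hV),
      mulVec_surjective_iff_isUnit.2 ((isUnit_iff_isUnit_det V).2 hV)⟩
  have h2 : (fun (c : Fin (p ^ t) → R) (x : F) => ∑ b : Fin (p ^ t), g (D.powFun b x) * c b) =
      (ε.arrowCongr (Equiv.refl R)).symm ∘ V.mulVec ∘ (Fin.revPerm.arrowCongr (Equiv.refl R)) := by
    ext c x
    simp only [Function.comp, Equiv.arrowCongr_symm, Equiv.arrowCongr_apply, Equiv.symm_symm,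
      Equiv.refl_symm, Equiv.coe_refl, id, mulVec, dotProduct]
    refine Fintype.sum_equiv Fin.revPerm _ _ fun b => ?_
    simp only [V, vandermonde_apply, Equiv.symm_apply_apply, Fin.revPerm_apply, powFun, map_pow,
      Fin.val_rev, Fin.revPerm_symm, Fin.rev_rev]
    congr 2
    omega
  rw [h2]
  exact (Equiv.bijective _).comp (h1.comp (Equiv.bijective _))

/-- The annihilator conditions for the coefficients of a function orthogonal to all translates of
the quadratic character. -/
noncomputable def kernelCoeff (D : TeichmullerLift p t F W) (b : ℕ) : W :=
  if b = p ^ t - 1 then 0 else if b = (p ^ t - 1) / 2 then 1 else D.coeff b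

theorem card_quadraticChar_kernel (D : TeichmullerLift p t F W)
    (hneg : quadraticChar F (-1) = -1) (hunit : ∀ w, D.res w ≠ 0 → IsUnit w) :
    Nat.card {f : F → R // ∀ x, ∑ y, (quadraticChar F (y - x) : R) * f y = 0} =
      ∏ b ∈ range (p ^ t), Nat.card {c : R // g (D.kernelCoeff b) * c = 0} := by
  have hq := D.three_le
  have hk := D.two_mul_half
  have hbij := D.bijective_expansion g hunit
  have key : ∀ c : Fin (p ^ t) → R, (∀ b : Fin (p ^ t), g (D.kernelCoeff b) * c b = 0) ↔
      ∀ x, ∑ y, (quadraticChar F (y - x) : R) * ∑ b : Fin (p ^ t), g (D.powFun b y) * c b = 0 := by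
    intro c
    obtain ⟨c, rfl⟩ : ∃ c' : ℕ → R, c = fun b : Fin (p ^ t) => c' b :=
      ⟨fun n => if h : n < p ^ t then c ⟨n, h⟩ else 0, by ext b; simp⟩
    let d : ℕ → R := fun b => if b = p ^ t - 1 then (((p ^ t : ℕ) : R) - 1) * c ((p ^ t - 1) / 2)
        else -(g (D.coeff ((b + (p ^ t - 1) / 2) % (p ^ t - 1))) *
          c ((b + (p ^ t - 1) / 2) % (p ^ t - 1)))
    have h1 : ∀ x, ∑ y, (quadraticChar F (y - x) : R) * ∑ b : Fin (p ^ t), g (D.powFun b y) * c b =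
        ∑ b : Fin (p ^ t), g (D.powFun b x) * d b := by
      intro x
      have h0 : ∀ y, ∑ b : Fin (p ^ t), g (D.powFun b y) * c b =
          ∑ b ∈ range (p ^ t), g (D.powFun b y) * c b := fun y =>
        Fin.sum_univ_eq_sum_range (fun b => g (D.powFun b y) * c b) _
      simp only [h0]
      rw [D.sum_quadraticChar_expansion g hneg c x,
        Fin.sum_univ_eq_sum_range (fun b => g (D.powFun b x) * d b)]
    have h2 : (∀ x, ∑ b : Fin (p ^ t), g (D.powFun b x) * d b = 0) ↔ ∀ b < p ^ t, d b = 0 := by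
      constructor
      · intro h b hb
        have := @hbij.1 (fun b : Fin (p ^ t) => d b) 0 (by ext x; simpa using h x)
        exact congrFun this ⟨b, hb⟩
      · intro h x
        exact sum_eq_zero fun b _ => by rw [h b b.2, mul_zero]
    simp only [h1, h2]
    have h3 : (∀ b : Fin (p ^ t), g (D.kernelCoeff b) * c b = 0) ↔
        ∀ b < p ^ t, g (D.kernelCoeff b) * c b = 0 := Fin.forall_iff
    rw [h3]
    have hσ : ∀ b < p ^ t - 1,
        ((b + (p ^ t - 1) / 2) % (p ^ t - 1) + (p ^ t - 1) / 2) % (p ^ t - 1) = b := fun b hb => by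
      rw [Nat.mod_add_mod, add_assoc, hk, Nat.add_mod_right, Nat.mod_eq_of_lt hb]
    constructor
    · intro h b hb
      have hck : c ((p ^ t - 1) / 2) = 0 := by
        have := h ((p ^ t - 1) / 2) (by omega)
        rwa [kernelCoeff, if_neg (by omega), if_pos rfl, map_one, one_mul] at this
      simp only [d]
      split_ifs with h4
      · rw [hck, mul_zero]
      · have hlt := Nat.mod_lt (b + (p ^ t - 1) / 2) (show p ^ t - 1 > 0 by omega)
        generalize (b + (p ^ t - 1) / 2) % (p ^ t - 1) = r at *
        rw [neg_eq_zero]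
        rcases eq_or_ne r ((p ^ t - 1) / 2) with rfl | hr
        · rw [hck, mul_zero]
        · have := h r (by omega)
          rwa [kernelCoeff, if_neg (by omega), if_neg hr] at this
    · intro h b hb
      have hcoeff : ∀ b < p ^ t - 1, g (D.coeff b) * c b = 0 := by
        intro b hb
        have hlt := Nat.mod_lt (b + (p ^ t - 1) / 2) (show p ^ t - 1 > 0 by omega)
        have := h ((b + (p ^ t - 1) / 2) % (p ^ t - 1)) (by omega)
        simp only [d] at this
        rwa [if_neg hlt.ne, hσ b hb, neg_eq_zero] at this
      rw [kernelCoeff]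
      split_ifs with h4 h5
      · simp
      · subst h5
        have h6 := hcoeff ((p ^ t - 1) / 2) (by omega)
        have h7 := h (p ^ t - 1) (by omega)
        rw [coeff, if_pos rfl, map_natCast] at h6
        simp only [d, if_true] at h7
        rw [map_one, one_mul]
        linear_combination h6 - h7
      · exact hcoeff b (by omega)
  rw [← Nat.card_congr ((Equiv.ofBijective _ hbij).subtypeEquiv key),
    Nat.card_congr (Equiv.subtypePiEquivPi (p := fun (b : Fin (p ^ t)) (c : R) =>
      g (D.kernelCoeff b) * c = 0)), Nat.card_pi,
    Fin.prod_univ_eq_prod_range (fun b => Nat.card {c : R // g (D.kernelCoeff b) * c = 0})]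

end TeichmullerLift

/-- The functions with values in `A` annihilated by an integer matrix. -/
def Matrix.addKernel {ι : Type*} [Fintype ι] (S : Matrix ι ι ℤ) (A : Type*) [AddCommGroup A] :
    AddSubgroup (ι → A) where
  carrier := {f | ∀ x, ∑ y, S x y • f y = 0}
  zero_mem' x := by simp
  add_mem' {f g} hf hg x := by simp [smul_add, sum_add_distrib, hf x, hg x]
  neg_mem' {f} hf x := by simp [hf x]

theorem Matrix.mem_addKernel {ι A : Type*} [Fintype ι] [AddCommGroup A] {S : Matrix ι ι ℤ}
    {f : ι → A} : f ∈ S.addKernel A ↔ ∀ x, ∑ y, S x y • f y = 0 := Iff.rfl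

theorem Matrix.card_addKernel_of_pi_equiv {ι A B : Type*} [Fintype ι] [AddCommGroup A]
    [AddCommGroup B] (S : Matrix ι ι ℤ) {t : ℕ} (e : (Fin t → A) ≃+ B) :
    Nat.card (S.addKernel B) = Nat.card (S.addKernel A) ^ t := by
  let ε : (ι → B) ≃ (Fin t → ι → A) :=
    ((Equiv.refl ι).arrowCongr e.symm.toEquiv).trans (Equiv.piComm fun _ _ => A)
  have h : ∀ f : ι → B, f ∈ S.addKernel B ↔ ∀ i, ε f i ∈ S.addKernel A := by
    intro f
    simp only [mem_addKernel]
    rw [forall_comm]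
    refine forall_congr' fun x => ?_
    rw [← map_eq_zero_iff e.symm e.symm.injective, funext_iff]
    refine forall_congr' fun i => ?_
    rw [map_sum, Finset.sum_apply]
    simp only [map_zsmul]
    rfl
  rw [Nat.card_congr (ε.subtypeEquiv (q := fun f => ∀ i, f i ∈ S.addKernel A) h), Nat.card_congr
    (Equiv.subtypePiEquivPi (p := fun (_ : Fin t) (f : ι → A) => f ∈ S.addKernel A)),
    Nat.card_pi, prod_const, card_univ, Fintype.card_fin]

theorem card_nsmul_eq_zero_of_pi_equiv {A B : Type*} [AddCommGroup A]
    [AddCommGroup B] (n : ℕ) {t : ℕ} (e : (Fin t → A) ≃+ B) :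
    Nat.card {b : B // n • b = 0} = Nat.card {a : A // n • a = 0} ^ t := by
  have h : ∀ b : B, n • b = 0 ↔ ∀ i, n • e.symm b i = 0 := by
    intro b
    rw [← map_eq_zero_iff e.symm e.symm.injective, funext_iff]
    simp
  rw [Nat.card_congr (e.symm.toEquiv.subtypeEquiv (q := fun f => ∀ i, n • f i = 0) h),
    Nat.card_congr
    (Equiv.subtypePiEquivPi (p := fun (_ : Fin t) (a : A) => n • a = 0)),
    Nat.card_pi, prod_const, card_univ, Fintype.card_fin]

theorem ZMod.card_nsmul_eq_zero (n k : ℕ) [NeZero n] :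
    Nat.card {z : ZMod n // k • z = 0} = Nat.gcd n k := by
  have h := IsAddCyclic.card_nsmulAddMonoidHom_ker (ZMod n) k
  rw [Nat.card_zmod] at h
  exact h

/-- The matrix of values of the quadratic character at differences of elements of `F`. -/
def quadraticCharMatrix (F : Type*) [Field F] [Fintype F] [DecidableEq F] : Matrix F F ℤ :=
  of fun x y => quadraticChar F (y - x)

namespace TeichmullerLift

variable {p t : ℕ} {F W R : Type} [Field F] [Fintype F] [CommRing W] [CommRing R]

theorem nonempty_pi_addEquiv (D : TeichmullerLift p t F W) (g : W →+* R)
    (hg : Function.Surjective g) {m : ℕ} (hm : (p : R) ^ m = 0) (hcard : Nat.card R = (p ^ t) ^ m) :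
    Nonempty ((Fin t → ZMod (p ^ m)) ≃+ R) := by
  have := Fact.mk D.prime
  have := D.charP
  let _ : Algebra (ZMod p) F := ZMod.algebra F p
  have hrank : Module.finrank (ZMod p) F = t := by
    have h := Module.card_eq_pow_finrank (K := ZMod p) (V := F)
    rw [D.card_eq, ZMod.card] at h
    exact (Nat.pow_right_injective D.prime.two_le h).symm
  let β := Module.finBasisOfFinrankEq (ZMod p) F hrank
  let ψ : R → ZMod (p ^ m) →+ R := fun r => ZMod.lift (p ^ m) ⟨zmultiplesHom R r, by
    rw [zmultiplesHom_apply, natCast_zsmul, nsmul_eq_mul, Nat.cast_pow, hm, zero_mul]⟩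
  have hψ : ∀ r (k : ℕ), ψ r (k : ZMod (p ^ m)) = k * r := by
    intro r k
    rw [← Int.cast_natCast k, ZMod.lift_coe]
    simp
  let φ : (Fin t → ZMod (p ^ m)) →+ R :=
    ∑ i, (ψ (g (D.lift (β i)))).comp (Pi.evalAddMonoidHom _ i)
  have hφ : ∀ c, φ c = ∑ i, ψ (g (D.lift (β i))) (c i) := fun c => by simp [φ]
  have hstep : ∀ r : R, ∃ a ∈ φ.range, ∃ r', r = a + p * r' := by
    intro r
    obtain ⟨w, rfl⟩ := hg r
    let k : Fin t → ℕ := fun i => (β.repr (D.res w) i).val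
    have h1 : D.res (w - ∑ i, (k i : W) * D.lift (β i)) = 0 := by
      rw [map_sub, map_sum, sub_eq_zero]
      conv_lhs => rw [← β.sum_repr (D.res w)]
      refine sum_congr rfl fun i _ => ?_
      rw [map_mul, D.res_lift, map_natCast, Algebra.smul_def]
      congr 1
      rw [← map_natCast (algebraMap (ZMod p) F), ZMod.natCast_zmod_val]
    obtain ⟨w', hw'⟩ := (D.res_eq_zero_iff _).1 h1
    refine ⟨φ fun i => (k i : ZMod (p ^ m)), ⟨_, rfl⟩, g w', ?_⟩
    rw [hφ, sub_eq_iff_eq_add.1 hw', map_add, map_mul, map_natCast,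
      map_sum, add_comm]
    congr 1
    refine sum_congr rfl fun i _ => ?_
    rw [map_mul, map_natCast, hψ]
  have hiter : ∀ j, ∀ r : R, ∃ a ∈ φ.range, ∃ r', r = a + (p : R) ^ j * r' := by
    intro j
    induction j with
    | zero => exact fun r => ⟨0, zero_mem _, r, by simp⟩
    | succ j ih =>
      intro r
      obtain ⟨a, ha, r', rfl⟩ := ih r
      obtain ⟨a', ha', s, rfl⟩ := hstep r'
      refine ⟨a + (p ^ j : ℕ) • a', add_mem ha (nsmul_mem ha' _), s, ?_⟩
      rw [nsmul_eq_mul]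
      push_cast
      ring
  have hsurj : Function.Surjective φ := by
    intro r
    obtain ⟨a, ⟨c, rfl⟩, r', rfl⟩ := hiter m r
    exact ⟨c, by rw [hm, zero_mul, add_zero]⟩
  have := NeZero.mk D.prime.ne_zero
  refine ⟨(AddEquiv.ofBijective φ ?_)⟩
  refine hsurj.bijective_of_nat_card_le ?_
  rw [hcard, Nat.card_fun, Nat.card_zmod, Nat.card_eq_fintype_card, Fintype.card_fin, ← pow_mul,
    ← pow_mul, mul_comm]

variable [DecidableEq F] [IsDomain W]

omit [DecidableEq F] in
theorem card_kernelCoeff_annihilator (D : TeichmullerLift p t F W) (g : W →+* R)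
    (hp0 : (p : W) ≠ 0) (hunit : ∀ w, D.res w ≠ 0 → IsUnit w) {b : ℕ}
    (hb : b ∈ genericExponents (p ^ t)) :
    Nat.card {c : R // g (D.kernelCoeff b) * c = 0} =
      Nat.card {c : R // (p ^ cyclicCarries p t b) • c = 0} := by
  obtain ⟨h0, hv⟩ := D.multiplicity_jacobiSum hp0 b hb
  obtain ⟨_, -, h1, h2⟩ := mem_filter.1 hb
  obtain ⟨u, hu, hndvd⟩ := (D.finiteMultiplicity _ h0).exists_eq_pow_mul_and_not_dvd
  rw [← D.res_eq_zero_iff] at hndvd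
  refine Nat.card_congr (Equiv.subtypeEquivRight fun c => ?_)
  rw [kernelCoeff, if_neg h2, if_neg h1, coeff, if_neg h1, hu, hv, map_mul, map_pow, map_natCast,
    mul_right_comm, ((hunit u hndvd).map g).mul_left_eq_zero, nsmul_eq_mul, Nat.cast_pow]

theorem card_addKernel_zmod (D : TeichmullerLift p t F W) (g : W →+* R)
    (hg : Function.Surjective g) {m : ℕ} (hm : (p : R) ^ m = 0) (hcard : Nat.card R = (p ^ t) ^ m)
    (hp0 : (p : W) ≠ 0) (hunit : ∀ w, D.res w ≠ 0 → IsUnit w)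
    (hneg : quadraticChar F (-1) = -1) :
    Nat.card ((quadraticCharMatrix F).addKernel (ZMod (p ^ m))) =
      p ^ (m + ∑ b ∈ genericExponents (p ^ t), min (cyclicCarries p t b) m) := by
  have := Fact.mk D.prime
  have := NeZero.mk D.prime.ne_zero
  have hk := D.two_mul_half
  have hq := D.three_le
  obtain ⟨e⟩ := D.nonempty_pi_addEquiv g hg hm hcard
  refine Nat.pow_left_injective D.pos.ne' ?_
  dsimp only
  rw [← card_addKernel_of_pi_equiv (quadraticCharMatrix F) e]
  let E : ℕ → ℕ := fun b => if b = 0 then 0 else if b = (p ^ t - 1) / 2 then 0 else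
    if b = p ^ t - 1 then m else min (cyclicCarries p t b) m
  have h1 := D.card_quadraticChar_kernel g hneg hunit
  have h2 : Nat.card ((quadraticCharMatrix F).addKernel R) =
      Nat.card {f : F → R // ∀ x, ∑ y, (quadraticChar F (y - x) : R) * f y = 0} := by
    refine Nat.card_congr (Equiv.subtypeEquivRight fun f => ?_)
    simp [mem_addKernel, quadraticCharMatrix]
  have h3 : ∀ b ∈ range (p ^ t), Nat.card {c : R // g (D.kernelCoeff b) * c = 0} =
      (p ^ E b) ^ t := by
    intro b hb
    by_cases hgen : b ∈ genericExponents (p ^ t)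
    · obtain ⟨-, h4, h5, h6⟩ := mem_filter.1 hgen
      rw [D.card_kernelCoeff_annihilator g hp0 hunit hgen, card_nsmul_eq_zero_of_pi_equiv _ e,
        ZMod.card_nsmul_eq_zero, gcd_prime_pow D.prime D.prime, if_pos rfl]
      simp only [E, if_neg h4, if_neg h5, if_neg h6]
    · have h4 : b = 0 ∨ b = (p ^ t - 1) / 2 ∨ b = p ^ t - 1 := by
        by_contra! h
        exact hgen (mem_filter.2 ⟨hb, h⟩)
      have hone : ∀ a : R, IsUnit a → Nat.card {c : R // a * c = 0} = 1 := by
        intro a ha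
        refine Nat.card_eq_one_iff_exists.2 ⟨⟨0, mul_zero _⟩, fun c => Subtype.ext ?_⟩
        exact ha.mul_right_eq_zero.1 c.2
      rcases h4 with rfl | rfl | rfl
      · have h7 : D.char ^ ((p ^ t - 1) / 2) ≠ 1 := by
          rw [ne_eq, D.char_pow_eq_one_iff]
          intro h
          have := Nat.le_of_dvd (by omega) h
          omega
        rw [kernelCoeff, if_neg (by omega), if_neg (by omega), coeff, if_neg (by omega), pow_zero,
          jacobiSum_one_nontrivial h7, map_neg, map_one, hone _ isUnit_one.neg]
        simp [E]
      · rw [kernelCoeff, if_neg (by omega), if_pos rfl, map_one, hone _ isUnit_one]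
        simp [E]
      · have h8 : E (p ^ t - 1) = m := by
          simp only [E]
          rw [if_neg (by omega), if_neg (by omega), if_pos trivial]
        rw [kernelCoeff, if_pos rfl, map_zero, h8, ← pow_mul, mul_comm, pow_mul, ← hcard]
        simp
  have h4 : ∑ b ∈ range (p ^ t), E b =
      m + ∑ b ∈ genericExponents (p ^ t), min (cyclicCarries p t b) m := by
    rw [genericExponents_union _ hq]
    congr 1
    · simp only [E]
      rw [if_pos trivial, if_neg (by omega), if_pos trivial, if_neg (by omega), if_neg (by omega),
        if_pos trivial]
      omega
    · refine sum_congr rfl fun b hb => ?_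
      obtain ⟨-, h4, h5, h6⟩ := mem_filter.1 hb
      simp only [E, if_neg h4, if_neg h5, if_neg h6]
  rw [h2, h1, prod_congr rfl h3, prod_pow, prod_pow_eq_pow_sum, h4]

end TeichmullerLift

theorem card_addKernel_quadraticChar {p t : ℕ} (hp : p.Prime) (hp2 : 2 < p) (ht : 0 < t)
    {F : Type} [Field F] [Fintype F] [DecidableEq F] (hF : Fintype.card F = p ^ t)
    (hneg : quadraticChar F (-1) = -1) (m : ℕ) :
    Nat.card ((quadraticCharMatrix F).addKernel (ZMod (p ^ m))) =
      p ^ (m + ∑ b ∈ genericExponents (p ^ t), min (cyclicCarries p t b) m) := by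
  have := Fact.mk hp
  have : CharP F p := charP_of_card_eq_prime_pow hF
  refine (TeichmullerLift.wittVector p t F hF hp2 ht).card_addKernel_zmod
    (WittVector.truncate m) (WittVector.truncate_surjective p m F) ?_ ?_
    (WittVector.irreducible p).ne_zero
      (fun w hw => WittVector.isUnit_of_coeff_zero_ne_zero w hw) hneg
  · rw [← map_natCast (WittVector.truncate m), ← map_pow, ← RingHom.mem_ker,
      WittVector.mem_ker_truncate]
    intro i hi
    exact WittVector.coeff_p_pow_eq_zero p F hi.ne
  · rw [Nat.card_eq_fintype_card, TruncatedWittVector.card, hF]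

/-- The kernel of an operator `Q` satisfying the identities of the Laplacian of a doubly regular
tournament with transpose `T`, over a ring in which the number of vertices is invertible. -/
theorem card_ker_of_doublyRegular {F R : Type*} [Fintype F] [CommRing R] [Finite R]
    (Q T : (F → R) →ₗ[R] (F → R)) (c : R) (hq : IsUnit (Fintype.card F : R))
    (hodd : Odd (Fintype.card F))
    (hQT : ∀ f x, Q (T f) x = c * (Fintype.card F * f x - ∑ y, f y))
    (hTQ : ∀ f x, T (Q f) x = c * (Fintype.card F * f x - ∑ y, f y))
    (hadd : ∀ f x, Q f x + T f x = Fintype.card F * f x - ∑ y, f y)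
    (hconst : ∀ a, Q (fun _ => a) = 0) (hsum : ∀ f, ∑ x, Q f x = 0)
    (hsymm : Nat.card {f : F → R // Q f = 0 ∧ ∑ x, f x = 0} =
      Nat.card {f : F → R // T f = 0 ∧ ∑ x, f x = 0}) :
    Nat.card {f : F → R // Q f = 0} =
      Nat.card R * Nat.card {a : R // c * a = 0} ^ ((Fintype.card F - 1) / 2) := by
  obtain ⟨u, hu⟩ := hq
  set q := Fintype.card F with hqdef
  let r : R := ↑u⁻¹
  have hr : r * q = 1 := by rw [← hu]; exact u.inv_mul
  have hcard : ∀ a : R, ∑ _x : F, a = q * a := fun a => by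
    rw [sum_const, card_univ, nsmul_eq_mul]
  have hconstT : ∀ a, T (fun _ => a) = 0 := fun a => by
    ext x
    have := hadd (fun _ => a) x
    rw [hconst, hcard, sub_self, Pi.zero_apply, zero_add] at this
    exact this
  have hsumT : ∀ f, ∑ x, T f x = 0 := fun f => by
    have h := sum_congr rfl fun (x : F) (_ : x ∈ univ) => hadd f x
    rw [sum_add_distrib, hsum, sum_sub_distrib, ← mul_sum, hcard, sub_self, zero_add] at h
    exact h
  let e₁ : {f : F → R // Q f = 0} ≃ R × {f : F → R // Q f = 0 ∧ ∑ x, f x = 0} :=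
    { toFun := fun f => (r * ∑ y, f.1 y, ⟨f.1 - fun _ => r * ∑ y, f.1 y, by
        rw [map_sub, hconst, f.2, sub_zero], by
        simp only [Pi.sub_apply]
        rw [sum_sub_distrib, hcard]
        linear_combination -(∑ y, f.1 y) * hr⟩)
      invFun := fun a => ⟨(fun _ : F => a.1) + a.2.1, by
        rw [map_add, hconst, a.2.2.1, add_zero]⟩
      left_inv := fun f => by
        refine Subtype.ext (funext fun x => ?_)
        simp
      right_inv := fun b => by
        obtain ⟨a, f, hf⟩ := b
        have h : r * ∑ y, (a + f y) = a := by
          rw [sum_add_distrib, hf.2, hcard]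
          linear_combination a * hr
        refine Prod.ext h (Subtype.ext (funext fun x => ?_))
        simp [h] }
  let e₂ : (F → {a : R // c * a = 0}) ≃ {a : R // c * a = 0} ×
      {f : F → R // Q f = 0 ∧ ∑ x, f x = 0} × {f : F → R // T f = 0 ∧ ∑ x, f x = 0} :=
    { toFun := fun h => (⟨r * ∑ y, (h y).1, by
          rw [mul_left_comm, mul_sum, sum_congr rfl fun x _ => (h x).2, sum_const_zero, mul_zero]⟩,
        ⟨r • T fun y => (h y).1, by
          rw [LinearMap.map_smul]
          ext x
          rw [Pi.smul_apply, hQT, mul_sub, mul_left_comm, (h x).2, mul_sum,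
            sum_congr rfl fun x _ => (h x).2]
          simp, by
          simp only [Pi.smul_apply, ← smul_sum, hsumT, smul_zero]⟩,
        ⟨r • Q fun y => (h y).1, by
          rw [LinearMap.map_smul]
          ext x
          rw [Pi.smul_apply, hTQ, mul_sub, mul_left_comm, (h x).2, mul_sum,
            sum_congr rfl fun x _ => (h x).2]
          simp, by
          simp only [Pi.smul_apply, ← smul_sum, hsum, smul_zero]⟩)
      invFun := fun a x => ⟨a.1.1 + a.2.1.1 x + a.2.2.1 x, by
        obtain ⟨⟨a, ha⟩, ⟨f, hf, hf'⟩, g, hg, hg'⟩ := a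
        have h1 := hTQ f x
        have h2 := hQT g x
        rw [hf, hf', map_zero, Pi.zero_apply] at h1
        rw [hg, hg', map_zero, Pi.zero_apply] at h2
        linear_combination ha - r * h1 - r * h2 - (c * f x + c * g x) * hr⟩
      left_inv := fun h => by
        ext x
        have := hadd (fun y => (h y).1) x
        simp only [Pi.smul_apply, smul_eq_mul]
        linear_combination r * this + (h x).1 * hr
      right_inv := fun ⟨⟨a, ha⟩, ⟨f, hf, hf'⟩, g, hg, hg'⟩ => by
        have h0 : ∀ P : (F → R) →ₗ[R] (F → R), (∀ a, P (fun _ => a) = 0) →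
            P (fun y => a + f y + g y) = P f + P g := fun P hP => by
          have : (fun y => a + f y + g y) = (fun _ => a) + f + g := rfl
          rw [this, map_add, map_add, hP, zero_add]
        ext x
        · simp only [sum_add_distrib, hf', hg', hcard]
          linear_combination a * hr
        · simp only [h0 T hconstT, hg, add_zero, Pi.smul_apply, smul_eq_mul]
          have := hadd f x
          rw [hf, hf', Pi.zero_apply] at this
          linear_combination r * this + f x * hr
        · simp only [h0 Q hconst, hf, zero_add, Pi.smul_apply, smul_eq_mul]
          have := hadd g x
          rw [hg, hg', Pi.zero_apply] at this
          linear_combination r * this + g x * hr }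
  have h₁ := Nat.card_congr e₁
  have h₂ := Nat.card_congr e₂
  rw [Nat.card_prod] at h₁
  rw [Nat.card_prod, Nat.card_prod, ← hsymm, Nat.card_fun, Nat.card_eq_fintype_card (α := F),
    ← hqdef] at h₂
  obtain ⟨k, hk⟩ := hodd
  have hB : 0 < Nat.card {a : R // c * a = 0} :=
    have : Nonempty {a : R // c * a = 0} := ⟨⟨0, mul_zero c⟩⟩
    Nat.card_pos
  rw [hk, pow_succ', Nat.mul_left_cancel_iff hB, mul_comm 2 k, pow_mul, ← sq] at h₂
  rw [h₁, ← Nat.pow_left_injective two_ne_zero h₂, show (q - 1) / 2 = k by omega]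

section
variable {F : Type} [Field F] [Fintype F] [DecidableEq F]

theorem quadraticCharMatrix_transpose (hneg : quadraticChar F (-1) = -1) :
    (quadraticCharMatrix F)ᵀ = -quadraticCharMatrix F := by
  ext x y
  simp only [quadraticCharMatrix, transpose_apply, of_apply, Matrix.neg_apply]
  rw [← neg_sub, neg_eq_neg_one_mul, map_mul, hneg, neg_one_mul]

theorem quadraticCharMatrix_mul_ones (h2 : ringChar F ≠ 2) :
    quadraticCharMatrix F * of (fun _ _ : F => (1 : ℤ)) = 0 := by
  ext x y
  simp only [quadraticCharMatrix, mul_apply, of_apply, mul_one, Matrix.zero_apply]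
  rw [Fintype.sum_equiv (Equiv.subRight x) (fun y => quadraticChar F (y - x))
    (fun y => quadraticChar F y) fun y => rfl, quadraticChar_sum_zero h2]

theorem ones_mul_quadraticCharMatrix (h2 : ringChar F ≠ 2) :
    of (fun _ _ : F => (1 : ℤ)) * quadraticCharMatrix F = 0 := by
  ext x y
  simp only [quadraticCharMatrix, mul_apply, of_apply, one_mul, Matrix.zero_apply]
  rw [Fintype.sum_equiv (Equiv.subLeft y) (fun x => quadraticChar F (y - x))
    (fun y => quadraticChar F y) fun y => rfl, quadraticChar_sum_zero h2]

theorem quadraticCharMatrix_mul_self (h2 : ringChar F ≠ 2) (hneg : quadraticChar F (-1) = -1) :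
    quadraticCharMatrix F * quadraticCharMatrix F =
      of (fun _ _ : F => (1 : ℤ)) - (Fintype.card F : ℤ) • (1 : Matrix F F ℤ) := by
  ext x z
  simp only [quadraticCharMatrix, mul_apply, of_apply, Matrix.sub_apply, Matrix.smul_apply,
    one_apply, smul_eq_mul,
    mul_ite, mul_one, mul_zero]
  split_ifs with h
  · subst h
    have h1 : ∀ y, quadraticChar F (y - x) * quadraticChar F (x - y) =
        if y = x then 0 else -1 := by
      intro y
      split_ifs with hy
      · simp [hy]
      · rw [← neg_sub y x, neg_eq_neg_one_mul (y - x), map_mul, hneg, mul_left_comm, ← sq,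
          quadraticChar_sq_one (sub_ne_zero.2 hy), mul_one]
    have h3 : ∀ y : F, (if y = x then (0 : ℤ) else -1) = (if y = x then 1 else 0) - 1 := by
      intro y; split_ifs <;> rfl
    simp only [h1, h3]
    rw [sum_sub_distrib, sum_ite_eq' univ x]
    simp
  · have hd : z - x ≠ 0 := sub_ne_zero.2 (Ne.symm h)
    rw [← Equiv.sum_comp ((Equiv.mulLeft₀ _ hd).trans (Equiv.addRight x))]
    have h1 : ∀ u, quadraticChar F ((z - x) * u + x - x) * quadraticChar F (z - ((z - x) * u + x)) =
        quadraticChar F u * quadraticChar F (1 - u) := by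
      intro u
      rw [add_sub_cancel_right, show z - ((z - x) * u + x) = (z - x) * (1 - u) by ring, map_mul,
        map_mul]
      linear_combination (quadraticChar F u * quadraticChar F (1 - u)) * quadraticChar_sq_one hd
    simp only [Equiv.trans_apply, Equiv.mulLeft₀_apply, Equiv.coe_addRight, h1, sub_zero]
    have h3 := jacobiSum_nontrivial_inv (quadraticChar_ne_one h2)
    rw [(quadraticChar_isQuadratic F).inv, hneg, neg_neg] at h3
    exact h3

variable {Q : Matrix F F ℤ}

theorem mul_transpose_of_two_smul_eq (h2 : ringChar F ≠ 2) (hneg : quadraticChar F (-1) = -1)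
    (hQ : (2 : ℤ) • Q = (Fintype.card F : ℤ) • (1 : Matrix F F ℤ) - of (fun _ _ : F => (1 : ℤ)) -
      quadraticCharMatrix F) {c : ℕ} (hc : 4 * c = Fintype.card F + 1) :
    Q * Qᵀ = (c : ℤ) • ((Fintype.card F : ℤ) • (1 : Matrix F F ℤ) - of (fun _ _ : F => (1 : ℤ))) ∧
    Qᵀ * Q = (c : ℤ) • ((Fintype.card F : ℤ) • (1 : Matrix F F ℤ) - of (fun _ _ : F => (1 : ℤ))) ∧
    Q + Qᵀ = (Fintype.card F : ℤ) • (1 : Matrix F F ℤ) - of (fun _ _ : F => (1 : ℤ)) ∧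
    Q * of (fun _ _ : F => (1 : ℤ)) = 0 ∧ of (fun _ _ : F => (1 : ℤ)) * Q = 0 := by
  have hT : (2 : ℤ) • Qᵀ = (Fintype.card F : ℤ) • (1 : Matrix F F ℤ) -
      of (fun _ _ : F => (1 : ℤ)) + quadraticCharMatrix F := by
    rw [← transpose_smul, hQ, transpose_sub, transpose_sub, quadraticCharMatrix_transpose hneg,
      transpose_smul, transpose_one, sub_neg_eq_add]
    rfl
  have hSS := quadraticCharMatrix_mul_self h2 hneg
  have hSJ := quadraticCharMatrix_mul_ones h2
  have hJS := ones_mul_quadraticCharMatrix h2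
  have hJJ : of (fun _ _ : F => (1 : ℤ)) * of (fun _ _ : F => (1 : ℤ)) =
      (Fintype.card F : ℤ) • of (fun _ _ : F => (1 : ℤ)) := by
    ext x y
    simp [mul_apply]
  have hcq : (Fintype.card F : ℤ) = 4 * c - 1 := by omega
  generalize of (fun _ _ : F => (1 : ℤ)) = J at *
  generalize quadraticCharMatrix F = S at *
  generalize (Fintype.card F : ℤ) = q at *
  have h4 : ∀ A B : Matrix F F ℤ, (4 : ℤ) • A = (4 : ℤ) • B → A = B := fun A B h =>
    smul_right_injective _ (by norm_num : (4 : ℤ) ≠ 0) h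
  have h2' : ∀ A B : Matrix F F ℤ, (2 : ℤ) • A = (2 : ℤ) • B → A = B := fun A B h =>
    smul_right_injective _ (by norm_num : (2 : ℤ) ≠ 0) h
  have hprod : ∀ A B : Matrix F F ℤ, (4 : ℤ) • (A * B) = ((2 : ℤ) • A) * ((2 : ℤ) • B) := by
    intro A B
    rw [smul_mul_smul_comm]; norm_num
  refine ⟨h4 _ _ ?_, h4 _ _ ?_, h2' _ _ ?_, h2' _ _ ?_, h2' _ _ ?_⟩
  · rw [hprod, hQ, hT]
    simp only [sub_mul, mul_sub, mul_add, hSS, hSJ, hJS, hJJ, smul_mul_assoc, mul_smul_comm,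
      one_mul, mul_one]
    subst hcq
    module
  · rw [hprod, hQ, hT]
    simp only [sub_mul, mul_sub, add_mul, hSS, hSJ, hJS, hJJ, smul_mul_assoc, mul_smul_comm,
      one_mul, mul_one]
    subst hcq
    module
  · rw [smul_add, hQ, hT]
    module
  · rw [← smul_mul_assoc, hQ]
    simp only [sub_mul, hSJ, hJJ, smul_mul_assoc, one_mul]
    module
  · rw [← mul_smul_comm, hQ]
    simp only [mul_sub, hJS, hJJ, mul_smul_comm, mul_one]
    module

end

section

/-- The action of integer matrices on vectors with entries in a commutative ring. -/
def Matrix.intAction (ι R : Type*) [Fintype ι] [DecidableEq ι] [CommRing R] :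
    Matrix ι ι ℤ →+* Module.End R (ι → R) :=
  (toLinAlgEquiv' (R := R) (n := ι)).toRingEquiv.toRingHom.comp (Int.castRingHom R).mapMatrix

theorem Matrix.intAction_apply {ι R : Type*} [Fintype ι] [DecidableEq ι] [CommRing R]
    (A : Matrix ι ι ℤ) (f : ι → R) (x : ι) : intAction ι R A f x = ∑ y, (A x y : R) * f y := by
  simp [intAction, mulVec, dotProduct]

theorem Matrix.mem_addKernel_iff_intAction {ι R : Type*} [Fintype ι] [DecidableEq ι] [CommRing R]
    {A : Matrix ι ι ℤ} {f : ι → R} : f ∈ A.addKernel R ↔ intAction ι R A f = 0 := by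
  rw [mem_addKernel, funext_iff]
  simp [intAction_apply]

variable {F R : Type} [Field F] [Fintype F] [DecidableEq F] [CommRing R] {Q : Matrix F F ℤ}

theorem addKernel_eq_addKernel_quadraticCharMatrix (h2 : ringChar F ≠ 2)
    (hneg : quadraticChar F (-1) = -1)
    (hQ : (2 : ℤ) • Q = (Fintype.card F : ℤ) • (1 : Matrix F F ℤ) - of (fun _ _ : F => (1 : ℤ)) -
      quadraticCharMatrix F) (hR : IsUnit (2 : R)) (hR' : IsUnit ((Fintype.card F : R) + 1)) :
    Q.addKernel R = (quadraticCharMatrix F).addKernel R := by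
  have hSS := quadraticCharMatrix_mul_self h2 hneg
  have hJS := ones_mul_quadraticCharMatrix h2
  have hJJ : of (fun _ _ : F => (1 : ℤ)) * of (fun _ _ : F => (1 : ℤ)) =
      (Fintype.card F : ℤ) • of (fun _ _ : F => (1 : ℤ)) := by
    ext x y
    simp [mul_apply]
  generalize of (fun _ _ : F => (1 : ℤ)) = J at *
  generalize quadraticCharMatrix F = S at *
  have hcancel : ∀ (z : ℤ) (v : F → R), IsUnit (z : R) → z • v = 0 → v = 0 := by
    intro z v hz hv
    ext x
    have := congrFun hv x
    rw [Pi.smul_apply, zsmul_eq_mul, Pi.zero_apply, hz.mul_right_eq_zero] at this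
    exact this
  have h3 : (2 : ℤ) • Q = -((1 + S) * S) := by
    rw [hQ, add_mul, one_mul, hSS]
    abel
  have h4 : (1 + J) * (1 - S) * (1 + S) = ((Fintype.card F : ℤ) + 1) • (1 : Matrix F F ℤ) := by
    have : (1 - S) * (1 + S) = 1 - S * S := by noncomm_ring
    rw [mul_assoc, this, hSS]
    simp only [add_mul, mul_sub, hJJ, mul_smul_comm, mul_one, one_mul]
    module
  ext f
  rw [mem_addKernel_iff_intAction, mem_addKernel_iff_intAction]
  have h5 : (2 : ℤ) • intAction F R Q f = -(intAction F R (1 + S) (intAction F R S f)) := by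
    rw [← LinearMap.smul_apply, ← map_zsmul, h3, map_neg, map_mul]
    rfl
  constructor
  · intro h
    rw [h, smul_zero, eq_comm, neg_eq_zero] at h5
    have h6 : ((Fintype.card F : ℤ) + 1) • intAction F R S f = 0 := by
      have : intAction F R (((Fintype.card F : ℤ) + 1) • (1 : Matrix F F ℤ)) (intAction F R S f) =
          0 := by
        rw [← h4, map_mul, Module.End.mul_apply, h5, map_zero]
      rwa [map_zsmul, map_one] at this
    exact hcancel _ _ (by simpa using hR') h6
  · intro h
    rw [h, map_zero, neg_zero] at h5
    exact hcancel _ _ (by simpa using hR) h5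

theorem card_addKernel_of_isUnit_card [Finite R] (h2 : ringChar F ≠ 2)
    (hneg : quadraticChar F (-1) = -1)
    (hQ : (2 : ℤ) • Q = (Fintype.card F : ℤ) • (1 : Matrix F F ℤ) - of (fun _ _ : F => (1 : ℤ)) -
      quadraticCharMatrix F) {c : ℕ} (hc : 4 * c = Fintype.card F + 1)
    (hR : IsUnit (Fintype.card F : R)) :
    Nat.card (Q.addKernel R) =
      Nat.card R * Nat.card {a : R // c • a = 0} ^ ((Fintype.card F - 1) / 2) := by
  obtain ⟨h1, h3, h4, h5, h6⟩ := mul_transpose_of_two_smul_eq h2 hneg hQ hc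
  have hJ : ∀ (f : F → R) x, intAction F R ((Fintype.card F : ℤ) • (1 : Matrix F F ℤ) -
      of (fun _ _ : F => (1 : ℤ))) f x = Fintype.card F * f x - ∑ y, f y := by
    intro f x
    rw [map_sub, map_zsmul, map_one, LinearMap.sub_apply, Pi.sub_apply, intAction_apply]
    simp
  have hsymm : Nat.card {f : F → R // intAction F R Q f = 0 ∧ ∑ x, f x = 0} =
      Nat.card {f : F → R // intAction F R Qᵀ f = 0 ∧ ∑ x, f x = 0} := by
    have hQneg : ∀ x y, Qᵀ (-x) (-y) = Q x y := by
      intro x y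
      have h7 := congrFun (congrFun hQ x) y
      have h8 := congrFun (congrFun hQ (-y)) (-x)
      simp only [Matrix.smul_apply, Matrix.sub_apply, of_apply, quadraticCharMatrix,
        one_apply, smul_eq_mul]
        at h7 h8
      rw [show -x - -y = y - x by ring] at h8
      rw [transpose_apply]
      rcases eq_or_ne x y with rfl | hxy
      · simp only [if_true] at h7 h8
        omega
      · rw [if_neg hxy] at h7
        rw [if_neg fun h => hxy (neg_injective h).symm] at h8
        omega
    refine Nat.card_congr (((Equiv.neg F).arrowCongr (Equiv.refl R)).subtypeEquiv fun f => ?_)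
    refine and_congr ?_ ?_
    · rw [funext_iff, funext_iff, ← (Equiv.neg F).forall_congr_right]
      refine forall_congr' fun x => ?_
      rw [intAction_apply, intAction_apply, ← Equiv.sum_comp (Equiv.neg F)]
      have h7 : ∀ y, Q (-x) (-y) = Qᵀ x y := fun y => by rw [← hQneg, neg_neg, neg_neg]
      simp only [Equiv.neg_apply, h7, Pi.zero_apply]
      rfl
    · rw [← Equiv.sum_comp (Equiv.neg F)]
      simp
  have := card_ker_of_doublyRegular (intAction F R Q) (intAction F R Qᵀ) c hR
    ⟨2 * c - 1, by omega⟩ (fun f x => ?_) (fun f x => ?_) (fun f x => ?_) (fun a => ?_)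
    (fun f => ?_) hsymm
  · simp only [nsmul_eq_mul]
    rw [← this]
    exact Nat.card_congr (Equiv.subtypeEquivRight fun f => mem_addKernel_iff_intAction)
  · rw [← Module.End.mul_apply, ← map_mul, h1, map_zsmul, LinearMap.smul_apply, Pi.smul_apply, hJ]
    simp
  · rw [← Module.End.mul_apply, ← map_mul, h3, map_zsmul, LinearMap.smul_apply, Pi.smul_apply, hJ]
    simp
  · rw [← Pi.add_apply, ← LinearMap.add_apply, ← map_add, h4, hJ]
  · ext x
    have := congrArg (fun z : ℤ => (z : R)) (congrFun (congrFun h5 x) x)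
    simp [mul_apply] at this
    rw [intAction_apply, ← sum_mul, this, zero_mul, Pi.zero_apply]
  · simp only [intAction_apply]
    rw [sum_comm]
    refine sum_eq_zero fun y _ => ?_
    have := congrArg (fun z : ℤ => (z : R)) (congrFun (congrFun h6 y) y)
    simp [mul_apply] at this
    rw [← sum_mul, this, zero_mul]

end

section

theorem Matrix.card_addMonoidHom_quotient_span {ι C : Type*} [Fintype ι] [AddCommGroup C]
    (Q : Matrix ι ι ℤ) :
    Nat.card (((ι → ℤ) ⧸ Submodule.span ℤ (Set.range fun x => Q x)) →+ C) =
      Nat.card (Q.addKernel C) := by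
  classical
  have hmap : ∀ (φ : ((ι → ℤ) ⧸ Submodule.span ℤ (Set.range fun x => Q x)) →+ C) (v : ι → ℤ),
      φ (Submodule.mkQ _ v) = ∑ y, v y • φ (Submodule.mkQ _ (Pi.single y 1)) := fun φ v => by
    have h : v = ∑ y, v y • Pi.single y (1 : ℤ) := by
      ext x
      simp [Pi.single_apply]
    conv_lhs => rw [h]
    simp only [map_sum, map_zsmul]
  exact Nat.card_congr
    { toFun := fun φ => ⟨fun y => φ (Submodule.mkQ _ (Pi.single y 1)), fun x => by
        have h : Submodule.mkQ (Submodule.span ℤ (Set.range fun x => Q x)) (Q x) = 0 :=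
          (Submodule.Quotient.mk_eq_zero _).2 (Submodule.subset_span ⟨x, rfl⟩)
        exact (hmap φ (Q x)).symm.trans ((congrArg φ h).trans (map_zero φ))⟩
      invFun := fun f => ((Submodule.span ℤ (Set.range fun x => Q x)).liftQ
        (Fintype.linearCombination ℤ f.1) (Submodule.span_le.2 (by
          rintro _ ⟨x, rfl⟩
          exact f.2 x))).toAddMonoidHom
      left_inv := fun φ => by
        refine AddMonoidHom.ext fun v => ?_
        obtain ⟨v, rfl⟩ := Submodule.mkQ_surjective _ v
        exact (hmap φ v).symm
      right_inv := fun f => by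
        refine Subtype.ext (funext fun y => ?_)
        change Fintype.linearCombination ℤ _ (Pi.single y 1) = _
        rw [Fintype.linearCombination_apply_single, one_smul] }

theorem cyclicCarries_le (p t a : ℕ) : cyclicCarries p t a ≤ t := by
  refine (sum_le_sum fun i _ => ?_).trans_eq (b := ∑ _i ∈ range t, 1) (by simp)
  split_ifs <;> omega

theorem sum_min_cyclicCarries (p t m : ℕ) (s : Finset ℕ) :
    ∑ b ∈ s, min (cyclicCarries p t b) m =
      ∑ i : Fin t, #{b ∈ s | cyclicCarries p t b = (i : ℕ) + 1} * min ((i : ℕ) + 1) m := by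
  rw [← sum_fiberwise_of_maps_to (t := range (t + 1)) (g := cyclicCarries p t)
    fun b _ => mem_range_succ_iff.2 (cyclicCarries_le p t b), sum_range_succ']
  have h : ∀ i, ∑ b ∈ s with cyclicCarries p t b = i, min (cyclicCarries p t b) m =
      #{b ∈ s | cyclicCarries p t b = i} * min i m := by
    intro i
    rw [sum_congr rfl fun b hb => by rw [(mem_filter.1 hb).2], sum_const, smul_eq_mul]
  simp only [h, Nat.zero_min, mul_zero, add_zero]
  rw [Fin.sum_univ_eq_sum_range
    (fun i => #{b ∈ s | cyclicCarries p t b = i + 1} * min (i + 1) m)]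

theorem card_filter_cyclicCarries {B t : ℕ} (hB : 0 < B) (ht : 0 < t) :
    #{b ∈ genericExponents ((2 * B + 1) ^ t) | cyclicCarries (2 * B + 1) t b = t} =
      (B + 1) ^ t - 2 := by
  have h := coeff_carryTrace_eq_card B t t hB ht
  rw [coeff_carryTrace B t t ht le_rfl, Nat.sub_self, Nat.min_zero, zero_add, sum_range_one,
    if_neg ht.ne', if_pos rfl] at h
  have h0 : (t : ℚ) ≠ 0 := by exact_mod_cast ht.ne'
  simp [h0] at h
  have : (B + 1) ^ t =
    #{b ∈ genericExponents ((2 * B + 1) ^ t) | cyclicCarries (2 * B + 1) t b = t} + 2 := by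
    exact_mod_cast h
  omega

variable {F : Type} [Field F] [Fintype F] [DecidableEq F] {Q : Matrix F F ℤ}

theorem card_addKernel_laplacian {p t : ℕ} (hp : p.Prime) (hp2 : 2 < p) (ht : 0 < t)
    (hF : Fintype.card F = p ^ t) (hneg : quadraticChar F (-1) = -1)
    (hQ : (2 : ℤ) • Q = (Fintype.card F : ℤ) • (1 : Matrix F F ℤ) - of (fun _ _ : F => (1 : ℤ)) -
      quadraticCharMatrix F) {c : ℕ} (hc : 4 * c = p ^ t + 1) {l : ℕ} (hl : l.Prime) (m : ℕ) :
    Nat.card (Q.addKernel (ZMod (l ^ m))) = l ^ m * Nat.gcd (l ^ m) c ^ ((p ^ t - 1) / 2) *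
      ∏ i : Fin t, Nat.gcd (l ^ m) (p ^ ((i : ℕ) + 1)) ^
        #{b ∈ genericExponents (p ^ t) | cyclicCarries p t b = (i : ℕ) + 1} := by
  have := Fact.mk hp
  have : CharP F p := charP_of_card_eq_prime_pow hF
  have hchar : ringChar F ≠ 2 := by
    rw [ringChar.eq F p]
    omega
  have hNZ := NeZero.mk hl.ne_zero
  have hunit : ∀ a : ℕ, Nat.Coprime a l → IsUnit (a : ZMod (l ^ m)) := fun a ha =>
    (ZMod.isUnit_iff_coprime _ _).2 (ha.pow_right m)
  rcases eq_or_ne p l with rfl | hpl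
  · have hcop : ∀ a : ℕ, ¬ p ∣ a → Nat.Coprime a p := fun a ha =>
      ((Nat.Prime.coprime_iff_not_dvd hp).2 ha).symm
    have hdvd : p ∣ p ^ t := dvd_pow_self p ht.ne'
    have hcopc : Nat.gcd (p ^ m) c = 1 := by
      refine ((hcop c fun h => ?_).pow_right m).symm
      refine hp.one_lt.ne' (Nat.dvd_one.1 ((Nat.dvd_add_right hdvd).1 ?_))
      rw [← hc]
      exact h.mul_left 4
    rw [addKernel_eq_addKernel_quadraticCharMatrix hchar hneg hQ
      (by exact_mod_cast hunit 2 (hcop 2 fun h => by have := Nat.le_of_dvd two_pos h; omega))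
      (by
        rw [hF]
        exact_mod_cast hunit (p ^ t + 1) (hcop _ fun h =>
          hp.one_lt.ne' (Nat.dvd_one.1 ((Nat.dvd_add_right hdvd).1 h)))),
      card_addKernel_quadraticChar hp hp2 ht hF hneg, sum_min_cyclicCarries, hcopc, one_pow,
      mul_one, pow_add, ← prod_pow_eq_pow_sum]
    congr 1
    refine prod_congr rfl fun i _ => ?_
    rw [gcd_prime_pow hp hp, if_pos rfl, ← pow_mul, mul_comm]
  · rw [card_addKernel_of_isUnit_card hchar hneg hQ (by rw [hF, hc]) (by
      rw [hF]
      exact hunit _ (((Nat.coprime_primes hp hl).2 hpl).pow_left t)), ZMod.card_nsmul_eq_zero,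
      Nat.card_zmod, hF, prod_eq_one, mul_one]
    intro i _
    rw [gcd_prime_pow hp hl, if_neg hpl, pow_zero, one_pow]

end

end

theorem paley_critical_group (p t : ℕ) (hp : p.Prime) (ht : 0 < t) (hq : p^t % 4 = 3)
    (F : Type) [Field F] [Fintype F] [DecidableEq F] (hF : Fintype.card F = p^t)
    (M : Matrix F F ℤ)
    (hM : ∀ x y : F, M x y = if ∃ z : F, z ≠ 0 ∧ z^2 = y - x then 1 else 0)
    (Q : Matrix F F ℤ)
    (hQ : Q = (((p^t - 1)/2 : ℕ) : ℤ) • (1 : Matrix F F ℤ) - M) :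
    ∃ e : ℕ → ℕ,
      e t = ((p+1)/2)^t - 2 ∧
      (∀ i, 1 ≤ i → i < t → (e i : ℚ) =
        ∑ j ∈ Finset.range (min i (t - i) + 1),
          (t : ℚ) / ((t - j : ℕ) : ℚ) * ((t - j).choose j : ℚ)
            * ((t - 2*j).choose (i - j) : ℚ)
            * (-(p:ℚ))^j * (((p+1)/2 : ℕ) : ℚ)^(t - 2*j)) ∧
      Nonempty (((F → ℤ) ⧸ Submodule.span ℤ (Set.range fun x => Q x)) ≃+
        ℤ × (Fin ((p^t - 1)/2) → ZMod ((p^t + 1)/4))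
          × ((i : Fin t) → Fin (e ((i : ℕ) + 1)) → ZMod (p^((i : ℕ) + 1)))) := by
  have hp2 : p ≠ 2 := by
    rintro rfl
    obtain ⟨s, rfl⟩ : ∃ s, t = s + 1 := ⟨t - 1, by omega⟩
    rw [pow_succ] at hq
    omega
  have hp3 : 2 < p := by have := hp.two_le; omega
  obtain ⟨B, hB⟩ := hp.odd_of_ne_two hp2
  have hB0 : 0 < B := by omega
  have hBp : (p + 1) / 2 = B + 1 := by omega
  have := Fact.mk hp
  have : CharP F p := charP_of_card_eq_prime_pow hF
  have hchar : ringChar F ≠ 2 := by rwa [ringChar.eq F p]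
  have hneg : quadraticChar F (-1) = -1 := by
    rw [quadraticChar_neg_one hchar, hF, ZMod.χ₄_nat_three_mod_four hq]
  obtain ⟨c, hc⟩ : ∃ c, 4 * c = p ^ t + 1 := ⟨(p ^ t + 1) / 4, by omega⟩
  have hQ2 : (2 : ℤ) • Q = (Fintype.card F : ℤ) • (1 : Matrix F F ℤ) -
      of (fun _ _ : F => (1 : ℤ)) - quadraticCharMatrix F := by
    ext x y
    have h : (if ∃ z : F, z ≠ 0 ∧ z ^ 2 = y - x then (2 : ℤ) else 0) =
        1 - (if x = y then 1 else 0) + quadraticChar F (y - x) := by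
      rcases eq_or_ne x y with rfl | hxy
      · simp +contextual
      · have hd : y - x ≠ 0 := sub_ne_zero.2 hxy.symm
        have h1 : (∃ z : F, z ≠ 0 ∧ z ^ 2 = y - x) ↔ IsSquare (y - x) := by
          rw [isSquare_iff_exists_sq]
          exact ⟨fun ⟨z, _, hz⟩ => ⟨z, hz.symm⟩, fun ⟨z, hz⟩ =>
            ⟨z, by rintro rfl; exact hd (by rw [hz]; simp), hz.symm⟩⟩
        rw [if_neg hxy]
        rcases quadraticChar_dichotomy hd with h2 | h2
        · rw [if_pos (h1.2 ((quadraticChar_one_iff_isSquare hd).1 h2)), h2]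
          rfl
        · rw [if_neg fun h3 => quadraticChar_neg_one_iff_not_isSquare.1 h2 (h1.1 h3), h2]
          rfl
    have h0 : ((p ^ t : ℕ) : ℤ) = 2 * (((p ^ t - 1) / 2 : ℕ) : ℤ) + 1 := by omega
    simp only [hQ, Matrix.smul_apply, Matrix.sub_apply, of_apply, quadraticCharMatrix, hM, hF,
      smul_eq_mul, one_apply]
    rw [h0]
    split_ifs at h ⊢ <;> linarith
  refine ⟨fun i => Finset.card {b ∈ genericExponents (p ^ t) | cyclicCarries p t b = i},
    ?_, ?_, ?_⟩
  · rw [hBp, hB]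
    exact card_filter_cyclicCarries hB0 ht
  · intro i hi hit
    have h := coeff_carryTrace_eq_card B t i hB0 ht
    rw [coeff_carryTrace B t i ht hit.le, if_neg (by omega), if_neg (by omega), add_zero, add_zero,
      ← hB] at h
    rw [hBp]
    exact h.symm
  · have hcdiv : (p ^ t + 1) / 4 = c := by omega
    rw [hcdiv]
    have : NeZero c := ⟨by omega⟩
    have : NeZero p := ⟨hp.ne_zero⟩
    have : AddGroup.FG ((F → ℤ) ⧸ Submodule.span ℤ (Set.range fun x => Q x)) :=
      Module.Finite.iff_addGroup_fg.1 inferInstance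
    have : AddGroup.FG (ℤ × (Fin ((p ^ t - 1) / 2) → ZMod c) × ((i : Fin t) →
        Fin (Finset.card {b ∈ genericExponents (p ^ t) | cyclicCarries p t b = (i : ℕ) + 1}) →
          ZMod (p ^ ((i : ℕ) + 1)))) :=
      Module.Finite.iff_addGroup_fg.1 inferInstance
    refine nonempty_addEquiv_of_card_hom _ _ fun l m hl => ?_
    have : NeZero l := ⟨hl.ne_zero⟩
    rw [card_addMonoidHom_quotient_span, card_addKernel_laplacian hp hp3 ht hF hneg hQ2 hc hl m,
      AddMonoidHom.card_prod, AddMonoidHom.card_prod, AddMonoidHom.card_int, Nat.card_zmod,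
      AddMonoidHom.card_pi, AddMonoidHom.card_pi, mul_assoc]
    simp only [AddMonoidHom.card_pi, ZMod.card_addMonoidHom, Finset.prod_const, Finset.card_univ,
      Fintype.card_fin]
end

section
/- Let p be a prime and t a positive integer with q := p^t ≡ 3 (mod 4), and let Q be the Laplacian matrix of the Paley tournament P(q). Then the rank of the reduction of Q modulo p (as a matrix over the field ℤ/pℤ) equals ((p+1)/2)^t. -/
open Matrix

/-- A product of matrices over a field has full inner rank when the columns of the left factor and
the rows of the right factor are linearly independent. -/
lemma Matrix.rank_mul_eq_card_of_linearIndependent {K l m n : Type*} [Field K] [Fintype m]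
    [Fintype n] {U : Matrix l m K} {V : Matrix m n K}
    (hU : LinearIndependent K U.col) (hV : LinearIndependent K V.row) :
    (U * V).rank = Fintype.card m := by
  rw [← hV.rank_matrix, Matrix.rank, Matrix.rank, Matrix.mulVecLin_mul, LinearMap.range_comp]
  exact (Submodule.equivMapOfInjective U.mulVecLin (Matrix.mulVec_injective_iff.2 hU)
    _).symm.finrank_eq

/-- The rank of a square matrix is unchanged under a homomorphism of fields. -/
lemma Matrix.rank_map_of_field {K L n : Type*} [Field K] [Field L] [Fintype n] [DecidableEq n]
    (f : K →+* L) (A : Matrix n n K) : (A.map f).rank = A.rank := by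
  obtain ⟨V, U, e, hV, hU, h⟩ := A.exists_rank_normal_form
  have h' : V.map f * A.map f * U.map f =
      (fromBlocks (1 : Matrix (Fin A.rank) (Fin A.rank) L) 0 0 0).submatrix e e := by
    rw [← Matrix.map_mul, ← Matrix.map_mul, h, ← Matrix.submatrix_map, Matrix.fromBlocks_map]
    simp
  have hV' : IsUnit (V.map f).det :=
    (Matrix.isUnit_iff_isUnit_det _).1 (hV.map f.mapMatrix)
  have hU' : IsUnit (U.map f).det :=
    (Matrix.isUnit_iff_isUnit_det _).1 (hU.map f.mapMatrix)
  have hdiag : (fromBlocks (1 : Matrix (Fin A.rank) (Fin A.rank) L) 0 0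
      (0 : Matrix (Fin (Fintype.card n - A.rank)) (Fin (Fintype.card n - A.rank)) L)) =
      Matrix.diagonal (Sum.elim 1 0) := by
    rw [← Matrix.diagonal_one, ← Matrix.diagonal_zero, Matrix.fromBlocks_diagonal]
    rfl
  classical
  rw [← rank_mul_eq_right_of_isUnit_det _ (A.map f) hV',
    ← rank_mul_eq_left_of_isUnit_det _ (V.map f * A.map f) hU', h', rank_submatrix, hdiag,
    rank_diagonal, Fintype.card_subtype, Finset.card_filter, Fintype.sum_sum_type]
  simp

/-- Polynomials of distinct degrees smaller than the cardinality of a finite field induce linearly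
independent functions on it. -/
lemma Polynomial.Sequence.linearIndependent_eval {F ι : Type*} [Field F] [Fintype F] [Fintype ι]
    (S : Polynomial.Sequence F) {g : ι → ℕ} (hg : Function.Injective g)
    (hlt : ∀ i, g i < Fintype.card F) :
    LinearIndependent F fun i (x : F) ↦ (S (g i)).eval x := by
  have hS : LinearIndependent F fun i ↦ S (g i) :=
    LinearIndependent.comp S.linearIndependent g hg
  rw [Fintype.linearIndependent_iff] at hS ⊢
  intro c hc
  refine hS c (Polynomial.eq_zero_of_natDegree_lt_card_of_eval_eq_zero _ Function.injective_id
    (fun x ↦ ?_) ?_)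
  · simpa [Polynomial.eval_finsetSum] using congrFun hc x
  · refine (Polynomial.natDegree_sum_le_of_forall_le (n := Fintype.card F - 1) _ _
      fun i _ ↦ (Polynomial.natDegree_smul_le _ _).trans ?_).trans_lt
        (Nat.sub_lt Fintype.card_pos one_pos)
    rw [S.natDegree_eq]
    exact Nat.le_sub_one_of_lt (hlt i)

/-- Lucas' theorem, recast as a criterion for divisibility by `p` after appending a digit. -/
lemma Nat.Prime.not_dvd_choose_mul_add_iff {p m n : ℕ} (hp : p.Prime) (hm : m < p) (i : ℕ) :
    ¬ p ∣ (p * n + m).choose i ↔ i % p ≤ m ∧ ¬ p ∣ n.choose (i / p) := by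
  have : Fact p.Prime := ⟨hp⟩
  have h := Choose.choose_modEq_choose_mod_mul_choose_div_nat (n := p * n + m) (k := i) (p := p)
  rw [Nat.mul_add_mod, Nat.mod_eq_of_lt hm, Nat.mul_add_div hp.pos, Nat.div_eq_of_lt hm,
    add_zero] at h
  rw [h.dvd_iff dvd_rfl, hp.dvd_mul, not_or]
  refine and_congr_left fun _ ↦ ⟨fun hd ↦ ?_, fun hle hd ↦ ?_⟩
  · by_contra! hlt
    exact hd (by simp [Nat.choose_eq_zero_of_lt hlt])
  · have := (hd.mul_right _).mul_right _ |>.trans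
      (dvd_of_eq (Nat.choose_mul_factorial_mul_factorial hle))
    exact absurd ((hp.dvd_factorial).1 this) (by lia)

/-- If all `t` base-`p` digits of `k` equal `(p - 1) / 2`, then `((p + 1) / 2) ^ t` of the binomial
coefficients `k.choose i` are not divisible by `p`. -/
lemma Nat.Prime.card_not_dvd_choose {p : ℕ} (hp : p.Prime) (hp2 : p % 2 = 1) (t : ℕ) :
    ((Finset.range ((p ^ t - 1) / 2 + 1)).filter
      fun i ↦ ¬ p ∣ ((p ^ t - 1) / 2).choose i).card = ((p + 1) / 2) ^ t := by
  induction t with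
  | zero => simp [Finset.filter_singleton, hp.ne_one]
  | succ t ih =>
    set n := (p ^ t - 1) / 2 with hn
    have hodd : p ^ t % 2 = 1 := by simp [Nat.pow_mod, hp2]
    have hk : (p ^ (t + 1) - 1) / 2 = p * n + (p - 1) / 2 := by
      obtain ⟨a, ha⟩ : ∃ a, p = 2 * a + 1 := ⟨p / 2, by lia⟩
      have hb : p ^ t = 2 * n + 1 := by lia
      rw [pow_succ, hb]
      have : (2 * n + 1) * p = 2 * (p * n) + p := by ring
      lia
    have hm : (p - 1) / 2 < p := by have := hp.pos; lia
    rw [hk, pow_succ, ← ih, ← Finset.card_range ((p + 1) / 2), ← Finset.card_product]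
    refine Finset.card_nbij' (fun i ↦ (i / p, i % p)) (fun x ↦ p * x.1 + x.2) ?_ ?_ ?_ ?_
    · intro i hi
      simp only [Finset.coe_filter, Set.mem_ofPred_eq, hp.not_dvd_choose_mul_add_iff hm] at hi
      simp only [Finset.coe_product, Set.mem_prod, Finset.coe_filter, Set.mem_ofPred_eq,
        Finset.mem_range, Finset.coe_range, Set.mem_Iio]
      refine ⟨⟨?_, hi.2.2⟩, by lia⟩
      by_contra! hlt
      exact hi.2.2 (by simp [Nat.choose_eq_zero_of_lt (show n < i / p by lia)])
    · rintro ⟨a, b⟩ hab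
      simp only [Finset.coe_product, Set.mem_prod, Finset.coe_filter, Set.mem_ofPred_eq,
        Finset.mem_range, Finset.coe_range, Set.mem_Iio] at hab
      have hb : b < p := by lia
      simp only [Finset.coe_filter, Set.mem_ofPred_eq, hp.not_dvd_choose_mul_add_iff hm,
        Finset.mem_range, Nat.mul_add_mod, Nat.mod_eq_of_lt hb, Nat.mul_add_div hp.pos,
        Nat.div_eq_of_lt hb, add_zero]
      have := Nat.mul_le_mul_left p (show a ≤ n by lia)
      exact ⟨by lia, by lia, hab.1.2⟩
    · intro i _
      exact Nat.div_add_mod i p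
    · rintro ⟨a, b⟩ hab
      simp only [Finset.coe_product, Set.mem_prod, Finset.coe_range, Set.mem_Iio] at hab
      have hb : b < p := by lia
      simp [Nat.mod_eq_of_lt hb, Nat.mul_add_div hp.pos, Nat.div_eq_of_lt hb]

/-- The rank of the matrix `c * (1 + (y - x) ^ k)` over a finite field of characteristic `p` is the
number of binomial coefficients `k.choose i` not divisible by `p`. -/
lemma rank_one_add_sub_pow {F : Type*} [Field F] [Fintype F] {p k : ℕ} [CharP F p] (hk : 0 < k)
    (hkF : k < Fintype.card F) {c : F} (hc : c ≠ 0) :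
    (Matrix.of fun x y : F ↦ c * (1 + (y - x) ^ k)).rank =
      ((Finset.range (k + 1)).filter fun i ↦ ¬ p ∣ k.choose i).card := by
  set s := (Finset.range (k + 1)).filter fun i ↦ ¬ p ∣ k.choose i with hs
  have hsk (i : s) : i.1 ≤ k := by
    have := i.2
    simp only [hs, Finset.mem_filter, Finset.mem_range] at this
    lia
  let u : Polynomial.Sequence F := ⟨fun i ↦ Polynomial.X ^ i, by simp⟩
  let v : Polynomial.Sequence F :=
    ⟨fun i ↦ Polynomial.X ^ i + if i = k then 1 else 0, fun i ↦ by
      split_ifs with h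
      · simpa using Polynomial.degree_X_pow_add_C (h ▸ hk) (1 : F)
      · simp⟩
  let a (i : s) : Fˣ := Units.mk0 (c * ((-1) ^ (k - i.1) * (k.choose i.1 : F)))
    (mul_ne_zero hc (mul_ne_zero (pow_ne_zero _ (by simp))
      (by rw [Ne, CharP.cast_eq_zero_iff F p]; exact (Finset.mem_filter.1 i.2).2)))
  have hu := u.linearIndependent_eval (g := fun i : s ↦ k - i.1)
    (fun i j h ↦ Subtype.ext (by have := hsk i; have := hsk j; dsimp only at h; lia))
    (fun i ↦ by lia)
  have hv := (v.linearIndependent_eval (g := fun i : s ↦ i.1) Subtype.val_injective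
    (fun i ↦ (hsk i).trans_lt hkF)).units_smul a
  rw [← Fintype.card_coe s, ← Matrix.rank_mul_eq_card_of_linearIndependent
    (U := (Matrix.of fun (i : s) x ↦ (u (k - i.1)).eval x)ᵀ)
    (V := Matrix.of (a • fun (i : s) (x : F) ↦ (v i.1).eval x)) hu hv]
  congr 1
  ext x y
  have hexp : c * (1 + (y - x) ^ k) = ∑ i ∈ Finset.range (k + 1),
      x ^ (k - i) * (c * ((-1) ^ (k - i) * (k.choose i : F)) *
        (y ^ i + if i = k then 1 else 0)) := by
    rw [sub_eq_add_neg, add_pow, mul_add, Finset.mul_sum]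
    simp_rw [mul_add, mul_ite, mul_zero, Finset.sum_add_distrib]
    rw [Finset.sum_ite_eq', add_comm]
    congr 1
    · refine Finset.sum_congr rfl fun i _ ↦ ?_
      rw [neg_pow]
      ring
    · simp
  rw [Matrix.of_apply, hexp, Matrix.mul_apply, ← Finset.sum_filter_of_ne
    (p := fun i ↦ ¬ p ∣ k.choose i), ← hs, ← Finset.sum_coe_sort]
  · refine Finset.sum_congr rfl fun i _ ↦ ?_
    have hv_eval : (v i.1).eval y = y ^ i.1 + if i.1 = k then 1 else 0 := by
      change Polynomial.eval y (Polynomial.X ^ i.1 + if i.1 = k then 1 else 0) = _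
      split_ifs <;> simp
    have hu_eval : (u (k - i.1)).eval x = x ^ (k - i.1) := by
      change Polynomial.eval x (Polynomial.X ^ (k - i.1)) = _
      simp
    change _ = (u (k - i.1)).eval x *
      (c * ((-1) ^ (k - i.1) * (k.choose i.1 : F)) * (v i.1).eval y)
    rw [hv_eval, hu_eval]
  · intro i _ hi hd
    rw [← CharP.cast_eq_zero_iff F p] at hd
    simp [hd] at hi

theorem paley_p_rank (p t : ℕ) (hp : p.Prime) (ht : 0 < t) (hq : p^t % 4 = 3)
    (F : Type) [Field F] [Fintype F] [DecidableEq F] (hF : Fintype.card F = p^t)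
    (M : Matrix F F ℤ)
    (hM : ∀ x y : F, M x y = if ∃ z : F, z ≠ 0 ∧ z^2 = y - x then 1 else 0)
    (Q : Matrix F F ℤ)
    (hQ : Q = (((p^t - 1)/2 : ℕ) : ℤ) • (1 : Matrix F F ℤ) - M) :
    (Q.map (Int.cast : ℤ → ZMod p)).rank = ((p+1)/2)^t := by
  have : Fact p.Prime := ⟨hp⟩
  have : CharP F p := charP_of_card_eq_prime_pow hF
  have hp2 : p % 2 = 1 := by
    rcases Nat.mod_two_eq_zero_or_one p with h | h
    · have : p ^ t % 2 = 0 := by simp [Nat.pow_mod, h, ht.ne']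
      lia
    · exact h
  have hchar : ringChar F ≠ 2 := by
    rw [ringChar.eq F p]
    rintro rfl
    simp at hp2
  rw [← hp.card_not_dvd_choose hp2 t]
  set k := (p ^ t - 1) / 2 with hk
  have hkF : 2 * k + 1 = Fintype.card F := by lia
  have h2k : 2 * (k : F) = -1 := by
    have : ((2 * k + 1 : ℕ) : F) = 0 := by rw [hkF]; exact FiniteField.cast_card_eq_zero F
    push_cast at this
    linear_combination this
  have hk0 : (k : F) ≠ 0 := fun h ↦ by simp [h] at h2k
  have hkpos : 0 < k := by lia
  rw [← rank_one_add_sub_pow (F := F) hkpos (by lia) hk0,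
    ← Matrix.rank_map_of_field (ZMod.castHom (dvd_refl p) F)]
  congr 1
  ext x y
  simp only [Matrix.map_apply, map_intCast, Matrix.of_apply, hQ, Matrix.sub_apply,
    Matrix.smul_apply, hM]
  rcases eq_or_ne x y with rfl | hxy
  · have : ¬ ∃ z : F, z ≠ 0 ∧ z ^ 2 = x - x := by
      rintro ⟨z, hz, h⟩
      simp [hz] at h
    simp [hkpos.ne']
  · have hd : y - x ≠ 0 := sub_ne_zero.2 hxy.symm
    have hsq := FiniteField.isSquare_iff hchar hd
    have hiff : (∃ z : F, z ≠ 0 ∧ z ^ 2 = y - x) ↔ IsSquare (y - x) := by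
      rw [isSquare_iff_exists_sq]
      refine ⟨fun ⟨z, _, h⟩ ↦ ⟨z, h.symm⟩, fun ⟨z, h⟩ ↦ ⟨z, ?_, h.symm⟩⟩
      rintro rfl
      simp [hd] at h
    have hhalf : Fintype.card F / 2 = k := by lia
    rw [hhalf] at hsq
    have hdich := FiniteField.pow_dichotomy hchar hd
    rw [hhalf] at hdich
    by_cases h : IsSquare (y - x)
    · rw [if_pos (hiff.2 h), hsq.1 h]
      simp only [Matrix.one_apply_ne hxy]
      push_cast
      simp
      linear_combination -h2k
    · rw [if_neg (fun h' ↦ h (hiff.1 h')), hdich.resolve_left (fun h' ↦ h (hsq.2 h'))]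
      simp [Matrix.one_apply_ne hxy]
end

section
/- Let λ be a positive integer and let M be the adjacency matrix of a doubly-regular tournament with parameters (4λ+3, 2λ+1, λ). Then the characteristic polynomial of M over ℤ equals (X − (2λ+1))·(X² + X + (λ+1))^(2λ+1). -/
open Polynomial Matrix

theorem det_smul_one_add_smul_ones {n R : Type*} [Fintype n] [DecidableEq n] [CommRing R]
    (q r : R) :
    (q • (1 : Matrix n n R) + r • Matrix.of (fun _ _ => 1)).det
      = q ^ Fintype.card n + Fintype.card n * r * q ^ (Fintype.card n - 1) := by
  have h := eval_charpoly (vecMulVec (fun _ : n => -r) (fun _ => 1)) q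
  rw [charpoly_vecMulVec] at h
  have hmat : q • (1 : Matrix n n R) + r • Matrix.of (fun _ _ => 1)
      = scalar n q - vecMulVec (fun _ : n => -r) (fun _ => 1) := by
    ext i j
    simp [vecMulVec_apply, one_apply, diagonal_apply]
  rw [hmat, ← h]
  simp [dotProduct]

theorem charmatrix_mul_charmatrix_transpose {n R : Type*} [Fintype n] [DecidableEq n]
    [CommRing R] (M : Matrix n n R) (a b : R)
    (hskew : M + Mᵀ = Matrix.of (fun _ _ => 1) - 1)
    (hmul : M * Mᵀ = a • (1 : Matrix n n R) + b • Matrix.of (fun _ _ => 1)) :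
    M.charmatrix * Mᵀ.charmatrix
      = (X ^ 2 + X + C a) • (1 : Matrix n n R[X]) + (C b - X) • Matrix.of (fun _ _ => 1) := by
  have hs : M.map C + Mᵀ.map C = (Matrix.of (fun _ _ => 1) - 1 : Matrix n n R[X]) := by
    have h := congrArg (fun N : Matrix n n R => N.map (C : R → R[X])) hskew
    ext1 i j
    simpa [one_apply, apply_ite] using congrFun₂ h i j
  have hm : M.map C * Mᵀ.map C
      = C a • (1 : Matrix n n R[X]) + C b • Matrix.of (fun _ _ => 1) := by
    rw [← Matrix.map_mul, hmul]
    ext1 i j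
    simp [one_apply, apply_ite]
  have hc (N : Matrix n n R) :
      N.charmatrix = (X : R[X]) • (1 : Matrix n n R[X]) - N.map C := by
    rw [charmatrix, smul_one_eq_diagonal]
    rfl
  calc M.charmatrix * Mᵀ.charmatrix
      = (X : R[X]) ^ 2 • (1 : Matrix n n R[X]) - (X : R[X]) • (M.map C + Mᵀ.map C)
        + M.map C * Mᵀ.map C := by
        rw [hc, hc]
        simp only [sub_mul, mul_sub, smul_mul_assoc, mul_smul_comm, one_mul, mul_one]
        module
    _ = _ := by
        rw [hs, hm]
        module

theorem drt_charpoly (lam : ℕ) (hlam : 0 < lam)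
    (M : Matrix (Fin (4*lam+3)) (Fin (4*lam+3)) ℤ)
    (hM01 : ∀ i j, M i j = 0 ∨ M i j = 1)
    (hMdiag : ∀ i, M i i = 0)
    (hMskew : M + Mᵀ = Matrix.of (fun _ _ => 1) - 1)
    (hMMt : M * Mᵀ = ((lam : ℤ) + 1) • (1 : Matrix (Fin (4*lam+3)) (Fin (4*lam+3)) ℤ)
      + (lam : ℤ) • Matrix.of (fun _ _ => 1)) :
    M.charpoly = (X - C (2*(lam:ℤ)+1)) * (X^2 + X + C ((lam:ℤ)+1))^(2*lam+1) := by
  have hquad : (X ^ 2 + X + C ((lam : ℤ) + 1)).Monic := by monicity!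
  have hmonic : ((X - C (2*(lam:ℤ)+1)) * (X^2 + X + C ((lam:ℤ)+1))^(2*lam+1)).Monic :=
    (monic_X_sub_C _).mul (hquad.pow _)
  have hsq : M.charpoly ^ 2
      = ((X - C (2*(lam:ℤ)+1)) * (X^2 + X + C ((lam:ℤ)+1))^(2*lam+1)) ^ 2 := by
    calc M.charpoly ^ 2 = (M.charmatrix * Mᵀ.charmatrix).det := by
          rw [det_mul, ← charpoly, ← charpoly, charpoly_transpose, sq]
      _ = _ := by
          rw [charmatrix_mul_charmatrix_transpose M _ _ hMskew hMMt, det_smul_one_add_smul_ones,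
            Fintype.card_fin, show 4 * lam + 3 - 1 = (2 * lam + 1) * 2 by omega,
            show 4 * lam + 3 = (2 * lam + 1) * 2 + 1 by omega, pow_succ, pow_mul]
          simp only [map_add, map_mul, map_one, map_natCast, map_ofNat, Nat.cast_add,
            Nat.cast_mul, Nat.cast_ofNat, Nat.cast_one]
          ring
  rcases sq_eq_sq_iff_eq_or_eq_neg.mp hsq with h | h
  · exact h
  · have hlead := congrArg leadingCoeff h
    rw [leadingCoeff_neg, hmonic.leadingCoeff, (charpoly_monic M).leadingCoeff] at hlead
    norm_num at hlead
end

section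
/- Let λ be a positive integer, let M be the adjacency matrix of a doubly-regular tournament with parameters (4λ+3, 2λ+1, λ), and let Q = (2λ+1)·I − M be its Laplacian. Then for every index v, the determinant of the matrix obtained from Q by deleting row v and column v equals (4λ+3)^(2λ)·(λ+1)^(2λ+1). -/
open Matrix

/-- The determinant of the identity plus the all-ones matrix. -/
theorem Matrix.det_one_add_ones {ι R : Type*} [Fintype ι] [DecidableEq ι] [CommRing R] :
    (1 + Matrix.of (fun _ _ => 1) : Matrix ι ι R).det = 1 + (Fintype.card ι : R) := by
  have h : (Matrix.of (fun _ _ => 1) : Matrix ι ι R)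
      = replicateCol Unit (fun _ => (1 : R)) * replicateRow Unit (fun _ => (1 : R)) := by
    ext i j
    simp [Matrix.mul_apply]
  rw [h, det_one_add_replicateCol_mul_replicateRow]
  simp [dotProduct]

/-- A real weakly row-diagonally-dominant matrix has nonnegative determinant. -/
theorem Matrix.det_nonneg_of_sum_row_le_diag {ι : Type*} [Fintype ι] [DecidableEq ι]
    (A : Matrix ι ι ℝ) (h : ∀ i, ∑ j ∈ Finset.univ.erase i, |A i j| ≤ A i i) : 0 ≤ A.det := by
  rcases isEmpty_or_nonempty ι with _ | _
  · simp
  have heval (t : ℝ) : (-A).charpoly.eval t = (Matrix.scalar ι t + A).det := by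
    rw [eval_charpoly, sub_neg_eq_add]
  have hne (t : ℝ) (ht : 0 < t) : (-A).charpoly.eval t ≠ 0 := by
    rw [heval]
    refine det_ne_zero_of_sum_row_lt_diag fun i => ?_
    have hsum : ∑ j ∈ Finset.univ.erase i, ‖(Matrix.scalar ι t + A) i j‖
        = ∑ j ∈ Finset.univ.erase i, |A i j| := by
      refine Finset.sum_congr rfl fun j hj => ?_
      simp [Matrix.diagonal_apply_ne _ (Finset.ne_of_mem_erase hj).symm]
    have hdiag : (Matrix.scalar ι t + A) i i = t + A i i := by simp
    rw [hsum, hdiag]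
    exact lt_of_lt_of_le (lt_of_le_of_lt (h i) (lt_add_of_pos_left _ ht)) (le_abs_self _)
  have htop : Filter.Tendsto (fun t => (-A).charpoly.eval t) Filter.atTop Filter.atTop := by
    refine Polynomial.tendsto_atTop_of_leadingCoeff_nonneg _ ?_ ?_
    · rw [charpoly_degree_eq_dim]
      exact_mod_cast Fintype.card_pos
    · rw [(charpoly_monic (-A)).leadingCoeff]
      exact zero_le_one
  by_contra! hneg
  have h0 : (-A).charpoly.eval 0 < 0 := by
    rw [heval]
    simpa using hneg
  obtain ⟨T, hT, hTpos⟩ :=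
    ((htop.eventually_ge_atTop 0).and (Filter.eventually_ge_atTop 0)).exists
  obtain ⟨t, ht, hroot⟩ := intermediate_value_Icc hTpos
    ((-A).charpoly.continuous.continuousOn) ⟨h0.le, hT⟩
  rcases ht.1.eq_or_lt with rfl | hpos
  · exact h0.ne hroot
  · exact hne t hpos hroot

/-- If the rows of `Q` sum to zero, the Gram matrix of the rows other than `v` is
`A * (1 + J) * Aᵀ`, where `A` is `Q` with row and column `v` deleted. -/
theorem Matrix.submatrix_mul_one_add_ones_mul_transpose {ι R : Type*} [Fintype ι] [DecidableEq ι]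
    [CommRing R] (Q : Matrix ι ι R) (hQ : ∀ i, ∑ j, Q i j = 0) (v : ι) :
    Q.submatrix (fun i : {i // i ≠ v} => (i : ι)) (fun j : {j // j ≠ v} => (j : ι))
        * (1 + Matrix.of (fun _ _ => 1))
        * (Q.submatrix (fun i : {i // i ≠ v} => (i : ι)) (fun j : {j // j ≠ v} => (j : ι)))ᵀ
      = (Q * Qᵀ).submatrix (fun i : {i // i ≠ v} => (i : ι)) (fun j : {j // j ≠ v} => (j : ι)) := by
  have split (f : ι → R) : ∑ j, f j = f v + ∑ j : {j // j ≠ v}, f j :=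
    Fintype.sum_eq_add_sum_subtype_ne f v
  have hrow (i : ι) : ∑ j : {j // j ≠ v}, Q i j = -Q i v := by
    linear_combination hQ i - split (Q i)
  ext i j
  simp only [mul_add, add_mul, mul_one, add_apply, mul_apply, submatrix_apply, transpose_apply,
    of_apply, hrow, Finset.sum_add_distrib]
  rw [split, ← Finset.mul_sum, hrow]
  ring

theorem drt_reduced_laplacian_det (lam : ℕ) (hlam : 0 < lam)
    (M : Matrix (Fin (4*lam+3)) (Fin (4*lam+3)) ℤ)
    (hM01 : ∀ i j, M i j = 0 ∨ M i j = 1)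
    (hMdiag : ∀ i, M i i = 0)
    (hMskew : M + Mᵀ = Matrix.of (fun _ _ => 1) - 1)
    (hMMt : M * Mᵀ = ((lam : ℤ) + 1) • (1 : Matrix (Fin (4*lam+3)) (Fin (4*lam+3)) ℤ)
      + (lam : ℤ) • Matrix.of (fun _ _ => 1))
    (Q : Matrix (Fin (4*lam+3)) (Fin (4*lam+3)) ℤ)
    (hQ : Q = (2*(lam:ℤ)+1) • (1 : Matrix (Fin (4*lam+3)) (Fin (4*lam+3)) ℤ) - M) :
    ∀ v : Fin (4*lam+3),
      (Q.submatrix (fun i : {i : Fin (4*lam+3) // i ≠ v} => (i : Fin (4*lam+3)))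
        (fun j : {j : Fin (4*lam+3) // j ≠ v} => (j : Fin (4*lam+3)))).det
        = (4*(lam:ℤ)+3)^(2*lam) * ((lam:ℤ)+1)^(2*lam+1) := by
  intro v
  have hMrow (i) : ∑ j, M i j = 2 * (lam : ℤ) + 1 := by
    have h := congrFun (congrFun hMMt i) i
    simp only [mul_apply, transpose_apply, Matrix.add_apply, Matrix.smul_apply, one_apply_eq,
      of_apply, smul_eq_mul, mul_one] at h
    rw [Finset.sum_congr rfl fun j _ => show M i j = M i j * M i j by
      rcases hM01 i j with h | h <;> simp [h], h]
    ring
  have hQapply (i j) : Q i j = (2 * (lam : ℤ) + 1) * (if i = j then 1 else 0) - M i j := by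
    rw [hQ, Matrix.sub_apply, Matrix.smul_apply, one_apply, smul_eq_mul]
  have hQrow (i) : ∑ j, Q i j = 0 := by
    simp [hQapply, Finset.sum_sub_distrib, hMrow]
  have hQQt : Q * Qᵀ = ((lam : ℤ) + 1) • ((4 * (lam : ℤ) + 3) • 1 - Matrix.of (fun _ _ => 1)) := by
    have hMt : Mᵀ = Matrix.of (fun _ _ => 1) - 1 - M := eq_sub_of_add_eq' hMskew
    have hexp : Q * Qᵀ = (2 * (lam : ℤ) + 1) ^ 2 • 1 - (2 * (lam : ℤ) + 1) • (M + Mᵀ)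
        + M * Mᵀ := by
      rw [hQ]
      simp only [transpose_sub, transpose_smul, transpose_one, sub_mul, mul_sub, smul_mul_assoc,
        mul_smul_comm, one_mul, mul_one]
      module
    rw [hexp, hMskew, hMMt]
    module
  have hcard : Fintype.card {i : Fin (4*lam+3) // i ≠ v} = 4 * lam + 2 := by
    simp [Fintype.card_subtype_compl]
  have hgram := submatrix_mul_one_add_ones_mul_transpose Q hQrow v
  rw [hQQt] at hgram
  set A := Q.submatrix (fun i : {i : Fin (4*lam+3) // i ≠ v} => (i : Fin (4*lam+3)))
    (fun j : {j : Fin (4*lam+3) // j ≠ v} => (j : Fin (4*lam+3))) with hA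
  have hprod : A * (1 + Matrix.of (fun _ _ => 1)) * Aᵀ * (1 + Matrix.of (fun _ _ => 1))
      = (((lam : ℤ) + 1) * (4 * (lam : ℤ) + 3)) • 1 := by
    have hJ : (Matrix.of (fun _ _ => 1) : Matrix {i // i ≠ v} {i // i ≠ v} ℤ)
        * Matrix.of (fun _ _ => 1) = (4 * (lam : ℤ) + 2) • Matrix.of (fun _ _ => 1) := by
      ext i j
      rw [mul_apply, Matrix.smul_apply]
      simp only [of_apply, mul_one, Finset.sum_const, Finset.card_univ, hcard, nsmul_eq_mul,
        smul_eq_mul]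
      push_cast
      ring
    have hsub : (((lam : ℤ) + 1) • ((4 * (lam : ℤ) + 3) •
          (1 : Matrix (Fin (4*lam+3)) (Fin (4*lam+3)) ℤ) - Matrix.of (fun _ _ => 1))).submatrix
            (fun i : {i // i ≠ v} => (i : Fin (4*lam+3)))
            (fun j : {j // j ≠ v} => (j : Fin (4*lam+3)))
        = ((lam : ℤ) + 1) • ((4 * (lam : ℤ) + 3) • 1 - Matrix.of (fun _ _ => 1)) := by
      ext i j
      simp only [submatrix_apply, Matrix.smul_apply, Matrix.sub_apply, one_apply, of_apply,
        Subtype.ext_iff]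
    rw [hgram, hsub, mul_add, mul_one, smul_mul_assoc, sub_mul, smul_mul_assoc, one_mul, hJ]
    module
  have hsq : (A.det * (4 * (lam : ℤ) + 3)) ^ 2
      = ((((lam : ℤ) + 1) * (4 * (lam : ℤ) + 3)) ^ (2 * lam + 1)) ^ 2 := by
    have h := congrArg det hprod
    simp only [det_mul, det_transpose, det_one_add_ones, det_smul, det_one, hcard] at h
    push_cast at h
    rw [← pow_mul, show (2 * lam + 1) * 2 = 4 * lam + 2 by ring]
    linear_combination h
  have hnonneg : 0 ≤ A.det := by
    have hR : 0 ≤ (A.map (Int.cast : ℤ → ℝ)).det := by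
      refine det_nonneg_of_sum_row_le_diag _ fun i => ?_
      have hoff : ∑ j ∈ Finset.univ.erase i, |A i j| ≤ A i i := by
        have hQi : A i i = 2 * (lam : ℤ) + 1 := by simp [hA, hQapply, hMdiag]
        rw [hQi, ← hMrow i, Fintype.sum_eq_add_sum_subtype_ne (fun j => M i j) v]
        have hM0 (a b) : 0 ≤ M a b := by rcases hM01 a b with h | h <;> simp [h]
        calc ∑ j ∈ Finset.univ.erase i, |A i j| = ∑ j ∈ Finset.univ.erase i, M i j := by
              refine Finset.sum_congr rfl fun j hj => ?_
              have hne : (i : Fin (4*lam+3)) ≠ j :=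
                fun h => Finset.ne_of_mem_erase hj (Subtype.ext h).symm
              simp [hA, hQapply, hne, abs_of_nonneg (hM0 _ _)]
          _ ≤ ∑ j : {j : Fin (4*lam+3) // j ≠ v}, M i j :=
              Finset.sum_le_sum_of_subset_of_nonneg (Finset.erase_subset _ _)
                fun _ _ _ => hM0 _ _
          _ ≤ _ := le_add_of_nonneg_left (hM0 _ _)
      simp only [map_apply]
      exact_mod_cast hoff
    rw [← Int.cast_det] at hR
    exact_mod_cast hR
  have hn : (0 : ℤ) < 4 * (lam : ℤ) + 3 := by positivity
  have hroot := (sq_eq_sq₀ (by positivity) (by positivity)).mp hsq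
  refine mul_right_cancel₀ hn.ne' ?_
  rw [hroot, mul_pow]
  ring
end

section
/- Let λ be a positive integer, let M be the adjacency matrix of a doubly-regular tournament with parameters (4λ+3, 2λ+1, λ), and let Q = (2λ+1)·I − M be its Laplacian. Then for every prime 𝔭 dividing λ+1, the rank of the reduction of Q modulo 𝔭 (as a matrix over the field ℤ/𝔭ℤ) equals 2λ+1. -/
open Matrix

/-- Subadditivity of the matrix rank over a field. -/
theorem Matrix.rank_add_le_rank_add_rank {K m n : Type*} [Field K] [Finite m] [Fintype n]
    (A B : Matrix m n K) : (A + B).rank ≤ A.rank + B.rank := by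
  have hle : LinearMap.range (A + B).mulVecLin ≤
      LinearMap.range A.mulVecLin ⊔ LinearMap.range B.mulVecLin := by
    rw [Matrix.mulVecLin_add]
    exact LinearMap.range_add_le _ _
  exact (Submodule.finrank_mono hle).trans (Submodule.finrank_add_le_finrank_add_finrank _ _)

/-- If `A * Aᵀ = 0` and `A + Aᵀ` differs from `-1` by the all-ones matrix, then the rank of `A`
is determined by its (odd) size. -/
theorem Matrix.rank_eq_of_mul_transpose_eq_zero {K n : Type*} [Field K] [Fintype n]
    [DecidableEq n] {k : ℕ} (hn : Fintype.card n = 2 * k + 1) (A : Matrix n n K) (hmul : A * Aᵀ = 0)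
    (hadd : A + Aᵀ + vecMulVec 1 1 = -1) : A.rank = k := by
  have hupper := rank_add_rank_le_card_of_mul_eq_zero hmul
  have hlower : (A + Aᵀ + vecMulVec 1 1).rank ≤ A.rank + Aᵀ.rank + 1 :=
    (rank_add_le_rank_add_rank _ _).trans
      (add_le_add (rank_add_le_rank_add_rank _ _) (rank_vecMulVec_le _ _))
  rw [hadd, rank_of_isUnit (-1 : Matrix n n K) isUnit_one.neg] at hlower
  simp only [rank_transpose, hn] at hupper hlower
  omega

theorem drt_p_rank (lam : ℕ) (hlam : 0 < lam)
    (M : Matrix (Fin (4*lam+3)) (Fin (4*lam+3)) ℤ)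
    (hM01 : ∀ i j, M i j = 0 ∨ M i j = 1)
    (hMdiag : ∀ i, M i i = 0)
    (hMskew : M + Mᵀ = Matrix.of (fun _ _ => 1) - 1)
    (hMMt : M * Mᵀ = ((lam : ℤ) + 1) • (1 : Matrix (Fin (4*lam+3)) (Fin (4*lam+3)) ℤ)
      + (lam : ℤ) • Matrix.of (fun _ _ => 1))
    (Q : Matrix (Fin (4*lam+3)) (Fin (4*lam+3)) ℤ)
    (hQ : Q = (2*(lam:ℤ)+1) • (1 : Matrix (Fin (4*lam+3)) (Fin (4*lam+3)) ℤ) - M)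
    (p : ℕ) (hp : p.Prime) (hdvd : p ∣ lam + 1) :
    (Q.map (Int.cast : ℤ → ZMod p)).rank = 2*lam+1 := by
  have : Fact p.Prime := ⟨hp⟩
  have hlam_p : (lam : ZMod p) + 1 = 0 := by
    exact_mod_cast (ZMod.natCast_eq_zero_iff (lam + 1) p).mpr hdvd
  have hMt : Mᵀ = Matrix.of (fun _ _ => 1) - 1 - M := by rw [← hMskew]; abel
  have hQt : Qᵀ = (2 * (lam : ℤ) + 1) • (1 : Matrix _ _ ℤ) - Mᵀ := by
    rw [hQ, transpose_sub, transpose_smul, transpose_one]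
  have hQQt : Q * Qᵀ = ((lam : ℤ) + 1) •
      ((4 * (lam : ℤ) + 3) • (1 : Matrix _ _ ℤ) - Matrix.of (fun _ _ => 1)) := by
    rw [hQt, hQ]
    simp only [sub_mul, mul_sub, smul_mul_assoc, mul_smul_comm, one_mul, mul_one, hMMt]
    rw [hMt]
    module
  have hQ_add : Q + Qᵀ = (4 * (lam : ℤ) + 3) • (1 : Matrix _ _ ℤ) - Matrix.of (fun _ _ => 1) := by
    rw [hQt, hQ, hMt]
    module
  have hmul : Q.map (Int.cast : ℤ → ZMod p) * (Q.map (Int.cast : ℤ → ZMod p))ᵀ = 0 := by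
    have h := congrArg (fun A => A.map (Int.castRingHom (ZMod p))) hQQt
    simp only [Matrix.map_mul] at h
    refine h.trans ?_
    ext i j
    rw [map_apply, Matrix.smul_apply, smul_eq_mul, map_mul]
    simp [hlam_p]
  have hadd : Q.map (Int.cast : ℤ → ZMod p) + (Q.map (Int.cast : ℤ → ZMod p))ᵀ
      + vecMulVec 1 1 = -1 := by
    ext i j
    have h := congrArg (Int.cast : ℤ → ZMod p) (congrFun (congrFun hQ_add i) j)
    simp only [Matrix.add_apply, Matrix.sub_apply, Matrix.smul_apply, transpose_apply, of_apply,
      one_apply, smul_eq_mul] at h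
    push_cast at h
    simp only [Matrix.add_apply, Matrix.neg_apply, transpose_apply, map_apply, vecMulVec_apply,
      Pi.one_apply, one_apply]
    split_ifs at h ⊢
    · linear_combination h + 4 * hlam_p
    · linear_combination h
  refine Matrix.rank_eq_of_mul_transpose_eq_zero ?_ _ hmul hadd
  rw [Fintype.card_fin]
  ring
end

section
/- Let λ be a positive integer, let G be a finite abelian group of order 2λ+1, and let (A,B) be a skew Hadamard difference family with two blocks and parameters (2λ+1, λ, λ−1) in G. Then for every nontrivial additive character χ : G → ℂ*, (2λ+1 − χ(A))·(2λ+1 − χ(−A)) − χ(B)·(1 + χ(B)) = (4λ+3)·(λ+1). -/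
open Matrix Finset Pointwise

/-- A skew Hadamard difference family with two blocks and parameters
`(2λ+1, λ, λ−1)` in a finite abelian group `G`. -/
def IsSDF2 {G : Type} [AddCommGroup G] [Fintype G] [DecidableEq G]
    (lam : ℕ) (A B : Finset G) : Prop :=
  A ∩ (-A) = ∅ ∧ A ∪ (-A) = Finset.univ \ {0} ∧
  B ∩ (-B) = ∅ ∧ B ∪ (-B) = Finset.univ \ {0} ∧
  ∀ g : G, g ≠ 0 →
    ((A ×ˢ A).filter (fun p => p.1 - p.2 = g)).card
      + ((B ×ˢ B).filter (fun p => p.1 - p.2 = g)).card = lam - 1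

/-- The adjacency matrix of the graph `SZ(G,A,B)`: the vertex `v₀` is `Sum.inl ()`,
the vertex `a_g` is `Sum.inr (Sum.inl g)` and the vertex `b_g` is `Sum.inr (Sum.inr g)`. -/
def szAdj {G : Type} [AddCommGroup G] [DecidableEq G] (A B : Finset G) :
    Matrix (Unit ⊕ G ⊕ G) (Unit ⊕ G ⊕ G) ℤ :=
  Matrix.of fun v w =>
    match v, w with
    | Sum.inl _, Sum.inr (Sum.inl _) => 1
    | Sum.inr (Sum.inl g), Sum.inr (Sum.inl h) => if h - g ∈ A then 1 else 0
    | Sum.inr (Sum.inl g), Sum.inr (Sum.inr h) => if h - g ∈ B ∪ {0} then 1 else 0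
    | Sum.inr (Sum.inr _), Sum.inl _ => 1
    | Sum.inr (Sum.inr g), Sum.inr (Sum.inl h) => if h - g ∈ B ∪ {0} then 1 else 0
    | Sum.inr (Sum.inr g), Sum.inr (Sum.inr h) => if h - g ∈ -A then 1 else 0
    | _, _ => 0

/-- A product of character sums over `X` and `-X`, grouped by differences. -/
theorem charSum_mul_charSum_neg {G : Type} [AddCommGroup G] [Fintype G] [DecidableEq G]
    (X : Finset G) (χ : AddChar G ℂ) :
    (∑ x ∈ X, χ x) * (∑ x ∈ X, χ (-x))
      = ∑ g : G, (((X ×ˢ X).filter (fun p => p.1 - p.2 = g)).card : ℂ) * χ g := by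
  rw [Finset.sum_mul_sum, ← Finset.sum_product',
    ← Finset.sum_fiberwise (X ×ˢ X) (fun p : G × G => p.1 - p.2)]
  refine Finset.sum_congr rfl fun g _ => ?_
  rw [← nsmul_eq_mul, ← Finset.sum_const]
  refine Finset.sum_congr rfl fun p hp => ?_
  rw [← (Finset.mem_filter.mp hp).2, sub_eq_add_neg, AddChar.map_add_eq_mul]

/-- The zero difference occurs `|X|` times. -/
theorem card_filter_sub_eq_zero {G : Type} [AddCommGroup G] [DecidableEq G] (X : Finset G) :
    ((X ×ˢ X).filter (fun p => p.1 - p.2 = 0)).card = X.card := by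
  simp only [sub_eq_zero, ← Finset.diag_card X]
  congr 1
  ext p
  simp only [Finset.mem_filter, Finset.mem_product, Finset.mem_diag]
  constructor
  · exact fun h => ⟨h.1.1, h.2⟩
  · exact fun h => ⟨⟨h.1, h.2 ▸ h.1⟩, h.2⟩

/-- A skew set in a group of order `2 * lam + 1` has `lam` elements. -/
theorem card_of_skew {G : Type} [AddCommGroup G] [Fintype G] [DecidableEq G]
    {lam : ℕ} (hG : Fintype.card G = 2*lam+1) {X : Finset G}
    (h1 : X ∩ (-X) = ∅) (h2 : X ∪ (-X) = Finset.univ \ {0}) : X.card = lam := by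
  have h := Finset.card_union_of_disjoint (Finset.disjoint_iff_inter_eq_empty.mpr h1)
  rw [h2, Finset.card_sdiff_of_subset (Finset.subset_univ _), Finset.card_univ, hG,
    Finset.card_neg, Finset.card_singleton] at h
  omega

/-- The sum of a nontrivial character over the nonzero elements is `-1`. -/
theorem sum_sdiff_zero_of_nontrivial {G : Type} [AddCommGroup G] [Fintype G] [DecidableEq G]
    {χ : AddChar G ℂ} (hχ : ∃ g : G, χ g ≠ 1) :
    ∑ x ∈ Finset.univ \ {0}, χ x = -1 := by
  have h0 : ∑ x, χ x = 0 := AddChar.sum_eq_zero_of_ne_one (AddChar.ne_one_iff.mpr hχ)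
  have h := Finset.sum_sdiff (f := fun x => χ x) (Finset.subset_univ ({0} : Finset G))
  rw [h0, Finset.sum_singleton, AddChar.map_zero_eq_one] at h
  exact eq_neg_of_add_eq_zero_left h

/-- For a skew set `X` and nontrivial `χ`, `χ(X) + χ(-X) = -1`. -/
theorem charSum_add_charSum_neg_of_skew {G : Type} [AddCommGroup G] [Fintype G] [DecidableEq G]
    {χ : AddChar G ℂ} (hχ : ∃ g : G, χ g ≠ 1) {X : Finset G}
    (h1 : X ∩ (-X) = ∅) (h2 : X ∪ (-X) = Finset.univ \ {0}) :
    ∑ x ∈ X, χ x + ∑ x ∈ X, χ (-x) = -1 := by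
  rw [← sum_sdiff_zero_of_nontrivial hχ, ← h2,
    Finset.sum_union (Finset.disjoint_iff_inter_eq_empty.mpr h1), Finset.sum_neg_index]

/-- For a skew difference family and nontrivial `χ`, `χ(A)χ(-A) + χ(B)χ(-B) = lam + 1`. -/
theorem IsSDF2.charSum_mul_add_charSum_mul {G : Type} [AddCommGroup G] [Fintype G]
    [DecidableEq G] {lam : ℕ} (hlam : 0 < lam) (hG : Fintype.card G = 2*lam+1)
    {A B : Finset G} (hSDF : IsSDF2 lam A B) {χ : AddChar G ℂ} (hχ : ∃ g : G, χ g ≠ 1) :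
    (∑ x ∈ A, χ x) * (∑ x ∈ A, χ (-x)) + (∑ x ∈ B, χ x) * (∑ x ∈ B, χ (-x))
      = (lam : ℂ) + 1 := by
  obtain ⟨hA1, hA2, hB1, hB2, hd⟩ := hSDF
  rw [charSum_mul_charSum_neg, charSum_mul_charSum_neg, ← Finset.sum_add_distrib,
    ← Finset.sum_sdiff (Finset.subset_univ ({0} : Finset G)), Finset.sum_singleton,
    card_filter_sub_eq_zero, card_filter_sub_eq_zero, card_of_skew hG hA1 hA2,
    card_of_skew hG hB1 hB2, AddChar.map_zero_eq_one]
  have h : ∀ g ∈ (Finset.univ \ {0} : Finset G),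
      (((A ×ˢ A).filter (fun p => p.1 - p.2 = g)).card : ℂ) * χ g
        + (((B ×ˢ B).filter (fun p => p.1 - p.2 = g)).card : ℂ) * χ g
      = ((lam : ℂ) - 1) * χ g := by
    intro g hg
    rw [← add_mul, ← Nat.cast_add, hd g (by simpa using hg), Nat.cast_pred hlam]
  rw [Finset.sum_congr rfl h, ← Finset.mul_sum, sum_sdiff_zero_of_nontrivial hχ]
  ring


theorem sz_character_determinant {G : Type} [AddCommGroup G] [Fintype G] [DecidableEq G]
    (lam : ℕ) (hlam : 0 < lam) (hG : Fintype.card G = 2*lam+1)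
    (A B : Finset G) (hSDF : IsSDF2 lam A B)
    (χ : AddChar G ℂ) (hχ : ∃ g : G, χ g ≠ 1) :
    ((2*(lam:ℂ)+1) - ∑ x ∈ A, χ x) * ((2*(lam:ℂ)+1) - ∑ x ∈ A, χ (-x))
      - (∑ x ∈ B, χ x) * (1 + ∑ x ∈ B, χ x) = (4*(lam:ℂ)+3) * ((lam:ℂ)+1) := by
  have hAB := hSDF.charSum_mul_add_charSum_mul hlam hG hχ
  obtain ⟨hA1, hA2, hB1, hB2, -⟩ := hSDF
  have hA := charSum_add_charSum_neg_of_skew hχ hA1 hA2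
  have hB := charSum_add_charSum_neg_of_skew hχ hB1 hB2
  linear_combination hAB - (2*(lam:ℂ)+1) * hA - (∑ x ∈ B, χ x) * hB
end
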